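/- arXiv:0901.3441 — 5 statements merged into one kernel-verified Lean document; each statement's English description precedes it below -/
import Mathlib

section
/- Let N be a normal subgroup of a finite group G and let χ be a G-invariant irreducible complex character of N (i.e. χ(n^g) = χ(n) for all n ∈ N, g ∈ G). Suppose there exists an irreducible character ρ of G such that ρ is QSI and the inner product (ρ|_N, χ) is nonzero. Then χ is QSI as a character of N; more precisely, χ is QSI from the subgroup U ∩ N for some suitable conjugate of the inducing subgroup U for ρ. -/
open scoped BigOperators Classical

noncomputable section

/-- `χ` is the character of some finite-dimensional complex representation of `G`. -/
def IsCharacter (G : Type) [Monoid G] (χ : G → ℂ) : Prop :=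
  ∃ V : FDRep ℂ G, χ = V.character

/-- `χ` is an irreducible complex character of `G`, i.e. the character of a simple
finite-dimensional complex representation of `G`. -/
def IsIrreducibleCharacter (G : Type) [Monoid G] (χ : G → ℂ) : Prop :=
  ∃ V : FDRep ℂ G, CategoryTheory.Simple V ∧ χ = V.character

/-- The class function of `G` induced from the function `φ` on the subgroup `U`:
`φ^G(g) = |U|⁻¹ · ∑_{y ∈ G, y⁻¹gy ∈ U} φ(y⁻¹gy)`. -/
def inducedChar {G : Type} [Group G] [Finite G] (U : Subgroup G) (φ : ↥U → ℂ) : G → ℂ :=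
  fun g => (Nat.card ↥U : ℂ)⁻¹ *
    ∑ᶠ y : G, if h : y⁻¹ * g * y ∈ U then φ ⟨y⁻¹ * g * y, h⟩ else 0

/-- `χ` is quasi solvably induced (QSI) from the subgroup `U` and `φ ∈ Irr(U)`:
there is `k ≥ 1` with `k·χ = φ^G`, and `U/ker(φ)` is solvable, where
`ker(φ) = {u ∈ U | φ(u) = φ(1)}`. -/
def IsQSIFrom {G : Type} [Group G] [Finite G] (χ : G → ℂ) (U : Subgroup G)
    (φ : ↥U → ℂ) : Prop :=
  IsIrreducibleCharacter ↥U φ ∧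
  (∃ k : ℕ, 0 < k ∧ ∀ g : G, (k : ℂ) * χ g = inducedChar U φ g) ∧
  ∃ (K : Subgroup ↥U) (hK : K.Normal), (K : Set ↥U) = {u : ↥U | φ u = φ 1} ∧
    (letI := hK; IsSolvable (↥U ⧸ K))

/-- `χ` is QSI from some subgroup `U ≤ G` and some `φ ∈ Irr(U)`. -/
def IsQSI {G : Type} [Group G] [Finite G] (χ : G → ℂ) : Prop :=
  ∃ (U : Subgroup G) (φ : ↥U → ℂ), IsQSIFrom χ U φ

/-- A finite group `G` is QSI if every irreducible complex character of `G` is QSI. -/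
def IsQSIGroup (G : Type) [Group G] [Finite G] : Prop :=
  ∀ χ : G → ℂ, IsIrreducibleCharacter G χ → IsQSI χ

/-- The usual inner product of class functions on a finite group. -/
def charInner {H : Type} [Group H] [Finite H] (α β : H → ℂ) : ℂ :=
  (Nat.card H : ℂ)⁻¹ * ∑ᶠ h : H, α h * starRingEnd ℂ (β h)

section helpers

open CategoryTheory

/-- Extension by zero of a function on a subgroup. -/
def extZero {G : Type} [Group G] (U : Subgroup G) (φ : ↥U → ℂ) (g : G) : ℂ :=
  if h : g ∈ U then φ ⟨g, h⟩ else 0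

/-- Schur's lemma for simple objects of `FDRep ℂ G`. -/
lemma fdrep_schur {G : Type} [Group G] (V : FDRep ℂ G) [Simple V] (T : V →ₗ[ℂ] V)
    (hT : ∀ g v, T (V.ρ g v) = V.ρ g (T v)) : ∃ c : ℂ, T = c • (1 : V →ₗ[ℂ] V) := by
  let f : V ⟶ V := ⟨InducedCategory.homMk (ModuleCat.ofHom T), fun g => by
    ext1
    ext v
    exact hT g v⟩
  obtain ⟨c, hc⟩ := (finrank_eq_one_iff_of_nonzero' (𝟙 V) (id_nonzero V)).mp
    (finrank_endomorphism_simple_eq_one ℂ V) f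
  refine ⟨c, ?_⟩
  have : f.hom.hom.hom = (c • 𝟙 V : V ⟶ V).hom.hom.hom := by rw [hc]
  exact this

lemma fdrep_finrank_ne_zero {G : Type} [Group G] (V : FDRep ℂ G) [Simple V] :
    Module.finrank ℂ V ≠ 0 := by
  intro h
  have hs := Module.finrank_zero_iff.mp h
  apply id_nonzero V
  ext v
  exact Subsingleton.elim (α := V) _ _

open scoped ComplexOrder in
lemma conj_trace_of_pow_eq_one {d : ℕ} (A : Matrix (Fin d) (Fin d) ℂ) (n : ℕ) (hn : 0 < n)
    (hA : A ^ n = 1) (B : Matrix (Fin d) (Fin d) ℂ) (hB : A * B = 1) :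
    B.trace = starRingEnd ℂ A.trace := by
  let S : Matrix (Fin d) (Fin d) ℂ := ∑ i ∈ Finset.range n, (A ^ i).conjTranspose * A ^ i
  have hS : S.PosDef := by
    obtain ⟨m, rfl⟩ : ∃ m, n = m + 1 := ⟨n - 1, by omega⟩
    simp only [S]
    rw [Finset.sum_range_succ']
    refine Matrix.PosDef.posSemidef_add (Matrix.posSemidef_sum _ fun i _ => ?_) ?_
    · exact Matrix.posSemidef_conjTranspose_mul_self _
    · simpa using Matrix.PosDef.one
  have hinv : A.conjTranspose * S * A = S := by
    have h1 : A.conjTranspose * S * A =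
        ∑ i ∈ Finset.range n, (A ^ (i + 1)).conjTranspose * A ^ (i + 1) := by
      simp only [S, Finset.mul_sum, Finset.sum_mul]
      refine Finset.sum_congr rfl fun i _ => ?_
      rw [pow_succ, Matrix.conjTranspose_mul]
      simp only [mul_assoc]
    have h2 := Finset.sum_range_succ (fun i => (A ^ i).conjTranspose * A ^ i) n
    rw [Finset.sum_range_succ', hA] at h2
    rw [h1]
    simpa [S] using h2
  have hdet : IsUnit S.det := (Matrix.isUnit_iff_isUnit_det _).mp hS.isUnit
  have h3 : A.conjTranspose * S = S * B := by
    calc A.conjTranspose * S = A.conjTranspose * S * (A * B) := by rw [hB, mul_one]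
      _ = A.conjTranspose * S * A * B := by simp only [mul_assoc]
      _ = S * B := by rw [hinv]
  have h4 : B = S⁻¹ * (A.conjTranspose * S) := by
    rw [h3, ← mul_assoc, Matrix.nonsing_inv_mul _ hdet, one_mul]
  rw [h4, Matrix.trace_mul_comm, mul_assoc, Matrix.mul_nonsing_inv _ hdet, mul_one,
    Matrix.trace_conjTranspose]
  rfl

lemma char_inv_eq_conj {G : Type} [Group G] [Finite G] {V : Type} [AddCommGroup V] [Module ℂ V]
    [FiniteDimensional ℂ V] (σ : Representation ℂ G V) (g : G) :
    σ.character g⁻¹ = starRingEnd ℂ (σ.character g) := by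
  let b := Module.finBasis ℂ V
  unfold Representation.character
  rw [LinearMap.trace_eq_matrix_trace ℂ b, LinearMap.trace_eq_matrix_trace ℂ b]
  refine conj_trace_of_pow_eq_one _ (Nat.card G) Nat.card_pos ?_ _ ?_
  · rw [LinearMap.toMatrix_pow, ← map_pow, pow_card_eq_one', map_one, LinearMap.toMatrix_one]
  · rw [← LinearMap.toMatrix_mul, ← map_mul, mul_inv_cancel, map_one, LinearMap.toMatrix_one]

lemma eq_one_of_trace {V : Type} [AddCommGroup V] [Module ℂ V]
    [FiniteDimensional ℂ V] (A : Module.End ℂ V) (n : ℕ) (hn : 0 < n)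
    (hA : A ^ n = 1) (ht : LinearMap.trace ℂ V A = Module.finrank ℂ V) : A = 1 := by
  have hsp : A.charpoly.Splits := IsAlgClosed.splits _
  have hcard : Multiset.card A.charpoly.roots = Module.finrank ℂ V := by
    rw [← hsp.natDegree_eq_card_roots, LinearMap.charpoly_natDegree]
  have hnorm : ∀ μ ∈ A.charpoly.roots, ‖μ‖ = 1 := by
    intro μ hμ
    have hr : A.HasEigenvalue μ :=
      (Module.End.hasEigenvalue_iff_isRoot_charpoly A μ).mpr (Polynomial.isRoot_of_mem_roots hμ)
    obtain ⟨v, hv⟩ := hr.exists_hasEigenvector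
    have h1 := hv.pow_apply n
    rw [hA, Module.End.one_apply] at h1
    have h2 : μ ^ n = 1 := by
      have : (μ ^ n - 1) • v = 0 := by rw [sub_smul, ← h1, one_smul, sub_self]
      rcases smul_eq_zero.mp this with h | h
      · exact sub_eq_zero.mp h
      · exact absurd h hv.2
    exact Complex.norm_eq_one_of_pow_eq_one h2 hn.ne'
  rw [Module.End.trace_eq_sum_roots_charpoly_of_splits hsp, ← hcard] at ht
  have key : ∀ s : Multiset ℂ, (∀ μ ∈ s, ‖μ‖ = 1) → s.sum.re ≤ Multiset.card s ∧
      (s.sum.re = Multiset.card s → ∀ μ ∈ s, μ = 1) := by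
    intro s
    induction s using Multiset.induction_on with
    | empty => simp
    | cons a s ih =>
      intro h
      obtain ⟨h1, h2⟩ := ih (fun μ hμ => h μ (Multiset.mem_cons_of_mem hμ))
      have ha := h a (Multiset.mem_cons_self a s)
      have hre : a.re ≤ 1 := ha ▸ Complex.re_le_norm a
      rw [Multiset.sum_cons, Multiset.card_cons, Complex.add_re]
      push_cast
      refine ⟨by linarith, fun heq μ hμ => ?_⟩
      rcases Multiset.mem_cons.mp hμ with rfl | hμ
      · have h3 : μ.re = 1 := by linarith
        have h4 : μ.re * μ.re + μ.im * μ.im = 1 := by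
          rw [← Complex.normSq_apply, Complex.normSq_eq_norm_sq, ha, one_pow]
        apply Complex.ext
        · simpa using h3
        · rw [h3] at h4
          have : μ.im * μ.im = 0 := by linarith
          simpa using this
      · exact h2 (by linarith) μ hμ
  have hall := (key _ hnorm).2 (by rw [ht]; simp)
  have hcp : A.charpoly = (Polynomial.X - Polynomial.C 1) ^ Module.finrank ℂ V := by
    rw [hsp.eq_prod_roots_of_monic A.charpoly_monic, Multiset.eq_replicate_of_mem hall, hcard]
    simp
  have hnil : IsNilpotent (A - 1) := by
    refine ⟨Module.finrank ℂ V, ?_⟩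
    have := LinearMap.aeval_self_charpoly A
    rw [hcp] at this
    simpa using this
  have hss : A.IsSemisimple := by
    refine Module.End.isSemisimple_of_squarefree_aeval_eq_zero
      (p := Polynomial.X ^ n - Polynomial.C 1) ?_ ?_
    · exact (Polynomial.separable_X_pow_sub_C (1 : ℂ) (by exact_mod_cast hn.ne')
        one_ne_zero).squarefree
    · simp [hA]
  have hss' : (A - 1).IsSemisimple := by
    refine Module.End.IsSemisimple.sub_of_commute (Commute.one_right A) hss ?_
    exact Module.End.isSemisimple_id
  exact sub_eq_zero.mp (Module.End.eq_zero_of_isNilpotent_isSemisimple hnil hss')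

lemma inducedChar_eq {G : Type} [Group G] [Fintype G] (U : Subgroup G) (φ : ↥U → ℂ) (g : G) :
    inducedChar U φ g = (Nat.card ↥U : ℂ)⁻¹ * ∑ y : G, extZero U φ (y⁻¹ * g * y) := by
  unfold inducedChar
  rw [finsum_eq_sum_of_fintype]
  rfl

section schur

variable {N : Type} [Group N] [Fintype N] (X : FDRep ℂ N) [Simple X]

lemma char_one_ne_zero : X.character 1 ≠ 0 := by
  rw [FDRep.char_one]
  exact_mod_cast fdrep_finrank_ne_zero X

/-- The scalar `|N| / χ(1)`. -/
def lam (X : FDRep ℂ N) : ℂ := (Nat.card N : ℂ) / X.character 1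

lemma natCard_ne_zero (N : Type) [Group N] [Finite N] : (Nat.card N : ℂ) ≠ 0 := by
  exact_mod_cast Nat.card_pos.ne'

lemma lam_ne_zero : lam X ≠ 0 := div_ne_zero (natCard_ne_zero N) (char_one_ne_zero X)

lemma schur_avg (a b : N) :
    ∑ x : N, X.character (x * a * x⁻¹ * b) = lam X * X.character a * X.character b := by
  obtain ⟨c, hc⟩ := fdrep_schur X (∑ x : N, X.ρ (x * a * x⁻¹)) (by
    intro g v
    simp only [LinearMap.sum_apply, map_sum]
    refine Fintype.sum_equiv (Equiv.mulLeft g⁻¹) _ _ fun x => ?_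
    simp only [Equiv.coe_mulLeft, ← Module.End.mul_apply, ← map_mul]
    congr 2
    group)
  have h1 : (Nat.card N : ℂ) * X.character a = c * X.character 1 := by
    have := congrArg (LinearMap.trace ℂ X) hc
    rw [map_sum, map_smul, LinearMap.trace_one, ← FDRep.char_one] at this
    have h2 : ∀ x : N, (LinearMap.trace ℂ X) (X.ρ (x * a * x⁻¹)) = X.character a :=
      fun x => FDRep.char_conj X a x
    simp only [h2] at this
    simpa using this
  have h3 : ∑ x : N, X.character (x * a * x⁻¹ * b) = c * X.character b := by
    have := congrArg (fun T => LinearMap.trace ℂ X (T * X.ρ b)) hc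
    simp only [Finset.sum_mul, map_sum, ← map_mul, smul_mul_assoc, one_mul, map_smul] at this
    exact this
  have h4 : c = lam X * X.character a := by
    have := char_one_ne_zero X
    unfold lam
    field_simp
    rw [h1]
  rw [h3, h4]

lemma char_conv (n : N) :
    ∑ m : N, X.character m⁻¹ * X.character (m * n) = lam X * X.character n := by
  obtain ⟨c, hc⟩ := fdrep_schur X (∑ m : N, X.character m⁻¹ • X.ρ m) (by
    intro g v
    simp only [LinearMap.sum_apply, map_sum, LinearMap.smul_apply, map_smul]
    refine Fintype.sum_equiv (MulAut.conj g⁻¹).toEquiv _ _ fun x => ?_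
    simp only [MulEquiv.toEquiv_eq_coe, EquivLike.coe_coe, MulAut.conj_apply,
      ← Module.End.mul_apply, ← map_mul]
    congr 1
    · rw [← FDRep.char_conj X x⁻¹ g⁻¹]
      congr 1
      group
    · congr 2
      group)
  have h1 : (Nat.card N : ℂ) = c * X.character 1 := by
    have := congrArg (LinearMap.trace ℂ X) hc
    rw [map_sum, map_smul, LinearMap.trace_one, ← FDRep.char_one] at this
    simp only [map_smul] at this
    rw [← (FDRep.simple_iff_char_is_norm_one X).mp inferInstance]
    rw [smul_eq_mul] at this
    rw [← this]
    refine Finset.sum_congr rfl fun m _ => ?_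
    rw [smul_eq_mul, mul_comm]
    rfl
  have h3 : ∑ m : N, X.character m⁻¹ * X.character (m * n) = c * X.character n := by
    have := congrArg (fun T => LinearMap.trace ℂ X (T * X.ρ n)) hc
    simp only [Finset.sum_mul, map_sum, ← map_mul, smul_mul_assoc, one_mul, map_smul] at this
    exact this
  have h4 : c = lam X := by
    have := char_one_ne_zero X
    unfold lam
    field_simp
    rw [h1]
  rw [h3, h4]

/-- The (unnormalised) central idempotent of `χ` acting on a representation. -/
def cent (X : FDRep ℂ N) {Y : Type} [AddCommGroup Y] [Module ℂ Y] (τ : Representation ℂ N Y) :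
    Module.End ℂ Y := ∑ m : N, X.character m⁻¹ • τ m

lemma cent_sq {Y : Type} [AddCommGroup Y] [Module ℂ Y] (τ : Representation ℂ N Y) :
    cent X τ * cent X τ = lam X • cent X τ := by
  unfold cent
  rw [Finset.sum_mul_sum]
  have : ∀ a : N, ∑ b : N, X.character a⁻¹ • τ a * X.character b⁻¹ • τ b =
      ∑ m : N, (X.character a⁻¹ * X.character (a * m⁻¹)) • τ m := by
    intro a
    refine Fintype.sum_equiv (Equiv.mulLeft a) _ _ fun b => ?_
    rw [smul_mul_smul_comm, ← map_mul, Equiv.coe_mulLeft]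
    congr 2
    rw [mul_inv_rev, ← mul_assoc, FDRep.char_conj]
  simp only [this]
  rw [Finset.sum_comm, Finset.smul_sum]
  refine Finset.sum_congr rfl fun m _ => ?_
  rw [← Finset.sum_smul, char_conv, mul_smul]

lemma classfun_eq (α : N → ℂ) (hcl : ∀ x n, α (x * n * x⁻¹) = α n)
    (hα : ∀ n, lam X * α n = ∑ m : N, X.character m⁻¹ * α (m * n)) (n : N) :
    (Nat.card N : ℂ) * α n = (∑ m : N, X.character m⁻¹ * α m) * X.character n := by
  have h1 : ∀ n, lam X * α n = ∑ m : N, X.character (n * m⁻¹) * α m := by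
    intro n
    rw [hα]
    refine Fintype.sum_equiv (Equiv.mulRight n) _ _ fun m => ?_
    rw [Equiv.coe_mulRight, mul_inv_rev, mul_inv_cancel_left]
  have h2 : (Nat.card N : ℂ) * (lam X * α n) =
      ∑ x : N, ∑ m : N, X.character (x * n * x⁻¹ * m⁻¹) * α m := by
    have : ∀ x : N, ∑ m : N, X.character (x * n * x⁻¹ * m⁻¹) * α m = lam X * α n := by
      intro x
      rw [← h1, hcl]
    simp [this]
  rw [Finset.sum_comm] at h2
  simp only [← Finset.sum_mul, schur_avg] at h2
  apply mul_left_cancel₀ (lam_ne_zero X)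
  rw [mul_left_comm, h2, Finset.sum_mul, Finset.mul_sum]
  refine Finset.sum_congr rfl fun m _ => ?_
  ring

end schur

section operators

variable {N : Type} [Group N] [Fintype N] (H : Subgroup N) {Y : Type} [AddCommGroup Y]
  [Module ℂ Y] (κ : Representation ℂ ↥H Y)

/-- Right translation on functions. -/
def rightTr (N Y : Type) [Group N] [AddCommGroup Y] [Module ℂ Y] :
    Representation ℂ N (N → Y) where
  toFun x := LinearMap.funLeft ℂ Y (· * x)
  map_one' := by ext; simp [LinearMap.funLeft]
  map_mul' x y := by
    refine LinearMap.ext fun f => funext fun n => ?_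
    simp [LinearMap.funLeft, mul_assoc]

@[simp] lemma rightTr_apply (x : N) (f : N → Y) (n : N) : rightTr N Y x f n = f (n * x) := rfl

/-- Projection onto the coinduced module. -/
def projC : Module.End ℂ (N → Y) where
  toFun f n := (Nat.card ↥H : ℂ)⁻¹ • ∑ h : ↥H, κ h⁻¹ (f ((h : N) * n))
  map_add' f g := by
    funext n
    simp [Finset.sum_add_distrib]
  map_smul' c f := by
    funext n
    simp [Finset.smul_sum, smul_comm c]

lemma projC_apply (f : N → Y) (n : N) :
    projC H κ f n = (Nat.card ↥H : ℂ)⁻¹ • ∑ h : ↥H, κ h⁻¹ (f ((h : N) * n)) := rfl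

lemma projC_idem : projC H κ * projC H κ = projC H κ := by
  refine LinearMap.ext fun f => funext fun n => ?_
  rw [Module.End.mul_apply, projC_apply]
  have : ∀ h : ↥H, κ h⁻¹ (projC H κ f (h * n)) = projC H κ f n := by
    intro h
    rw [projC_apply, projC_apply, map_smul, map_sum]
    congr 1
    refine Fintype.sum_equiv (Equiv.mulRight h) _ _ fun k => ?_
    rw [← Module.End.mul_apply, ← map_mul, Equiv.coe_mulRight, mul_inv_rev, Subgroup.coe_mul,
      mul_assoc]
  simp only [this]
  rw [Finset.sum_const, Finset.card_univ, ← Nat.card_eq_fintype_card, ← Nat.cast_smul_eq_nsmul ℂ,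
    smul_smul, inv_mul_cancel₀ (natCard_ne_zero ↥H), one_smul]

lemma projC_comm (x : N) : projC H κ * rightTr N Y x = rightTr N Y x * projC H κ := by
  refine LinearMap.ext fun f => funext fun n => ?_
  simp [projC_apply, mul_assoc]

lemma trace_pi [FiniteDimensional ℂ Y] (F : Module.End ℂ (N → Y)) :
    LinearMap.trace ℂ (N → Y) F = ∑ n : N, LinearMap.trace ℂ Y
      (LinearMap.proj n ∘ₗ F ∘ₗ LinearMap.single ℂ (fun _ : N => Y) n) := by
  have h : F = ∑ n : N, (F ∘ₗ LinearMap.single ℂ (fun _ : N => Y) n) ∘ₗ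
      (LinearMap.proj n : (N → Y) →ₗ[ℂ] Y) := by
    refine LinearMap.ext fun f => ?_
    simp only [LinearMap.sum_apply, LinearMap.comp_apply, ← map_sum]
    congr 1
    exact (LinearMap.sum_single_apply (fun _ : N => Y) f).symm
  conv_lhs => rw [h]
  rw [map_sum]
  refine Finset.sum_congr rfl fun n _ => ?_
  rw [LinearMap.trace_comp_comm']

lemma trace_projC [FiniteDimensional ℂ Y] (x : N) :
    LinearMap.trace ℂ (N → Y) (projC H κ * rightTr N Y x) = inducedChar H κ.character x := by
  rw [trace_pi, inducedChar_eq, Finset.mul_sum]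
  refine Fintype.sum_equiv (Equiv.inv N) _ _ fun n => ?_
  have h1 : (LinearMap.proj n ∘ₗ (projC H κ * rightTr N Y x) ∘ₗ
      LinearMap.single ℂ (fun _ : N => Y) n) = (Nat.card ↥H : ℂ)⁻¹ •
        ∑ h : ↥H, if (h : N) = n * x⁻¹ * n⁻¹ then κ h⁻¹ else 0 := by
    refine LinearMap.ext fun v => ?_
    simp only [LinearMap.comp_apply, LinearMap.proj_apply, Module.End.mul_apply, projC_apply,
      rightTr_apply, LinearMap.smul_apply, LinearMap.sum_apply]
    congr 1
    refine Finset.sum_congr rfl fun h _ => ?_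
    have he : (h : N) * n * x = n ↔ (h : N) = n * x⁻¹ * n⁻¹ := by
      constructor
      · intro e
        rw [eq_mul_inv_iff_mul_eq, eq_mul_inv_iff_mul_eq, e]
      · intro e
        rw [e]
        group
    by_cases hh : (h : N) = n * x⁻¹ * n⁻¹
    · rw [if_pos hh, he.mpr hh]
      simp
    · rw [if_neg hh]
      simp [Pi.single_apply, mt he.mp hh]
  rw [h1, map_smul, smul_eq_mul, map_sum]
  congr 1
  rw [Equiv.inv_apply, inv_inv]
  unfold extZero
  split_ifs with hx
  · have hx' : n * x⁻¹ * n⁻¹ ∈ H := by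
      have := H.inv_mem hx
      simpa [mul_assoc] using this
    rw [Finset.sum_eq_single ⟨n * x⁻¹ * n⁻¹, hx'⟩]
    · rw [if_pos rfl]
      unfold Representation.character
      congr 2
      ext
      simp [mul_assoc]
    · intro b _ hb
      rw [if_neg (fun e => hb (Subtype.ext e)), map_zero]
    · simp
  · refine Finset.sum_eq_zero fun h _ => ?_
    rw [if_neg, map_zero]
    intro e
    apply hx
    have := H.inv_mem h.2
    rw [e] at this
    simpa [mul_assoc] using this

/-- The defect operator. -/
def defect (X : FDRep ℂ N) : Module.End ℂ (N → Y) :=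
  projC H κ * (1 - (lam X)⁻¹ • cent X (rightTr N Y))

lemma projC_cent (X : FDRep ℂ N) :
    projC H κ * cent X (rightTr N Y) = cent X (rightTr N Y) * projC H κ := by
  unfold cent
  simp only [Finset.mul_sum, Finset.sum_mul, mul_smul_comm, smul_mul_assoc, projC_comm]

lemma defect_idem (X : FDRep ℂ N) [Simple X] : IsIdempotentElem (defect H κ X) := by
  have hl := lam_ne_zero X
  have hc : Commute (projC H κ) (1 - (lam X)⁻¹ • cent X (rightTr N Y)) := by
    refine Commute.sub_right (Commute.one_right _) (Commute.smul_right ?_ _)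
    exact projC_cent H κ X
  have h2 : IsIdempotentElem ((lam X)⁻¹ • cent X (rightTr N Y)) := by
    unfold IsIdempotentElem
    rw [smul_mul_smul_comm, cent_sq, smul_smul]
    congr 1
    field_simp
  exact IsIdempotentElem.mul_of_commute hc (projC_idem H κ) h2.one_sub

lemma trace_defect [FiniteDimensional ℂ Y] (X : FDRep ℂ N) (x : N) :
    LinearMap.trace ℂ (N → Y) (defect H κ X * rightTr N Y x) =
      inducedChar H κ.character x -
        (lam X)⁻¹ * ∑ m : N, X.character m⁻¹ * inducedChar H κ.character (m * x) := by
  have : defect H κ X * rightTr N Y x = projC H κ * rightTr N Y x -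
      (lam X)⁻¹ • ∑ m : N, X.character m⁻¹ • (projC H κ * rightTr N Y (m * x)) := by
    unfold defect cent
    simp only [mul_sub, mul_one, sub_mul, mul_smul_comm, smul_mul_assoc, Finset.mul_sum,
      Finset.sum_mul, map_mul, mul_assoc]
  rw [this, map_sub, map_smul, map_sum, trace_projC]
  simp only [map_smul, trace_projC, smul_eq_mul]

end operators

lemma exists_irreducible_sub {H : Type} [Group H] {Y : Type} [AddCommGroup Y]
    [Module ℂ Y] [FiniteDimensional ℂ Y] (κ : Representation ℂ H Y)
    (hY : Module.finrank ℂ Y ≠ 0) :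
    ∃ p : Subrepresentation κ, p.toRepresentation.IsIrreducible := by
  have hex : ∃ n : ℕ, ∃ p : Subrepresentation κ, Module.finrank ℂ p.toSubmodule = n ∧ n ≠ 0 :=
    ⟨_, ⊤, rfl, by
      have : (⊤ : Subrepresentation κ).toSubmodule = ⊤ := rfl
      rw [this, finrank_top]
      exact hY⟩
  obtain ⟨p, hp, hp0⟩ := Nat.find_spec hex
  refine ⟨p, ?_⟩
  have hmin : ∀ q : Subrepresentation κ, Module.finrank ℂ q.toSubmodule ≠ 0 →
      Module.finrank ℂ p.toSubmodule ≤ Module.finrank ℂ q.toSubmodule := by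
    intro q hq
    rw [hp]
    exact Nat.find_min' hex ⟨q, rfl, hq⟩
  rw [← hp] at hp0
  have hbt : ∀ s : Subrepresentation p.toRepresentation, s = ⊥ ∨ s = ⊤ := by
    intro s
    by_cases h0 : Module.finrank ℂ s.toSubmodule = 0
    · left
      apply Subrepresentation.toSubmodule_injective
      exact Submodule.finrank_eq_zero.mp h0
    · right
      apply Subrepresentation.toSubmodule_injective
      let q : Subrepresentation κ := ⟨s.toSubmodule.map p.toSubmodule.subtype, by
        rintro g _ ⟨v, hv, rfl⟩
        exact ⟨p.toRepresentation g v, s.apply_mem_toSubmodule g hv, rfl⟩⟩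
      have hq : Module.finrank ℂ q.toSubmodule = Module.finrank ℂ s.toSubmodule :=
        (Submodule.equivMapOfInjective _ p.toSubmodule.injective_subtype _).finrank_eq.symm
      have := hmin q (by rwa [hq])
      rw [hq] at this
      exact Submodule.eq_top_of_finrank_eq (le_antisymm (Submodule.finrank_le _) this)
  have hnt : (⊥ : Subrepresentation p.toRepresentation) ≠ ⊤ := by
    intro h
    have h1 : (⊥ : Submodule ℂ p.toSubmodule) = ⊤ :=
      congrArg Subrepresentation.toSubmodule h
    have h2 := finrank_top ℂ p.toSubmodule
    rw [← h1, finrank_bot] at h2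
    exact hp0 h2.symm
  have : Nontrivial (Subrepresentation p.toRepresentation) := ⟨⊥, ⊤, hnt⟩
  exact ⟨hbt⟩

lemma simple_of_irreducible {H : Type} [Group H] [Fintype H] {Y : Type} [AddCommGroup Y]
    [Module ℂ Y] [FiniteDimensional ℂ Y] (κ : Representation ℂ H Y) [κ.IsIrreducible] :
    Simple (FDRep.of κ) := by
  rw [FDRep.simple_iff_char_is_norm_one]
  have := invertibleOfNonzero (natCard_ne_zero H)
  have h := Representation.char_orthonormal κ κ
  rw [if_pos ⟨Representation.Equiv.refl κ⟩] at h
  rw [inv_mul_eq_one₀ (natCard_ne_zero H)] at h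
  exact h.symm

lemma defect_sub {N : Type} [Group N] [Fintype N] (H : Subgroup N) {Y : Type} [AddCommGroup Y]
    [Module ℂ Y] (κ : Representation ℂ ↥H Y) (X : FDRep ℂ N) (h0 : defect H κ X = 0)
    (p : Subrepresentation κ) : defect H p.toRepresentation X = 0 := by
  have hP : ∀ (f : N → p.toSubmodule) (n : N), ((projC H p.toRepresentation f n : p.toSubmodule) : Y)
      = projC H κ (fun n => (f n : Y)) n := by
    intro f n
    rw [projC_apply, projC_apply]
    push_cast
    rfl
  refine LinearMap.ext fun f => funext fun n => Subtype.ext ?_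
  unfold defect
  rw [Module.End.mul_apply, hP]
  have := congrFun (LinearMap.congr_fun h0 (fun n => (f n : Y))) n
  unfold defect at this
  rw [Module.End.mul_apply] at this
  convert this using 3
  · simp [cent, LinearMap.sum_apply, Finset.sum_apply]
  · rfl

lemma sum_mul_inducedChar {G M : Type} [Group G] [Fintype G] [Group M] [Fintype M]
    (U : Subgroup G) (φ : ↥U → ℂ) (j : M → G) (c : M → ℂ) (e : G → M ≃ M)
    (hj : ∀ y m, j (e y m) = y⁻¹ * j m * y) (hc : ∀ y m, c (e y m) = c m) :
    ∑ m : M, c m * inducedChar U φ (j m) =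
      (Nat.card ↥U : ℂ)⁻¹ * (Nat.card G * ∑ m : M, c m * extZero U φ (j m)) := by
  simp only [inducedChar_eq]
  have h1 : ∀ m : M, c m * ((Nat.card ↥U : ℂ)⁻¹ * ∑ y : G, extZero U φ (y⁻¹ * j m * y)) =
      (Nat.card ↥U : ℂ)⁻¹ * ∑ y : G, c (e y m) * extZero U φ (j (e y m)) := by
    intro m
    simp only [hj, hc, ← Finset.mul_sum]
    ring
  simp only [h1]
  rw [← Finset.mul_sum, Finset.sum_comm]
  congr 1
  have h2 : ∀ y : G, ∑ m : M, c (e y m) * extZero U φ (j (e y m)) =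
      ∑ m : M, c m * extZero U φ (j m) := fun y => Equiv.sum_comp (e y)
        (fun m => c m * extZero U φ (j m))
  simp [h2]

lemma inducedChar_one {G : Type} [Group G] [Fintype G] (U : Subgroup G) (φ : ↥U → ℂ) :
    inducedChar U φ 1 = (Nat.card ↥U : ℂ)⁻¹ * (Nat.card G * φ 1) := by
  have h : extZero U φ 1 = φ 1 := by
    unfold extZero
    rw [dif_pos U.one_mem]
    rfl
  rw [inducedChar_eq]
  simp [h]

lemma sum_extZero {N : Type} [Group N] [Fintype N] (H : Subgroup N) (c : N → ℂ) (ψ : ↥H → ℂ) :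
    ∑ m : N, c m * extZero H ψ m = ∑ h : ↥H, c h * ψ h := by
  rw [← Finset.sum_subset (Finset.subset_univ (Finset.univ.filter (· ∈ H)))]
  · rw [Finset.sum_subtype (p := (· ∈ H)) _ (by simp)]
    refine Finset.sum_congr rfl fun h _ => ?_
    unfold extZero
    rw [dif_pos h.2]
  · intro x _ hx
    have : x ∉ H := by simpa using hx
    unfold extZero
    rw [dif_neg this, mul_zero]

lemma qsi_core {N : Type} [Group N] [Fintype N] (X : FDRep ℂ N) [Simple X] (H : Subgroup N)
    {Y : Type} [AddCommGroup Y] [Module ℂ Y] [FiniteDimensional ℂ Y]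
    (κ : Representation ℂ ↥H Y) (hY : Module.finrank ℂ Y ≠ 0) (h0 : defect H κ X = 0) :
    ∃ k : ℕ, 0 < k ∧ ∀ n : N, (k : ℂ) * X.character n = inducedChar H κ.character n := by
  have := invertibleOfNonzero (natCard_ne_zero ↥H)
  let res : Representation ℂ ↥H X := MonoidHom.comp X.ρ H.subtype
  have hk := Representation.card_inv_mul_sum_char_mul_char_eq_finrank res κ
  set k := Module.finrank ℂ (Representation.IntertwiningMap res κ)
  have hcl : ∀ x n, inducedChar H κ.character (x * n * x⁻¹) = inducedChar H κ.character n := by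
    intro x n
    rw [inducedChar_eq, inducedChar_eq]
    congr 1
    refine Fintype.sum_equiv (Equiv.mulLeft x⁻¹) _ _ fun y => ?_
    rw [Equiv.coe_mulLeft]
    congr 1
    group
  have hconv : ∀ n, lam X * inducedChar H κ.character n =
      ∑ m : N, X.character m⁻¹ * inducedChar H κ.character (m * n) := by
    intro n
    have := trace_defect H κ X n
    rw [h0, zero_mul, map_zero] at this
    have hl := lam_ne_zero X
    rw [sub_eq_zero.mp this.symm, mul_inv_cancel_left₀ hl]
  have hs := sum_mul_inducedChar H κ.character (fun m : N => m) (fun m => X.character m⁻¹)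
    (fun y => (MulAut.conj y⁻¹).toEquiv) (by intro y m; simp)
    (by
      intro y m
      simp only [MulEquiv.toEquiv_eq_coe, EquivLike.coe_coe, MulAut.conj_apply]
      rw [← FDRep.char_conj X m⁻¹ y⁻¹]
      congr 1
      group)
  rw [sum_extZero H (fun m => X.character m⁻¹)] at hs
  have hk' : (Nat.card ↥H : ℂ)⁻¹ * ∑ h : ↥H, X.character (h : N)⁻¹ * κ.character h = k := by
    rw [← hk]
    congr 1
    refine Finset.sum_congr rfl fun h _ => ?_
    rw [mul_comm]
    rfl
  have hmain : ∀ n : N, (k : ℂ) * X.character n = inducedChar H κ.character n := by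
    intro n
    have h1 := classfun_eq X _ hcl hconv n
    rw [hs, mul_left_comm, hk', mul_assoc] at h1
    exact (mul_left_cancel₀ (natCard_ne_zero N) h1).symm
  refine ⟨k, Nat.pos_of_ne_zero ?_, hmain⟩
  intro hk0
  have h1 := hmain 1
  rw [hk0, Nat.cast_zero, zero_mul, inducedChar_one, Representation.char_one] at h1
  have : (Module.finrank ℂ Y : ℂ) ≠ 0 := by exact_mod_cast hY
  exact mul_ne_zero (inv_ne_zero (natCard_ne_zero ↥H)) (mul_ne_zero (natCard_ne_zero N) this)
    h1.symm

lemma rep_eq_one {H : Type} [Group H] [Finite H] {Y : Type} [AddCommGroup Y] [Module ℂ Y]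
    [FiniteDimensional ℂ Y] (κ : Representation ℂ H Y) (h : H)
    (hh : κ.character h = κ.character 1) : κ h = 1 := by
  refine eq_one_of_trace (κ h) (Nat.card H) Nat.card_pos ?_ ?_
  · rw [← map_pow, pow_card_eq_one', map_one]
  · rw [Representation.char_one] at hh
    exact hh

lemma main_aux (G : Type) [Group G] [Fintype G] (N : Subgroup G) [N.Normal]
    (X : FDRep ℂ ↥N) [Simple X]
    (hinv : ∀ (g n : G) (hn : n ∈ N) (hgn : g⁻¹ * n * g ∈ N),
      X.character ⟨g⁻¹ * n * g, hgn⟩ = X.character ⟨n, hn⟩)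
    (V : FDRep ℂ G) [Simple V]
    (hne : charInner (fun n : ↥N => V.character (n : G)) X.character ≠ 0)
    (U : Subgroup G) (φ : ↥U → ℂ) (hq : IsQSIFrom V.character U φ) :
    ∃ ψ : ↥(U.subgroupOf N) → ℂ, IsQSIFrom X.character (U.subgroupOf N) ψ := by
  obtain ⟨⟨F, hF, rfl⟩, ⟨k, hk0, hk⟩, K, hK, hKφ, hsolv⟩ := hq
  have hl := lam_ne_zero X
  have hmem : ∀ (y : G) (m : ↥N), y⁻¹ * (m : G) * y ∈ N := fun y m => by
    simpa using Subgroup.Normal.conj_mem (inferInstance : N.Normal) (m : G) m.2 y⁻¹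
  -- conjugation as a permutation of `N`
  let e : G → ↥N ≃ ↥N := fun y =>
    { toFun := fun m => ⟨y⁻¹ * (m : G) * y, hmem y m⟩
      invFun := fun m => ⟨y * (m : G) * y⁻¹,
        Subgroup.Normal.conj_mem (inferInstance : N.Normal) (m : G) m.2 y⟩
      left_inv := fun m => by ext; simp [mul_assoc]
      right_inv := fun m => by ext; simp [mul_assoc] }
  have he : ∀ y m, ((e y m : ↥N) : G) = y⁻¹ * (m : G) * y := fun _ _ => rfl
  have hec : ∀ y m, X.character (e y m)⁻¹ = X.character m⁻¹ := by
    intro y m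
    rw [← hinv y (m⁻¹ : ↥N) (m⁻¹).2 (hmem y m⁻¹)]
    congr 1
    ext
    simp [he, mul_assoc]
  -- the central element acts on `V` by the scalar `lam X`
  let τ : Representation ℂ ↥N V := MonoidHom.comp V.ρ N.subtype
  have htr : LinearMap.trace ℂ V (cent X τ) = ∑ m : ↥N, X.character m⁻¹ * V.character (m : G) := by
    unfold cent
    rw [map_sum]
    refine Finset.sum_congr rfl fun m _ => ?_
    rw [map_smul, smul_eq_mul]
    rfl
  have hsum : ∑ m : ↥N, X.character m⁻¹ * V.character (m : G) =
      lam X * V.character 1 := by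
    obtain ⟨c, hc⟩ := fdrep_schur V (cent X τ) (by
      intro g v
      unfold cent
      simp only [LinearMap.sum_apply, map_sum, LinearMap.smul_apply, map_smul]
      refine Fintype.sum_equiv (e g) _ _ fun m => ?_
      rw [hec]
      congr 1
      change V.ρ (m : G) (V.ρ g v) = V.ρ g (V.ρ (g⁻¹ * (m : G) * g) v)
      rw [← Module.End.mul_apply, ← Module.End.mul_apply, ← map_mul, ← map_mul]
      congr 2
      group)
    have h1 : ∑ m : ↥N, X.character m⁻¹ * V.character (m : G) = c * V.character 1 := by
      rw [← htr, hc, map_smul, LinearMap.trace_one, FDRep.char_one, smul_eq_mul]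
    have hc0 : c ≠ 0 := by
      rintro rfl
      apply hne
      unfold charInner
      rw [finsum_eq_sum_of_fintype]
      rw [zero_mul] at h1
      rw [← mul_zero ((Nat.card ↥N : ℂ)⁻¹), ← h1]
      congr 1
      refine Finset.sum_congr rfl fun m _ => ?_
      rw [mul_comm]
      congr 1
      exact (char_inv_eq_conj X.ρ m).symm
    have hsq := congrArg (LinearMap.trace ℂ V) (cent_sq X τ)
    rw [hc, smul_mul_smul_comm, mul_one, smul_smul, map_smul, map_smul, LinearMap.trace_one,
      ← FDRep.char_one, smul_eq_mul, smul_eq_mul] at hsq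
    have h2 := mul_right_cancel₀ (char_one_ne_zero V) hsq
    rw [h1, mul_right_cancel₀ hc0 h2]
  -- transfer to `φ`
  have hφ : ∑ m : ↥N, X.character m⁻¹ * extZero U F.character (m : G) =
      lam X * F.character 1 := by
    have h1 := sum_mul_inducedChar U F.character (fun m : ↥N => (m : G))
      (fun m => X.character m⁻¹) e he hec
    have h2 : ∑ m : ↥N, X.character m⁻¹ * inducedChar U F.character (m : G) =
        lam X * inducedChar U F.character 1 := by
      simp only [← hk]
      rw [mul_left_comm, ← hsum, Finset.mul_sum]
      refine Finset.sum_congr rfl fun m _ => ?_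
      ring
    rw [h1, inducedChar_one, mul_left_comm (lam X), mul_left_comm (lam X)] at h2
    exact mul_left_cancel₀ (natCard_ne_zero G)
      (mul_left_cancel₀ (inv_ne_zero (natCard_ne_zero ↥U)) h2)
  -- restriction to `U ∩ N`
  let r : ↥(U.subgroupOf N) →* ↥U :=
    { toFun := fun h => ⟨((h : ↥N) : G), h.2⟩
      map_one' := rfl
      map_mul' := fun _ _ => rfl }
  let κ : Representation ℂ ↥(U.subgroupOf N) F := MonoidHom.comp F.ρ r
  have hext : ∀ m : ↥N, extZero (U.subgroupOf N) κ.character m = extZero U F.character (m : G) := by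
    intro m
    unfold extZero
    by_cases hm : (m : G) ∈ U
    · rw [dif_pos hm, dif_pos (Subgroup.mem_subgroupOf.mpr hm)]
      rfl
    · rw [dif_neg hm, dif_neg (fun h => hm (Subgroup.mem_subgroupOf.mp h))]
  have hdef : defect (U.subgroupOf N) κ X = 0 := by
    rw [← LinearMap.IsIdempotentElem.trace_eq_zero_iff (defect_idem _ κ X)]
    have h1 := trace_defect (U.subgroupOf N) κ X 1
    rw [map_one, mul_one] at h1
    rw [h1]
    simp only [mul_one]
    have h2 := sum_mul_inducedChar (U.subgroupOf N) κ.character (fun m : ↥N => m)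
      (fun m => X.character m⁻¹) (fun y => e y) (by intro y m; ext; simp [he])
      (fun y m => hec y m)
    simp only [hext] at h2
    rw [h2, hφ, inducedChar_one]
    have h3 : κ.character 1 = F.character 1 := rfl
    rw [h3]
    field_simp
    ring
  obtain ⟨p, hp⟩ := exists_irreducible_sub κ (fdrep_finrank_ne_zero F)
  have hS : Simple (FDRep.of p.toRepresentation) := simple_of_irreducible p.toRepresentation
  refine ⟨p.toRepresentation.character, ⟨FDRep.of p.toRepresentation, hS, rfl⟩, ?_, ?_⟩
  · exact qsi_core X _ p.toRepresentation (fdrep_finrank_ne_zero (FDRep.of p.toRepresentation))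
      (defect_sub _ κ X hdef p)
  · let W : ↥(U.subgroupOf N) →* Module.End ℂ p.toSubmodule := p.toRepresentation
    refine ⟨W.ker, inferInstance, ?_, ?_⟩
    · ext u
      constructor
      · intro hu
        have hu' : p.toRepresentation u = 1 := hu
        change p.toRepresentation.character u = p.toRepresentation.character 1
        unfold Representation.character
        rw [hu', map_one p.toRepresentation]
      · intro hu
        exact rep_eq_one p.toRepresentation u hu
    · let := hK
      let f : ↥(U.subgroupOf N) →* ↥U ⧸ K := (QuotientGroup.mk' K).comp r
      have hle : f.ker ≤ W.ker := by
        intro u hu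
        have h1 : r u ∈ K := (QuotientGroup.eq_one_iff _).mp hu
        have h2 : r u ∈ (K : Set ↥U) := h1
        rw [hKφ] at h2
        have h3 : F.ρ (r u) = 1 := rep_eq_one F.ρ (r u) h2
        change p.toRepresentation u = 1
        refine LinearMap.ext fun v => Subtype.ext ?_
        exact LinearMap.congr_fun h3 (v : F)
      have hsolv' : Group.IsSolvable (↥U ⧸ K) := hsolv
      have h1 : Group.IsSolvable (↥(U.subgroupOf N) ⧸ f.ker) :=
        Group.isSolvable_of_isSolvable_injective (QuotientGroup.kerLift_injective f)
      refine Group.isSolvable_of_surjective (f := QuotientGroup.map f.ker W.ker (MonoidHom.id _) hle) ?_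
      intro x
      obtain ⟨u, rfl⟩ := QuotientGroup.mk_surjective x
      exact ⟨QuotientGroup.mk u, rfl⟩

end helpers

/-- If `N ⊴ G`, `χ ∈ Irr(N)` is `G`-invariant, and some QSI character `ρ ∈ Irr(G)` satisfies
`(ρ|_N, χ) ≠ 0`, then `χ` is QSI, and more precisely `χ` is QSI from `U^g ∩ N` for some
conjugate of the subgroup `U` from which `ρ` is QSI. -/
theorem invariant_char_isQSI_of_inner_ne_zero (G : Type) [Group G] [Finite G]
    (N : Subgroup G) [N.Normal]
    (χ : ↥N → ℂ) (hχirr : IsIrreducibleCharacter ↥N χ)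
    (hinv : ∀ (g n : G) (hn : n ∈ N) (hgn : g⁻¹ * n * g ∈ N),
      χ ⟨g⁻¹ * n * g, hgn⟩ = χ ⟨n, hn⟩)
    (ρ : G → ℂ) (hρirr : IsIrreducibleCharacter G ρ) (hρ : IsQSI ρ)
    (hne : charInner (fun n : ↥N => ρ (n : G)) χ ≠ 0) :
    IsQSI χ ∧
    ∃ (U : Subgroup G) (φ : ↥U → ℂ) (g : G)
      (ψ : ↥((U.map (MulAut.conj g).toMonoidHom).subgroupOf N) → ℂ),
        IsQSIFrom ρ U φ ∧
        IsQSIFrom χ ((U.map (MulAut.conj g).toMonoidHom).subgroupOf N) ψ := by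
  obtain ⟨X, hX, rfl⟩ := hχirr
  obtain ⟨V, hV, rfl⟩ := hρirr
  obtain ⟨U, φ, hq⟩ := hρ
  haveI := Fintype.ofFinite G
  obtain ⟨ψ, hψ⟩ := main_aux G N X hinv V hne U φ hq
  refine ⟨⟨_, ψ, hψ⟩, U, φ, 1, ?_⟩
  have h1 : U.map (MulAut.conj (1 : G)).toMonoidHom = U := by
    ext x
    simp
  rw [h1]
  exact ⟨ψ, hq, hψ⟩
end
end

section
/- Let G be a finite QSI group and N a normal subgroup of G. Then every G-invariant irreducible complex character of N is QSI as a character of N. -/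
open scoped BigOperators Classical

noncomputable section

namespace QSIAux

open CategoryTheory

/-- Bilinear scalar product of functions on a finite group. -/
def ip {H : Type} [Group H] [Fintype H] (α β : H → ℂ) : ℂ :=
  (Nat.card H : ℂ)⁻¹ * ∑ h : H, α h * β h⁻¹

lemma ip_add {H : Type} [Group H] [Fintype H] (α β γ : H → ℂ) :
    ip (α + β) γ = ip α γ + ip β γ := by
  simp [ip, add_mul, Finset.sum_add_distrib, mul_add]

lemma isCharacter_of_rep {H : Type} [Group H] {V : Type} [AddCommGroup V] [Module ℂ V]
    [Module.Finite ℂ V] (ρ : Representation ℂ H V) : IsCharacter H ρ.character :=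
  ⟨FDRep.of ρ, rfl⟩

lemma isCharacter_comp {H K : Type} [Group H] [Group K] {α : H → ℂ} (hα : IsCharacter H α)
    (f : K →* H) : IsCharacter K (fun k => α (f k)) := by
  obtain ⟨V, rfl⟩ := hα
  exact ⟨FDRep.of (V.ρ.comp f), rfl⟩

lemma irr_isCharacter {H : Type} [Group H] {α : H → ℂ} (hα : IsIrreducibleCharacter H α) :
    IsCharacter H α := by
  obtain ⟨V, _, h⟩ := hα
  exact ⟨V, h⟩

lemma char_conj {H : Type} [Group H] {α : H → ℂ} (hα : IsCharacter H α) (g h : H) :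
    α (h * g * h⁻¹) = α g := by
  obtain ⟨V, rfl⟩ := hα
  simp

lemma ip_nat {H : Type} [Group H] [Fintype H] {α β : H → ℂ} (hα : IsCharacter H α)
    (hβ : IsCharacter H β) : ∃ n : ℕ, ip α β = n := by
  obtain ⟨V, rfl⟩ := hα
  obtain ⟨W, rfl⟩ := hβ
  have := invertibleOfNonzero (NeZero.ne (Nat.card H : ℂ))
  exact ⟨_, FDRep.scalar_product_char_eq_finrank_equivariant W V⟩

lemma ip_self {H : Type} [Group H] [Fintype H] {α : H → ℂ} (hα : IsIrreducibleCharacter H α) :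
    ip α α = 1 := by
  obtain ⟨V, hV, rfl⟩ := hα
  have := invertibleOfNonzero (NeZero.ne (Nat.card H : ℂ))
  have h := FDRep.char_orthonormal V V
  rw [if_pos ⟨Iso.refl V⟩] at h
  simpa [ip] using h

lemma ip_ne {H : Type} [Group H] [Fintype H] {α β : H → ℂ} (hα : IsIrreducibleCharacter H α)
    (hβ : IsIrreducibleCharacter H β) (hne : α ≠ β) : ip α β = 0 := by
  obtain ⟨V, hV, rfl⟩ := hα
  obtain ⟨W, hW, rfl⟩ := hβ
  have := invertibleOfNonzero (NeZero.ne (Nat.card H : ℂ))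
  have h := FDRep.char_orthonormal V W
  rw [if_neg] at h
  · simpa [ip] using h
  · rintro ⟨i⟩
    exact hne (FDRep.char_iso i)

lemma irr_of_rep {H : Type} [Group H] [Fintype H] {V : Type} [AddCommGroup V] [Module ℂ V]
    [Module.Finite ℂ V] (ρ : Representation ℂ H V) [ρ.IsIrreducible] :
    IsIrreducibleCharacter H ρ.character := by
  refine ⟨FDRep.of ρ, ?_, rfl⟩
  rw [FDRep.simple_iff_char_is_norm_one]
  have := invertibleOfNonzero (NeZero.ne (Nat.card H : ℂ))
  have h := Representation.card_inv_mul_sum_char_mul_char_eq_finrank ρ ρ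
  rw [Representation.IsIrreducible.finrank_intertwiningMap_self,
    inv_mul_eq_iff_eq_mul₀ (NeZero.ne _)] at h
  exact h.trans (by simp)

lemma char_isCompl {H : Type} [Group H] {V : Type} [AddCommGroup V] [Module ℂ V]
    [Module.Finite ℂ V] (ρ : Representation ℂ H V) (p q : Subrepresentation ρ)
    (h : IsCompl p.toSubmodule q.toSubmodule) :
    ρ.character = p.toRepresentation.character + q.toRepresentation.character := by
  funext g
  let A : Bool → Submodule ℂ V := fun b => if b then p.toSubmodule else q.toSubmodule
  have hA : DirectSum.IsInternal A := by
    rw [DirectSum.isInternal_submodule_iff_isCompl A (i := true) (j := false) (by simp)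
      (by ext x; cases x <;> simp)]
    exact h
  have hf : ∀ i, Set.MapsTo (ρ g) (A i) (A i) := by
    intro i
    cases i
    · exact q.apply_mem_toSubmodule g
    · exact p.apply_mem_toSubmodule g
  have := LinearMap.trace_eq_sum_trace_restrict hA hf
  rw [Fintype.sum_bool] at this
  exact this

lemma decomp_rep {H : Type} [Group H] [Fintype H] (n : ℕ) : ∀ {V : Type} [AddCommGroup V]
    [Module ℂ V] [Module.Finite ℂ V] (ρ : Representation ℂ H V), Module.finrank ℂ V = n →
    ∃ l : List (H → ℂ), (∀ θ ∈ l, IsIrreducibleCharacter H θ) ∧ ρ.character = l.sum := by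
  induction n using Nat.strong_induction_on with
  | _ n ih =>
  intro V _ _ _ ρ hn
  by_cases hirr : ρ.IsIrreducible
  · exact ⟨[ρ.character], by simpa using irr_of_rep ρ, by simp⟩
  by_cases h0 : n = 0
  · refine ⟨[], by simp, ?_⟩
    subst h0
    funext g
    have : Subsingleton V := Module.finrank_zero_iff.mp hn
    have h1 : ρ g = 0 := Subsingleton.elim _ _
    simp [Representation.character, h1]
  have hnt : Nontrivial V := Module.nontrivial_of_finrank_pos (R := ℂ) (by omega)
  have hbt : (⊥ : Subrepresentation ρ) ≠ ⊤ := by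
    intro h
    have : (⊥ : Submodule ℂ V) = ⊤ := congrArg Subrepresentation.toSubmodule h
    exact bot_ne_top this
  have : ∃ p : Subrepresentation ρ, p ≠ ⊥ ∧ p ≠ ⊤ := by
    by_contra hcon
    push Not at hcon
    apply hirr
    have : Nontrivial (Subrepresentation ρ) := ⟨⊥, ⊤, hbt⟩
    exact ⟨fun p => by
      by_cases hp : p = ⊥
      · exact Or.inl hp
      · exact Or.inr (hcon p hp)⟩
  obtain ⟨p, hp0, hp1⟩ := this
  obtain ⟨q, hq⟩ := exists_isCompl p
  have hc : IsCompl p.toSubmodule q.toSubmodule := by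
    rw [isCompl_iff, disjoint_iff, codisjoint_iff] at hq ⊢
    rw [← Subrepresentation.toSubmodule_inf, ← Subrepresentation.toSubmodule_sup, hq.1, hq.2]
    exact ⟨rfl, rfl⟩
  have hsum := Submodule.finrank_add_eq_of_isCompl hc
  have hppos : 0 < Module.finrank ℂ p.toSubmodule := by
    rw [Nat.pos_iff_ne_zero]
    intro h
    exact hp0 (Subrepresentation.toSubmodule_injective (Submodule.finrank_eq_zero.mp h))
  have hplt : Module.finrank ℂ p.toSubmodule < Module.finrank ℂ V := by
    apply Submodule.finrank_lt
    intro h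
    exact hp1 (Subrepresentation.toSubmodule_injective h)
  obtain ⟨l1, hl1, e1⟩ := ih _ (by omega) p.toRepresentation rfl
  obtain ⟨l2, hl2, e2⟩ := ih _ (by omega) q.toRepresentation rfl
  refine ⟨l1 ++ l2, ?_, ?_⟩
  · intro θ hθ
    rcases List.mem_append.mp hθ with h | h
    · exact hl1 _ h
    · exact hl2 _ h
  · rw [char_isCompl ρ p q hc, e1, e2, List.sum_append]

lemma decomp {H : Type} [Group H] [Fintype H] {α : H → ℂ} (hα : IsCharacter H α) :
    ∃ l : List (H → ℂ), (∀ θ ∈ l, IsIrreducibleCharacter H θ) ∧ α = l.sum := by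
  obtain ⟨V, rfl⟩ := hα
  exact decomp_rep _ (V.ρ : Representation ℂ H V) rfl

lemma isCharacter_add {H : Type} [Group H] {α β : H → ℂ} (hα : IsCharacter H α)
    (hβ : IsCharacter H β) : IsCharacter H (α + β) := by
  obtain ⟨V, rfl⟩ := hα
  obtain ⟨W, rfl⟩ := hβ
  refine ⟨FDRep.of (Representation.prod (V.ρ : Representation ℂ H V) (W.ρ : Representation ℂ H W)), ?_⟩
  funext g
  exact (LinearMap.trace_prodMap' (V.ρ g) (W.ρ g)).symm

lemma isCharacter_zero {H : Type} [Group H] : IsCharacter H 0 := by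
  refine ⟨FDRep.of (1 : Representation ℂ H PUnit), ?_⟩
  funext g
  have : Module.finrank ℂ PUnit = 0 := Module.finrank_zero_of_subsingleton
  exact ((LinearMap.trace_one ℂ PUnit).trans (by rw [this]; simp)).symm

lemma isCharacter_list {H : Type} [Group H] (l : List (H → ℂ))
    (hl : ∀ θ ∈ l, IsIrreducibleCharacter H θ) : IsCharacter H l.sum := by
  induction l with
  | nil => exact isCharacter_zero
  | cons a l ih =>
    rw [List.sum_cons]
    exact isCharacter_add (irr_isCharacter (hl a (by simp)))
      (ih fun θ h => hl θ (by simp [h]))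

/-- A nonzero character splits off an irreducible one. -/
lemma split_irr {H : Type} [Group H] [Fintype H] {α : H → ℂ} (hα : IsCharacter H α)
    (h0 : α ≠ 0) : ∃ θ γ, IsIrreducibleCharacter H θ ∧ IsCharacter H γ ∧ α = θ + γ := by
  obtain ⟨l, hl, rfl⟩ := decomp hα
  cases l with
  | nil => simp at h0
  | cons a l =>
    exact ⟨a, l.sum, hl a (by simp), isCharacter_list l fun θ h => hl θ (by simp [h]), by simp⟩

lemma ip_zero_left_of_add {H : Type} [Group H] [Fintype H] {α β θ : H → ℂ}
    (hα : IsCharacter H α) (hβ : IsCharacter H β) (hθ : IsCharacter H θ)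
    (h : ip (α + β) θ = 0) : ip α θ = 0 ∧ ip β θ = 0 := by
  obtain ⟨n, hn⟩ := ip_nat hα hθ
  obtain ⟨m, hm⟩ := ip_nat hβ hθ
  rw [ip_add, hn, hm] at h
  norm_cast at h
  have : n = 0 ∧ m = 0 := by omega
  simp [hn, hm, this]

lemma multiple {H : Type} [Group H] [Fintype H] {α χ : H → ℂ} (hα : IsCharacter H α)
    (h : ∀ θ, IsIrreducibleCharacter H θ → θ ≠ χ → ip α θ = 0) :
    ∃ m : ℕ, ∀ g, α g = m * χ g := by
  obtain ⟨l, hl, rfl⟩ := decomp hα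
  clear hα
  induction l with
  | nil => exact ⟨0, by simp⟩
  | cons a l ih =>
    have hl' : ∀ θ ∈ l, IsIrreducibleCharacter H θ := fun θ h => hl θ (by simp [h])
    have ha := hl a (by simp)
    have hs : ∀ θ, IsIrreducibleCharacter H θ → θ ≠ χ → ip a θ = 0 ∧ ip l.sum θ = 0 := by
      intro θ hθ hne
      have := h θ hθ hne
      rw [List.sum_cons] at this
      exact ip_zero_left_of_add (irr_isCharacter ha) (isCharacter_list l hl')
        (irr_isCharacter hθ) this
    obtain ⟨m, hm⟩ := ih hl' fun θ h1 h2 => (hs θ h1 h2).2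
    have haχ : a = χ := by
      by_contra hne
      have := (hs a ha hne).1
      rw [ip_self ha] at this
      exact one_ne_zero this
    refine ⟨m + 1, fun g => ?_⟩
    rw [List.sum_cons, Pi.add_apply, hm, haχ]
    push_cast
    ring

lemma irr_one_ne_zero {H : Type} [Group H] [Fintype H] {α : H → ℂ}
    (hα : IsIrreducibleCharacter H α) : α 1 ≠ 0 := by
  intro h0
  have h1 := ip_self hα
  obtain ⟨V, _, rfl⟩ := hα
  rw [FDRep.char_one] at h0
  have : Subsingleton V := Module.finrank_zero_iff.mp (by exact_mod_cast h0)
  have h2 : ∀ g, V.character g = 0 := fun g => by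
    have h1 : V.ρ g = 0 := Subsingleton.elim _ _
    simp [FDRep.character, h1]
  simp [ip, h2] at h1

lemma char_one_nat {H : Type} [Group H] {α : H → ℂ}
    (hα : IsCharacter H α) : ∃ n : ℕ, α 1 = n := by
  obtain ⟨V, rfl⟩ := hα
  exact ⟨_, FDRep.char_one V⟩

/-- Norm bound on the trace of a finite order operator, with the equality case. -/
lemma trace_fin_order {V : Type} [AddCommGroup V] [Module ℂ V] [Module.Finite ℂ V]
    (T : Module.End ℂ V) (m : ℕ) (hm : 0 < m) (hT : T ^ m = 1) :
    (LinearMap.trace ℂ V T).re ≤ Module.finrank ℂ V ∧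
      ((LinearMap.trace ℂ V T).re = Module.finrank ℂ V → T = 1) := by
  have hs : T.charpoly.Splits := IsAlgClosed.splits _
  have htr := Module.End.trace_eq_sum_roots_charpoly_of_splits hs
  have hcard : Multiset.card T.charpoly.roots = Module.finrank ℂ V := by
    rw [← hs.natDegree_eq_card_roots, LinearMap.charpoly_natDegree]
  have hroot : ∀ μ ∈ T.charpoly.roots, ‖μ‖ = 1 := by
    intro μ hμ
    have h1 := (Polynomial.mem_roots'.mp hμ).2
    rw [← Module.End.hasEigenvalue_iff_isRoot_charpoly] at h1
    obtain ⟨v, hv⟩ := h1.exists_hasEigenvector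
    have h2 := hv.pow_apply m
    rw [hT] at h2
    have h3 : (μ ^ m - 1) • v = 0 := by
      rw [sub_smul, ← h2]; simp
    rcases smul_eq_zero.mp h3 with h | h
    · exact Complex.norm_eq_one_of_pow_eq_one (sub_eq_zero.mp h) hm.ne'
    · exact absurd h hv.2
  have key : ∀ s : Multiset ℂ, (∀ μ ∈ s, ‖μ‖ = 1) → s.sum.re ≤ Multiset.card s ∧
      (s.sum.re = Multiset.card s → ∀ μ ∈ s, μ = 1) := by
    intro s
    induction s using Multiset.induction_on with
    | empty => simp
    | cons a s ih =>
      intro h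
      obtain ⟨h1, h2⟩ := ih fun μ hμ => h μ (Multiset.mem_cons_of_mem hμ)
      have ha := h a (Multiset.mem_cons_self a s)
      have har : a.re ≤ 1 := ha ▸ Complex.re_le_norm a
      rw [Multiset.sum_cons, Multiset.card_cons, Complex.add_re]
      push_cast
      refine ⟨by linarith, fun heq μ hμ => ?_⟩
      rcases Multiset.mem_cons.mp hμ with rfl | hμ
      · have hre : μ.re = 1 := by linarith
        have hn : μ.re ^ 2 + μ.im ^ 2 = 1 := by
          have := Complex.sq_norm μ
          rw [ha, Complex.normSq_apply] at this
          nlinarith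
        have him : μ.im = 0 := by
          rw [hre] at hn
          have : μ.im ^ 2 = 0 := by linarith
          exact pow_eq_zero_iff (two_ne_zero) |>.mp this
        exact Complex.ext (by simp [hre]) (by simp [him])
      · exact h2 (by linarith) μ hμ
  obtain ⟨k1, k2⟩ := key _ hroot
  refine ⟨by rw [htr, ← hcard]; exact k1, fun heq => ?_⟩
  have hall := k2 (by rw [← htr, heq, hcard])
  have hcp : T.charpoly = (Polynomial.X - Polynomial.C 1) ^ (Module.finrank ℂ V) := by
    have h1 := hs.eq_prod_roots_of_monic T.charpoly_monic
    rw [h1, Multiset.eq_replicate.mpr ⟨hcard, hall⟩]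
    simp
  have hnil : IsNilpotent (T - 1) := by
    refine ⟨Module.finrank ℂ V, ?_⟩
    have := T.aeval_self_charpoly
    rw [hcp] at this
    simpa using this
  have hss : (T - 1).IsSemisimple := by
    have h1 : T.IsSemisimple := by
      apply Module.End.isSemisimple_of_squarefree_aeval_eq_zero
        (p := (Polynomial.X ^ m - 1 : Polynomial ℂ))
      · exact (Polynomial.X_pow_sub_one_separable_iff.mpr (by exact_mod_cast hm.ne')).squarefree
      · simp [hT]
    have h2 := (Module.End.isSemisimple_sub_algebraMap_iff (f := T) (μ := (1 : ℂ))).mpr h1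
    simpa using h2
  exact sub_eq_zero.mp (Module.End.eq_zero_of_isNilpotent_isSemisimple hnil hss)

lemma char_re_le {H : Type} [Group H] [Finite H] {α : H → ℂ} (hα : IsCharacter H α) (h : H) :
    (α h).re ≤ (α 1).re := by
  obtain ⟨V, rfl⟩ := hα
  rw [FDRep.char_one, Complex.natCast_re]
  exact (trace_fin_order (V.ρ h) (orderOf h) (orderOf_pos h)
    (by rw [← map_pow, pow_orderOf_eq_one, map_one])).1

lemma char_eq_of_re {H : Type} [Group H] [Finite H] {α : H → ℂ} (hα : IsCharacter H α) (h : H)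
    (hre : (α h).re = (α 1).re) : α h = α 1 := by
  obtain ⟨V, rfl⟩ := hα
  rw [FDRep.char_one, Complex.natCast_re] at hre
  have := (trace_fin_order (V.ρ h) (orderOf h) (orderOf_pos h)
    (by rw [← map_pow, pow_orderOf_eq_one, map_one])).2 hre
  rw [FDRep.char_one, FDRep.character, this, LinearMap.trace_one]

/-- The kernel of a character is the kernel of a homomorphism. -/
lemma exists_ker {H : Type} [Group H] [Finite H] {α : H → ℂ} (hα : IsCharacter H α) :
    ∃ (K : Subgroup H), K.Normal ∧ (K : Set H) = {h | α h = α 1} := by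
  obtain ⟨V, rfl⟩ := hα
  refine ⟨V.ρ.ker, inferInstance, ?_⟩
  ext h
  rw [SetLike.mem_coe, MonoidHom.mem_ker, Set.mem_setOf_eq, FDRep.char_one]
  constructor
  · intro h1
    rw [FDRep.character, h1, LinearMap.trace_one]
  · intro h1
    apply (trace_fin_order (V.ρ h) (orderOf h) (orderOf_pos h)
      (by rw [← map_pow, pow_orderOf_eq_one, map_one])).2
    have h2 := congrArg Complex.re h1
    rwa [Complex.natCast_re] at h2

lemma trace_pi_fun {ι V : Type} [Fintype ι] [AddCommGroup V] [Module ℂ V] [Module.Finite ℂ V]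
    (T : (ι → V) →ₗ[ℂ] (ι → V)) :
    LinearMap.trace ℂ (ι → V) T = ∑ x : ι, LinearMap.trace ℂ V
      (LinearMap.proj x ∘ₗ T ∘ₗ LinearMap.single ℂ (fun _ : ι => V) x) := by
  have h : T = ∑ x : ι, (T ∘ₗ LinearMap.single ℂ (fun _ : ι => V) x) ∘ₗ LinearMap.proj x := by
    apply LinearMap.ext
    intro f
    rw [LinearMap.sum_apply]
    simp only [LinearMap.comp_apply, LinearMap.proj_apply]
    rw [← map_sum]
    congr 1
    exact (LinearMap.sum_single_apply (fun _ : ι => V) f).symm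
  conv_lhs => rw [h]
  rw [map_sum]
  refine Finset.sum_congr rfl fun x _ => ?_
  exact LinearMap.trace_comp_comm' _ _

section Induced

variable {G V : Type} [Group G] [Fintype G] (U : Subgroup G) [AddCommGroup V] [Module ℂ V]
  [Module.Finite ℂ V] (ρ : Representation ℂ ↥U V)

/-- Right translation on functions. -/
def rtrans : Representation ℂ G (G → V) where
  toFun g := LinearMap.funLeft ℂ V (fun x => x * g)
  map_one' := by ext; simp [LinearMap.funLeft_apply]
  map_mul' a b := by
    apply LinearMap.ext
    intro f
    funext x
    simp [LinearMap.funLeft_apply, mul_assoc]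

/-- The space of equivariant functions. -/
def indSub : Subrepresentation (rtrans (G := G) (V := V)) where
  toSubmodule :=
    { carrier := {f | ∀ (u : U) (x : G), f (u * x) = ρ u (f x)}
      add_mem' := fun {a b} ha hb u x => by simp [ha u x, hb u x]
      zero_mem' := fun u x => by simp
      smul_mem' := fun c a ha u x => by simp [ha u x] }
  apply_mem_toSubmodule := by
    intro g f hf u x
    have := hf u (x * g)
    simpa [rtrans, LinearMap.funLeft_apply, mul_assoc] using this

/-- The averaging projection onto the space of equivariant functions. -/
def avgProj : (G → V) →ₗ[ℂ] (G → V) :=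
  LinearMap.pi fun x => (Nat.card U : ℂ)⁻¹ • ∑ u : U, ρ u⁻¹ ∘ₗ LinearMap.proj ((u : G) * x)

lemma avgProj_apply (f : G → V) (x : G) :
    avgProj U ρ f x = (Nat.card U : ℂ)⁻¹ • ∑ u : U, ρ u⁻¹ (f ((u : G) * x)) := by
  simp [avgProj, LinearMap.sum_apply]

lemma avgProj_mem (f : G → V) : avgProj U ρ f ∈ (indSub U ρ).toSubmodule := by
  intro w x
  rw [avgProj_apply, avgProj_apply, map_smul, map_sum]
  congr 1
  refine Fintype.sum_equiv (Equiv.mulRight w) _ _ fun u => ?_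
  simp [mul_assoc]

lemma avgProj_of_mem (f : G → V) (hf : f ∈ (indSub U ρ).toSubmodule) : avgProj U ρ f = f := by
  funext x
  rw [avgProj_apply]
  have : ∀ u : U, ρ u⁻¹ (f ((u : G) * x)) = f x := by
    intro u
    rw [hf u x, ← Module.End.mul_apply, ← map_mul]
    simp
  simp only [this]
  rw [Finset.sum_const, Finset.card_univ, ← Nat.card_eq_fintype_card, ← Nat.cast_smul_eq_nsmul ℂ,
    smul_smul, inv_mul_cancel₀ (NeZero.ne _), one_smul]

lemma ind_character : (indSub U ρ).toRepresentation.character = inducedChar U ρ.character := by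
  funext g
  have hmem : ∀ f, (rtrans (V := V) g ∘ₗ avgProj U ρ) f ∈ (indSub U ρ).toSubmodule := fun f =>
    (indSub U ρ).apply_mem_toSubmodule g (avgProj_mem U ρ f)
  have h1 := LinearMap.trace_restrict_eq_of_forall_mem _ _ hmem
  have h2 : (indSub U ρ).toRepresentation g =
      (rtrans (V := V) g ∘ₗ avgProj U ρ).restrict (fun x _ => hmem x) := by
    apply LinearMap.ext
    intro f
    apply Subtype.ext
    change rtrans (V := V) g f.1 = rtrans (V := V) g (avgProj U ρ f.1)
    rw [avgProj_of_mem U ρ f.1 f.2]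
  rw [Representation.character, h2, h1, trace_pi_fun, inducedChar, finsum_eq_sum_of_fintype,
    Finset.mul_sum]
  refine Fintype.sum_equiv (Equiv.inv G) _ _ fun x => ?_
  have h3 : LinearMap.proj x ∘ₗ (rtrans (V := V) g ∘ₗ avgProj U ρ) ∘ₗ
      LinearMap.single ℂ (fun _ : G => V) x =
      (Nat.card U : ℂ)⁻¹ • ∑ u : U, if (u : G) * (x * g) = x then ρ u⁻¹ else 0 := by
    apply LinearMap.ext
    intro v
    change avgProj U ρ (Pi.single x v) (x * g) = _
    rw [avgProj_apply, LinearMap.smul_apply, LinearMap.sum_apply]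
    congr 1
    refine Finset.sum_congr rfl fun u _ => ?_
    by_cases h : (u : G) * (x * g) = x
    · rw [if_pos h, h, Pi.single_eq_same]
    · rw [if_neg h, Pi.single_eq_of_ne h]; simp
  rw [h3, map_smul, smul_eq_mul, map_sum]
  congr 1
  simp only [Equiv.inv_apply, inv_inv]
  by_cases hx : x * g * x⁻¹ ∈ U
  · rw [dif_pos hx, Finset.sum_eq_single (⟨x * g * x⁻¹, hx⟩⁻¹ : U)]
    · rw [if_pos (by simp [mul_assoc]), inv_inv]
      rfl
    · intro u _ hu
      rw [if_neg, map_zero]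
      intro h
      apply hu
      apply Subtype.ext
      simp only [InvMemClass.coe_inv]
      rw [eq_mul_inv_of_mul_eq h]
      group
    · simp
  · rw [dif_neg hx]
    refine Finset.sum_eq_zero fun u _ => ?_
    rw [if_neg, map_zero]
    intro h
    apply hx
    have : x * g * x⁻¹ = ((u⁻¹ : U) : G) := by
      rw [InvMemClass.coe_inv, eq_mul_inv_of_mul_eq h]
      group
    rw [this]
    exact SetLike.coe_mem _

end Induced

lemma isCharacter_induced {G : Type} [Group G] [Fintype G] (U : Subgroup G) {φ : ↥U → ℂ}
    (hφ : IsCharacter ↥U φ) : IsCharacter G (inducedChar U φ) := by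
  obtain ⟨V, rfl⟩ := hφ
  have := isCharacter_of_rep (indSub U (V.ρ : Representation ℂ ↥U V)).toRepresentation
  rw [ind_character] at this
  exact this

/-- Extension by zero of a function on a subgroup. -/
def ext0 {G : Type} [Group G] (U : Subgroup G) (φ : ↥U → ℂ) (g : G) : ℂ :=
  if h : g ∈ U then φ ⟨g, h⟩ else 0

lemma inducedChar_eq {G : Type} [Group G] [Fintype G] (U : Subgroup G) (φ : ↥U → ℂ) (g : G) :
    inducedChar U φ g = (Nat.card U : ℂ)⁻¹ * ∑ y : G, ext0 U φ (y⁻¹ * g * y) := by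
  rw [inducedChar, finsum_eq_sum_of_fintype]
  rfl

lemma sum_ext0 {G : Type} [Group G] [Fintype G] (U : Subgroup G) (φ : ↥U → ℂ) (β : G → ℂ) :
    ∑ h : G, ext0 U φ h * β h⁻¹ = Nat.card U * ip φ (fun u => β u) := by
  rw [ip, mul_inv_cancel_left₀ (NeZero.ne _)]
  have h1 : ∑ h : G, ext0 U φ h * β h⁻¹ = ∑ h : G with h ∈ U, ext0 U φ h * β h⁻¹ := by
    rw [Finset.sum_filter_of_ne]
    intro x _ hx
    by_contra hU
    exact hx (by simp [ext0, hU])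
  rw [h1, Finset.sum_subtype (p := fun h => h ∈ U) _ (by simp)]
  refine Finset.sum_congr rfl fun u _ => ?_
  simp [ext0]

lemma frobenius {G : Type} [Group G] [Fintype G] (U : Subgroup G) (φ : ↥U → ℂ) {β : G → ℂ}
    (hβ : IsCharacter G β) : ip (inducedChar U φ) β = ip φ (fun u => β u) := by
  have h1 : ∑ g : G, inducedChar U φ g * β g⁻¹ =
      ∑ _y : G, (Nat.card U : ℂ)⁻¹ * ∑ g : G, ext0 U φ g * β g⁻¹ := by
    simp_rw [inducedChar_eq, mul_assoc, Finset.sum_mul, Finset.mul_sum]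
    rw [Finset.sum_comm]
    refine Finset.sum_congr rfl fun y _ => ?_
    refine Fintype.sum_equiv (MulAut.conj y⁻¹).toEquiv _ _ fun g => ?_
    have : β ((MulAut.conj y⁻¹).toEquiv g)⁻¹ = β g⁻¹ := by
      rw [← char_conj hβ g⁻¹ y⁻¹]
      congr 1
      simp [mul_assoc]
    rw [this]
    simp [mul_assoc]
  rw [ip, h1, sum_ext0, inv_mul_cancel_left₀ (NeZero.ne _), Finset.sum_const, Finset.card_univ,
    ← Nat.card_eq_fintype_card, nsmul_eq_mul, inv_mul_cancel_left₀ (NeZero.ne _)]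

/-- The inclusion of `U ∩ N`, as a subgroup of `N`, into `U`. -/
def incl {G : Type} [Group G] (U N : Subgroup G) : ↥(U.subgroupOf N) →* ↥U where
  toFun v := ⟨v.1.1, v.2⟩
  map_one' := rfl
  map_mul' _ _ := rfl

lemma mackey_zero {G : Type} [Group G] [Fintype G] (U N : Subgroup G) [N.Normal] {φ : ↥U → ℂ}
    (hφ : IsCharacter ↥U φ) {θ : ↥N → ℂ} (hθ : IsCharacter ↥N θ)
    (h : ip (fun n : N => inducedChar U φ n) θ = 0) :
    ip (fun v => φ (incl U N v)) (fun v : U.subgroupOf N => θ v) = 0 := by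
  have hy : ∀ y : G, ∑ n : N, ext0 U φ (y⁻¹ * n * y) * θ n⁻¹ = Nat.card (U.subgroupOf N) *
      ip (fun v => φ (incl U N v)) (fun v : U.subgroupOf N => θ (MulAut.conjNormal y v)) := by
    intro y
    rw [← sum_ext0 (U.subgroupOf N) (fun v => φ (incl U N v))
      (fun n => θ (MulAut.conjNormal y n))]
    symm
    refine Fintype.sum_equiv (MulAut.conjNormal y).toEquiv _ _ fun n => ?_
    congr 1
    · have : y⁻¹ * (((MulAut.conjNormal y).toEquiv n : N) : G) * y = n := by
        change y⁻¹ * ((MulAut.conjNormal y n : N) : G) * y = n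
        rw [MulAut.conjNormal_apply]
        group
      rw [this]
      rfl
    · change θ (MulAut.conjNormal y n⁻¹) = θ (MulAut.conjNormal y n)⁻¹
      rw [map_inv]
  choose a ha using fun y : G => ip_nat (isCharacter_comp hφ (incl U N)) (isCharacter_comp hθ
    (((MulAut.conjNormal (H := N) y).toMonoidHom).comp (U.subgroupOf N).subtype))
  have hsum : ∑ n : N, inducedChar U φ n * θ n⁻¹ = (Nat.card U : ℂ)⁻¹ *
      ∑ y : G, (Nat.card (U.subgroupOf N) : ℂ) * a y := by
    simp_rw [inducedChar_eq, mul_assoc, Finset.sum_mul]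
    rw [← Finset.mul_sum, Finset.sum_comm]
    congr 1
    refine Finset.sum_congr rfl fun y _ => ?_
    rw [← ha y]
    have := hy y
    simp only [mul_assoc] at this
    exact this
  rw [ip, hsum] at h
  simp only [mul_eq_zero, inv_eq_zero, NeZero.ne, false_or, ← Finset.mul_sum] at h
  have h1 : ∑ y : G, a y = 0 := by exact_mod_cast h
  have h2 := (Finset.sum_eq_zero_iff.mp h1) 1 (Finset.mem_univ _)
  have h3 := ha 1
  rw [h2] at h3
  simpa using h3

lemma inducedChar_one {G : Type} [Group G] [Fintype G] (U : Subgroup G) (φ : ↥U → ℂ)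
    (h : φ 1 ≠ 0) : inducedChar U φ 1 ≠ 0 := by
  rw [inducedChar_eq]
  have : ∀ y : G, ext0 U φ (y⁻¹ * 1 * y) = φ 1 := fun y => by
    simp [ext0, U.one_mem]
    rfl
  simp only [this, Finset.sum_const, Finset.card_univ, nsmul_eq_mul]
  simp [h]

/-- An invariant irreducible character lies under a fully ramified one. -/
lemma exists_over {G : Type} [Group G] [Fintype G] (N : Subgroup G) [N.Normal]
    (χ : ↥N → ℂ) (hχ : IsIrreducibleCharacter ↥N χ)
    (hinv : ∀ (g n : G) (hn : n ∈ N) (hgn : g⁻¹ * n * g ∈ N),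
      χ ⟨g⁻¹ * n * g, hgn⟩ = χ ⟨n, hn⟩) :
    ∃ ψ, IsIrreducibleCharacter G ψ ∧ ∃ m : ℕ, ∀ n : N, ψ n = m * χ n := by
  have hA := isCharacter_induced N (irr_isCharacter hχ)
  have h1 := inducedChar_one N χ (irr_one_ne_zero hχ)
  obtain ⟨ψ, γ, hψ, hγ, hs⟩ := split_irr hA (fun h => h1 (by rw [h]; rfl))
  refine ⟨ψ, hψ, ?_⟩
  apply multiple (isCharacter_comp (irr_isCharacter hψ) N.subtype)
  intro θ hθ hne
  refine (ip_zero_left_of_add (isCharacter_comp (irr_isCharacter hψ) N.subtype) (isCharacter_comp hγ N.subtype)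
    (irr_isCharacter hθ) ?_).1
  have h2 : ((fun n => ψ (N.subtype n)) + fun n => γ (N.subtype n)) =
      fun n => ((Nat.card N : ℂ)⁻¹ * Fintype.card G) * χ n := by
    funext n
    have h3 : ∀ y : G, ext0 N χ (y⁻¹ * n * y) = χ n := by
      intro y
      have hm : y⁻¹ * n * y ∈ N := by
        simpa using Subgroup.Normal.conj_mem (inferInstanceAs N.Normal) n.1 n.2 y⁻¹
      rw [ext0, dif_pos hm]
      exact hinv y n n.2 hm
    have h4 := congrFun hs n
    rw [inducedChar_eq] at h4
    simp only [h3, Finset.sum_const, Finset.card_univ, nsmul_eq_mul] at h4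
    rw [mul_assoc, h4]
    rfl
  have h5 := ip_ne hχ hθ hne.symm
  rw [ip] at h5 ⊢
  rw [h2]
  simp only [mul_assoc, ← Finset.mul_sum]
  rw [mul_left_comm, mul_left_comm _ (Fintype.card G : ℂ), h5]
  simp

lemma ker_of_split {H : Type} [Group H] [Finite H] {α β : H → ℂ} (hα : IsCharacter H α)
    (hβ : IsCharacter H β) (h : H) (heq : α h + β h = α 1 + β 1) : α h = α 1 := by
  have h1 := char_re_le hα h
  have h2 := char_re_le hβ h
  have h3 := congrArg Complex.re heq
  simp only [Complex.add_re] at h3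
  have h4 : (α h).re = (α 1).re := by linarith
  exact char_eq_of_re hα h h4

end QSIAux

/-- If `G` is a finite QSI group and `N ⊴ G`, then every `G`-invariant irreducible complex
character of `N` is QSI as a character of `N`. -/
theorem invariant_char_isQSI_of_isQSIGroup (G : Type) [Group G] [Finite G]
    (hG : IsQSIGroup G) (N : Subgroup G) [N.Normal]
    (χ : ↥N → ℂ) (hχirr : IsIrreducibleCharacter ↥N χ)
    (hinv : ∀ (g n : G) (hn : n ∈ N) (hgn : g⁻¹ * n * g ∈ N),
      χ ⟨g⁻¹ * n * g, hgn⟩ = χ ⟨n, hn⟩) :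
    IsQSI χ := by
  haveI : Fintype G := Fintype.ofFinite G
  obtain ⟨ψ, hψ, m, hm⟩ := QSIAux.exists_over N χ hχirr hinv
  obtain ⟨U, φ, hφ, ⟨k, hk, hkψ⟩, K, hK, hKφ, hsol⟩ := hG ψ hψ
  have hφc := QSIAux.irr_isCharacter hφ
  have hres := QSIAux.isCharacter_comp hφc (QSIAux.incl U N)
  have hφ1 := QSIAux.irr_one_ne_zero hφ
  obtain ⟨φ', γ, hφ', hγ, hs⟩ := QSIAux.split_irr hres (fun h => hφ1 (by
    have := congrFun h 1
    simpa using this))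
  have hφ'c := QSIAux.irr_isCharacter hφ'
  have hind := QSIAux.isCharacter_induced _ hφ'c
  obtain ⟨k', hk'⟩ := QSIAux.multiple (χ := χ) hind (by
    intro θ hθ hne
    have hθc := QSIAux.irr_isCharacter hθ
    rw [QSIAux.frobenius _ _ hθc]
    have hθ' := QSIAux.isCharacter_comp hθc (U.subgroupOf N).subtype
    refine (QSIAux.ip_zero_left_of_add hφ'c hγ hθ' ?_).1
    rw [← hs]
    refine QSIAux.mackey_zero U N hφc hθc ?_
    have h5 := QSIAux.ip_ne hχirr hθ hne.symm
    rw [QSIAux.ip] at h5 ⊢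
    simp only [← hkψ, hm, mul_assoc, ← Finset.mul_sum]
    rw [mul_left_comm, mul_left_comm _ (m : ℂ), h5]
    simp)
  obtain ⟨K', hK'n, hK'⟩ := QSIAux.exists_ker hφ'c
  refine ⟨U.subgroupOf N, φ', hφ', ⟨k', ?_, fun g => (hk' g).symm⟩, K', hK'n, hK', ?_⟩
  · rw [Nat.pos_iff_ne_zero]
    rintro rfl
    apply QSIAux.inducedChar_one _ φ' (QSIAux.irr_one_ne_zero hφ')
    rw [hk']
    simp
  · let f : ↥(U.subgroupOf N) →* ↥U ⧸ K := (QuotientGroup.mk' K).comp (QSIAux.incl U N)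
    have hle : f.ker ≤ K' := by
      intro v hv
      have h1 : QSIAux.incl U N v ∈ K := (QuotientGroup.eq_one_iff _).mp hv
      have h2 : φ (QSIAux.incl U N v) = φ 1 := by
        have : QSIAux.incl U N v ∈ (K : Set ↥U) := h1
        rw [hKφ] at this
        exact this
      have h3 : v ∈ (K' : Set _) := by
        rw [hK']
        refine QSIAux.ker_of_split hφ'c hγ v ?_
        have e1 := congrFun hs v
        have e2 := congrFun hs 1
        simp only [Pi.add_apply, map_one] at e1 e2
        rw [← e1, ← e2, h2]
      exact h3
    have hsol' : Group.IsSolvable (↥U ⧸ K) := hsol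
    have hs1 : Group.IsSolvable (↥(U.subgroupOf N) ⧸ f.ker) :=
      Group.isSolvable_of_isSolvable_injective (QuotientGroup.kerLift_injective f)
    have hsurj : Function.Surjective
        (QuotientGroup.map f.ker K' (MonoidHom.id _) hle) := by
      intro q
      obtain ⟨v, rfl⟩ := QuotientGroup.mk_surjective q
      exact ⟨(v : ↥(U.subgroupOf N) ⧸ f.ker), rfl⟩
    exact Group.isSolvable_of_surjective hsurj
end
end

section
/- Let n ≥ 5 with n ≠ 6, let S be the alternating group A_n, let m ≥ 1, and let G be any finite group with S^m ≤ G ≤ Aut(S^m) (where S^m is identified with its image under conjugation as a normal subgroup of Aut(S^m)). Then G is not QSI. -/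
open scoped BigOperators Classical

noncomputable section

open Equiv

/-- A permutation moving at most six points has order dividing `60`. -/
lemma pow_sixty_of_support {α : Type} [Fintype α] [DecidableEq α] (g : Perm α)
    (h : g.support.card ≤ 6) : g ^ 60 = 1 := by
  rw [← orderOf_dvd_iff_pow_eq_one, ← Perm.lcm_cycleType, Multiset.lcm_dvd]
  intro b hb
  have h1 := Perm.two_le_of_mem_cycleType hb
  have h2 := Perm.le_card_support_of_mem_cycleType hb
  have : b ≤ 6 := h2.trans h
  interval_cases b <;> norm_num

lemma threeCycle_pow_sixty {α : Type} [Fintype α] [DecidableEq α] (c g : Perm α)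
    (h : c.IsThreeCycle) : (c * (g * c * g⁻¹)) ^ 60 = 1 := by
  apply pow_sixty_of_support
  have h2 : (g * c * g⁻¹).support.card = 3 := by
    rw [Perm.card_support_conj, h.card_support]
  calc _ ≤ (c.support ∪ (g * c * g⁻¹).support).card :=
        Finset.card_le_card (Perm.support_mul_le _ _)
    _ ≤ _ := (Finset.card_union_le _ _).trans (by rw [h.card_support, h2])

lemma iter60_7 {α : Type} (w : Perm α) (p : ℕ → α) (h : ∀ i < 6, w (p i) = p (i+1))
    (h6 : w (p 6) = p 0) : (w ^ 60) (p 0) = p 4 := by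
  have h7 : ∀ k ≤ 6, (w ^ k) (p 0) = p k := by
    intro k hk
    induction k with
    | zero => simp
    | succ k ih => rw [pow_succ', Perm.mul_apply, ih (by omega), h k (by omega)]
  have h8 : (w ^ 7) (p 0) = p 0 := by
    rw [pow_succ', Perm.mul_apply, h7 6 le_rfl, h6]
  have h9 : ∀ j, (w ^ (7 * j)) (p 0) = p 0 := by
    intro j
    induction j with
    | zero => simp
    | succ j ih => rw [Nat.mul_succ, pow_add, Perm.mul_apply, h8, ih]
  rw [show 60 = 4 + 7 * 8 from rfl, pow_add, Perm.mul_apply, h9, h7 4 (by omega)]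

lemma iter60_9 {α : Type} (w : Perm α) (p : ℕ → α) (h : ∀ i < 8, w (p i) = p (i+1))
    (h6 : w (p 8) = p 0) : (w ^ 60) (p 0) = p 6 := by
  have h7 : ∀ k ≤ 8, (w ^ k) (p 0) = p k := by
    intro k hk
    induction k with
    | zero => simp
    | succ k ih => rw [pow_succ', Perm.mul_apply, ih (by omega), h k (by omega)]
  have h8 : (w ^ 9) (p 0) = p 0 := by
    rw [pow_succ', Perm.mul_apply, h7 8 le_rfl, h6]
  have h9 : ∀ j, (w ^ (9 * j)) (p 0) = p 0 := by
    intro j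
    induction j with
    | zero => simp
    | succ j ih => rw [Nat.mul_succ, pow_add, Perm.mul_apply, h8, ih]
  rw [show 60 = 6 + 9 * 6 from rfl, pow_add, Perm.mul_apply, h9, h7 6 (by omega)]

/-- An element of order three which is not a three-cycle violates the conclusion of
`threeCycle_pow_sixty` as soon as there are at least seven points. -/
lemma exists_not_pow_sixty {α : Type} [Fintype α] [DecidableEq α] (hα : 7 ≤ Fintype.card α)
    (x : Perm α) (hx3 : x ^ 3 = 1) (hx1 : x ≠ 1) (hx : ¬ x.IsThreeCycle) :
    ∃ g ∈ alternatingGroup α, (x * (g * x * g⁻¹)) ^ 60 ≠ 1 := by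
  have h3 : ∀ a, x (x (x a)) = a := fun a => by
    have := congrArg (fun f : Perm α => f a) hx3
    simpa [pow_succ] using this
  have hinj : ∀ {a b}, x a = x b → a = b := fun h => x.injective h
  obtain ⟨p0, hp0⟩ : ∃ a, x a ≠ a := by
    by_contra! h
    exact hx1 (Perm.ext h)
  obtain ⟨p3, hp3, h30, h31, h32⟩ : ∃ a, x a ≠ a ∧ a ≠ p0 ∧ a ≠ x p0 ∧ a ≠ x (x p0) := by
    by_contra! h
    apply hx
    rw [← card_support_eq_three_iff]
    have : x.support = {p0, x p0, x (x p0)} := by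
      ext a
      simp only [Perm.mem_support, Finset.mem_insert, Finset.mem_singleton]
      grind
    rw [this, Finset.card_eq_three]
    exact ⟨_, _, _, by grind, by grind, by grind, rfl⟩
  set p1 := x p0 with e1
  set p2 := x p1 with e2
  set p4 := x p3 with e4
  set p5 := x p4 with e5
  have e0 : x p2 = p0 := h3 p0
  have e3 : x p5 = p3 := h3 p3
  obtain ⟨p6, hp6⟩ : ∃ a, a ∉ ({p0, p1, p2, p3, p4, p5} : Finset α) := by
    by_contra! h
    have : Finset.univ ⊆ ({p0, p1, p2, p3, p4, p5} : Finset α) := fun a _ => h a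
    have := (Finset.card_le_card this).trans Finset.card_le_six
    rw [Finset.card_univ] at this
    omega
  simp only [Finset.mem_insert, Finset.mem_singleton, not_or] at hp6
  obtain ⟨h60, h61, h62, h63, h64, h65⟩ := hp6
  have h01 : p0 ≠ p1 := by grind
  have h02 : p0 ≠ p2 := by grind
  have h12 : p1 ≠ p2 := by grind
  have h34 : p3 ≠ p4 := by grind
  have h35 : p3 ≠ p5 := by grind
  have h45 : p4 ≠ p5 := by grind
  have h40 : p4 ≠ p0 := by grind
  have h41 : p4 ≠ p1 := by grind
  have h42 : p4 ≠ p2 := by grind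
  have h50 : p5 ≠ p0 := by grind
  have h51 : p5 ≠ p1 := by grind
  have h52 : p5 ≠ p2 := by grind
  refine ⟨swap p0 p3 * swap p1 p6, ?_, ?_⟩
  · rw [Perm.mem_alternatingGroup, map_mul, Perm.sign_swap h30.symm, Perm.sign_swap (Ne.symm h61)]
    norm_num
  have hinv : (swap p0 p3 * swap p1 p6)⁻¹ = swap p0 p3 * swap p1 p6 := by
    rw [mul_inv_rev, swap_inv, swap_inv]
    ext a
    simp only [Perm.mul_apply, swap_apply_def]
    grind
  rw [hinv]
  intro hcon
  set w := x * (swap p0 p3 * swap p1 p6 * x * (swap p0 p3 * swap p1 p6)) with hw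
  have hwa : ∀ a, w a = x (swap p0 p3 (swap p1 p6 (x (swap p0 p3 (swap p1 p6 a))))) :=
    fun a => rfl
  by_cases h6 : x p6 = p6
  · have := iter60_7 w (fun i => [p0, p5, p1, p2, p4, p3, p6].getD i p0) (by
      intro i hi
      rw [hwa]
      interval_cases i <;> simp [swap_apply_def] <;> grind) (by
      rw [hwa]; simp [swap_apply_def]; grind)
    rw [hcon] at this
    simp at this
    grind
  · set p7 := x p6 with e7
    set p8 := x p7 with e8
    have e6 : x p8 = p6 := h3 p6
    have h70 : p7 ≠ p0 := by grind
    have h71 : p7 ≠ p1 := by grind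
    have h73 : p7 ≠ p3 := by grind
    have h80 : p8 ≠ p0 := by grind
    have h81 : p8 ≠ p1 := by grind
    have h83 : p8 ≠ p3 := by grind
    have h86 : p8 ≠ p6 := by grind
    have := iter60_9 w (fun i => [p0, p5, p1, p8, p2, p4, p3, p7, p6].getD i p0) (by
      intro i hi
      rw [hwa]
      interval_cases i <;> simp [swap_apply_def] <;> grind) (by
      rw [hwa]; simp [swap_apply_def]; grind)
    rw [hcon] at this
    simp at this
    grind

/-- Automorphisms of `A_n` preserve three-cycles when `n ≥ 5`, `n ≠ 6`. -/
lemma aut_threeCycle {n : ℕ} (hn : 5 ≤ n) (hn6 : n ≠ 6)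
    (σ : MulAut (alternatingGroup (Fin n))) (c : alternatingGroup (Fin n))
    (hc : (c : Perm (Fin n)).IsThreeCycle) : (σ c : Perm (Fin n)).IsThreeCycle := by
  have hx3 : (σ c : Perm (Fin n)) ^ 3 = 1 := by
    have : c ^ 3 = 1 := by
      apply Subtype.ext
      have := pow_orderOf_eq_one (c : Perm (Fin n))
      rw [hc.orderOf] at this
      simpa using this
    have := congrArg σ this
    rw [map_pow, map_one] at this
    exact_mod_cast congrArg Subtype.val this
  have hx1 : (σ c : Perm (Fin n)) ≠ 1 := by
    intro h
    have : σ c = 1 := Subtype.ext h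
    rw [map_eq_one_iff σ σ.injective] at this
    rw [this] at hc
    exact hc.ne_one rfl
  by_contra hcon
  rcases Nat.lt_or_ge n 7 with h7 | h7
  · have h5 : n = 5 := by omega
    subst h5
    apply hcon
    rw [← card_support_eq_three_iff]
    have hd : (σ c : Perm (Fin 5)).cycleType = Multiset.replicate
        (Multiset.card (σ c : Perm (Fin 5)).cycleType) 3 := by
      rw [Multiset.eq_replicate]
      refine ⟨rfl, fun b hb => ?_⟩
      have h1 := Perm.dvd_of_mem_cycleType hb
      have h2 := Perm.two_le_of_mem_cycleType hb
      have h3 := h1.trans (orderOf_dvd_of_pow_eq_one hx3)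
      rcases (Nat.dvd_prime Nat.prime_three).1 h3 with h | h <;> omega
    have hs := Perm.sum_cycleType (σ c : Perm (Fin 5))
    have hle := Finset.card_le_univ (σ c : Perm (Fin 5)).support
    rw [hd] at hs
    simp at hs hle
    have : (σ c : Perm (Fin 5)).support.card ≠ 0 := by
      rw [Ne, Finset.card_eq_zero, Perm.support_eq_empty_iff]
      exact hx1
    omega
  · obtain ⟨g, hg, hw⟩ := exists_not_pow_sixty (by simpa using h7) _ hx3 hx1 hcon
    apply hw
    obtain ⟨g', hg'⟩ := σ.surjective ⟨g, hg⟩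
    have h1 : (c * (g' * c * g'⁻¹)) ^ 60 = 1 := by
      apply Subtype.ext
      simpa using threeCycle_pow_sixty (c : Perm (Fin n)) g' hc
    have := congrArg σ h1
    simp only [map_pow, map_mul, map_inv, map_one, hg'] at this
    simpa using congrArg Subtype.val this

/-- `d` is the three-cycle `(p q r)`. -/
def C3 {α : Type} (d : Perm α) (p q r : α) : Prop :=
  d p = q ∧ d q = r ∧ d r = p ∧ p ≠ q ∧ q ≠ r ∧ p ≠ r ∧ ∀ y, y ≠ p → y ≠ q → y ≠ r → d y = y

lemma C3.of_moved {α : Type} [Fintype α] [DecidableEq α] {d : Perm α} (h : d.IsThreeCycle)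
    {p : α} (hp : d p ≠ p) : C3 d p (d p) (d (d p)) := by
  have hp' : p ∈ d.support := Perm.mem_support.2 hp
  have h1 := h.support_eq_iff_mem_support.2 hp'
  have h2 := h.nodup_iff_mem_support.2 hp'
  have h3 : d (d (d p)) = p := by
    have := pow_orderOf_eq_one d
    rw [h.orderOf] at this
    have := congrArg (fun f : Perm α => f p) this
    simpa [pow_succ] using this
  simp at h2
  refine ⟨rfl, rfl, h3, by grind, by grind, by grind, fun y h4 h5 h6 => ?_⟩
  by_contra hy
  have : y ∈ d.support := Perm.mem_support.2 hy
  rw [h1] at this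
  simp at this
  grind

lemma C3.exists {α : Type} [Fintype α] [DecidableEq α] {d : Perm α} (h : d.IsThreeCycle) :
    ∃ p q r, C3 d p q r := by
  obtain ⟨p, hp⟩ : ∃ a, d a ≠ a := by
    by_contra! h'
    exact h.ne_one (Perm.ext h')
  exact ⟨_, _, _, C3.of_moved h hp⟩

/-- Two three-cycles whose product is an involution share an arc. -/
lemma C3.share {α : Type} {d e : Perm α} {p q r u v w : α} (hd : C3 d p q r) (he : C3 e u v w)
    (hne : ¬ ∀ y, d (e y) = y) (h2 : ∀ y, d (e (d (e y))) = y) :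
    ∃ a, d a ≠ a ∧ d a = e a := by
  by_contra! hcon
  obtain ⟨d1, d2, d3, d4, d5, d6, d7⟩ := hd
  obtain ⟨e1, e2, e3, e4, e5, e6, e7⟩ := he
  have cp := hcon p (by grind)
  have cq := hcon q (by grind)
  have cr := hcon r (by grind)
  have ip := h2 p
  have iq := h2 q
  have ir := h2 r
  have iu := h2 u
  have iv := h2 v
  have iw := h2 w
  have hne' : ¬ (d (e p) = p ∧ d (e q) = q ∧ d (e r) = r ∧
    d (e u) = u ∧ d (e v) = v ∧ d (e w) = w) := by
    rintro ⟨f1, f2, f3, f4, f5, f6⟩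
    apply hne
    intro y
    by_cases hy : y = u ∨ y = v ∨ y = w
    · grind
    · by_cases hy' : y = p ∨ y = q ∨ y = r
      · grind
      · grind
  clear hne h2 hcon
  have du := d7 u
  have dv := d7 v
  have dw := d7 w
  have ep := e7 p
  have eq := e7 q
  have er := e7 r
  clear d7 e7
  by_cases hu : u = p ∨ u = q ∨ u = r <;> by_cases hv : v = p ∨ v = q ∨ v = r <;>
  by_cases hw : w = p ∨ w = q ∨ w = r <;> grind

/-- The explicit three-cycle `(a b c)`. -/
def cyc {α : Type} [DecidableEq α] (a b c : α) : Perm α := swap a b * swap b c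

lemma cyc_C3 {α : Type} [DecidableEq α] {a b c : α} (h1 : a ≠ b) (h2 : b ≠ c) (h3 : a ≠ c) :
    C3 (cyc a b c) a b c := by
  unfold C3 cyc
  simp only [Perm.mul_apply, swap_apply_def]
  grind

lemma C3.ext {α : Type} {d e : Perm α} {p q r : α} (hd : C3 d p q r) (he : C3 e p q r) :
    d = e := by
  unfold C3 at hd he
  refine Perm.ext fun y => ?_
  by_cases h1 : y = p
  · grind
  by_cases h2 : y = q
  · grind
  by_cases h3 : y = r
  · grind
  grind

lemma C3.isThreeCycle {α : Type} [Fintype α] [DecidableEq α] {d : Perm α} {p q r : α}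
    (hd : C3 d p q r) : d.IsThreeCycle := by
  obtain ⟨d1, d2, d3, d4, d5, d6, d7⟩ := hd
  rw [← card_support_eq_three_iff, Finset.card_eq_three]
  refine ⟨p, q, r, d4, d6, d5, ?_⟩
  ext y
  simp only [Perm.mem_support, Finset.mem_insert, Finset.mem_singleton]
  grind

lemma C3.conj {α : Type} {d : Perm α} {p q r : α} (hd : C3 d p q r) (t : Perm α) :
    C3 (t * d * t⁻¹) (t p) (t q) (t r) := by
  obtain ⟨d1, d2, d3, d4, d5, d6, d7⟩ := hd
  refine ⟨by simp [d1], by simp [d2], by simp [d3], by simpa, by simpa, by simpa, ?_⟩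
  intro y h1 h2 h3
  have : d (t⁻¹ y) = t⁻¹ y := d7 _ (by rintro h; apply h1; simp [← h])
    (by rintro h; apply h2; simp [← h]) (by rintro h; apply h3; simp [← h])
  rw [Perm.mul_apply, Perm.mul_apply, this]
  simp

open MulAction in
lemma block_closed {α : Type} {H : Subgroup (Perm α)} {B : Set α} (hB : IsBlock H B)
    {g : Perm α} (hg : g ∈ H) {x : α} (hx : x ∈ B) (hgx : g x ∈ B) (y : α) :
    g y ∈ B ↔ y ∈ B := by
  open scoped Pointwise in
  have h : (⟨g, hg⟩ : H) • B = B := hB.smul_eq_of_mem (g := ⟨g, hg⟩) hx hgx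
  constructor
  · intro hy
    rw [← h] at hy
    exact (Set.smul_mem_smul_set_iff (a := (⟨g, hg⟩ : H))).1 hy
  · intro hy
    rw [← h]
    exact (Set.smul_mem_smul_set_iff (a := (⟨g, hg⟩ : H))).2 hy

lemma exists_avoid {n : ℕ} (hn : 5 ≤ n) (a b c d : Fin n) :
    ∃ z, z ≠ a ∧ z ≠ b ∧ z ≠ c ∧ z ≠ d := by
  by_contra! h
  have : Finset.univ ⊆ ({a, b, c, d} : Finset (Fin n)) := fun z _ => by
    simp only [Finset.mem_insert, Finset.mem_singleton]
    have := h z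
    grind
  have := (Finset.card_le_card this).trans Finset.card_le_four
  simp at this
  omega

/-- The three-cycles `(a b z)` generate the alternating group. -/
lemma closure_cyc {n : ℕ} (hn : 5 ≤ n) {a b : Fin n} (hab : a ≠ b)
    (K : Subgroup (alternatingGroup (Fin n)))
    (hK : ∀ g : alternatingGroup (Fin n), ∀ z, C3 (g : Perm (Fin n)) a b z → g ∈ K) :
    K = ⊤ := by
  set K' := K.map (alternatingGroup (Fin n)).subtype with hK'
  have hc : ∀ z, z ≠ a → z ≠ b → cyc a b z ∈ K' := by
    intro z h1 h2
    have h := cyc_C3 hab h2.symm h1.symm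
    exact ⟨⟨cyc a b z, h.isThreeCycle.mem_alternatingGroup⟩, hK _ z h, rfl⟩
  obtain ⟨z, hza, hzb, -⟩ := exists_avoid hn a b a a
  have hcz := cyc_C3 hab hzb.symm hza.symm
  have hprim : MulAction.IsPreprimitive K' (Fin n) := by
    apply MulAction.IsPreprimitive.of_isTrivialBlock_of_notMem_fixedPoints (a := a)
    · intro h
      have : cyc a b z a = a := h ⟨_, hc z hza hzb⟩
      rw [hcz.1] at this
      exact hab this.symm
    · intro B haB hB
      by_cases hs : B.Subsingleton
      · exact Or.inl hs
      right
      have hy : ∃ y ∈ B, y ≠ a := by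
        by_contra! h
        exact hs fun u hu v hv => (h u hu).trans (h v hv).symm
      obtain ⟨y, hyB, hya⟩ := hy
      have hbB : b ∈ B := by
        by_cases hyb : y = b
        · rwa [← hyb]
        · obtain ⟨w, h1, h2, h3, -⟩ := exists_avoid hn a b y y
          have hw := cyc_C3 hab h2.symm h1.symm
          have := (block_closed hB (hc w h1 h2) hyB
            (by rwa [hw.2.2.2.2.2.2 y hya hyb h3.symm]) a).2 haB
          rwa [hw.1] at this
      ext w
      simp only [Set.mem_univ, iff_true]
      by_cases h1 : w = a
      · rwa [h1]
      by_cases h2 : w = b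
      · rwa [h2]
      have hw := cyc_C3 hab (Ne.symm h2) (Ne.symm h1)
      have := (block_closed hB (hc w h1 h2) haB (by rwa [hw.1]) b).2 hbB
      rwa [hw.2.1] at this
  have := Equiv.Perm.alternatingGroup_le_of_isPreprimitive_of_isThreeCycle_mem hprim
    hcz.isThreeCycle (hc z hza hzb)
  rw [eq_top_iff]
  intro g _
  obtain ⟨g', h1, h2⟩ := this g.2
  rwa [← Subtype.ext h2]

/-- Every automorphism of `A_n` (`n ≥ 5`, `n ≠ 6`) is conjugation by a permutation. -/
theorem aut_alternating {n : ℕ} (hn : 5 ≤ n) (hn6 : n ≠ 6)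
    (σ : MulAut (alternatingGroup (Fin n))) :
    ∃ t : Perm (Fin n), ∀ g : alternatingGroup (Fin n),
      (σ g : Perm (Fin n)) = t * (g : Perm (Fin n)) * t⁻¹ := by
  let a : Fin n := ⟨0, by omega⟩
  let b : Fin n := ⟨1, by omega⟩
  have hab : a ≠ b := by simp [a, b]
  have hC : ∀ z, z ≠ a → z ≠ b → C3 (cyc a b z) a b z := fun z h1 h2 => cyc_C3 hab h2.symm h1.symm
  -- the elements `(a b z)` of `A_n`
  let c : Fin n → alternatingGroup (Fin n) := fun z =>
    if h : z ≠ a ∧ z ≠ b then ⟨cyc a b z, (hC z h.1 h.2).isThreeCycle.mem_alternatingGroup⟩ else 1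
  have hc : ∀ z, z ≠ a → z ≠ b → (c z : Perm (Fin n)) = cyc a b z := by
    intro z h1 h2
    simp [c, h1, h2]
  have h3 : ∀ z, z ≠ a → z ≠ b → (σ (c z) : Perm (Fin n)).IsThreeCycle := by
    intro z h1 h2
    apply aut_threeCycle hn hn6
    rw [hc z h1 h2]
    exact (hC z h1 h2).isThreeCycle
  let d : Fin n → Perm (Fin n) := fun z => (σ (c z) : Perm (Fin n))
  have hinj : ∀ x y, x ≠ a → x ≠ b → y ≠ a → y ≠ b → d x = d y → x = y := by
    intro x y h1 h2 h3 h4 h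
    have : c x = c y := σ.injective (Subtype.ext h)
    have := congrArg Subtype.val this
    rw [hc x h1 h2, hc y h3 h4] at this
    rw [← (hC x h1 h2).2.1, this, (hC y h3 h4).2.1]
  have hshare : ∀ x y, x ≠ a → x ≠ b → y ≠ a → y ≠ b → x ≠ y →
      ∃ p, d x p ≠ p ∧ d x p = d y p := by
    intro x y h1 h2 h4 h5 h6
    obtain ⟨p, q, r, hp⟩ := C3.exists (h3 x h1 h2)
    obtain ⟨u, v, w, hu⟩ := C3.exists (h3 y h4 h5)
    have hx := hC x h1 h2
    have hy := hC y h4 h5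
    apply C3.share hp hu
    · intro h
      have : c x * c y = 1 := by
        apply σ.injective
        apply Subtype.ext
        ext t
        simpa using congrArg Fin.val (h t)
      have := congrArg (fun g : alternatingGroup (Fin n) => (g : Perm (Fin n)) b) this
      simp only [Subgroup.coe_mul, hc x h1 h2, hc y h4 h5, Perm.mul_apply] at this
      rw [hy.2.1, hx.2.2.2.2.2.2 y h4 h5 h6.symm] at this
      exact h5 this
    · intro t
      have : c x * (c y * (c x * c y)) = 1 := by
        apply Subtype.ext
        simp only [Subgroup.coe_mul, hc x h1 h2, hc y h4 h5]
        refine Perm.ext fun t => ?_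
        simp only [Perm.mul_apply, Subgroup.coe_one, Perm.one_apply]
        unfold C3 at hx hy
        by_cases ta : t = a
        · grind
        by_cases tb : t = b
        · grind
        by_cases tx : t = x
        · grind
        by_cases ty : t = y
        · grind
        grind
      have := congrArg (fun g => (σ g : Perm (Fin n)) t) this
      simpa using this
  obtain ⟨x, hxa, hxb, -⟩ := exists_avoid hn a b a a
  obtain ⟨y, hya, hyb, hyx, -⟩ := exists_avoid hn a b x x
  obtain ⟨p, hp, hpy⟩ := hshare x y hxa hxb hya hyb hyx.symm
  have hdx := C3.of_moved (h3 x hxa hxb) hp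
  have hdy := C3.of_moved (h3 y hya hyb) (p := p) (by change d y p ≠ p; rw [← hpy]; exact hp)
  change C3 (d x) p (d x p) (d x (d x p)) at hdx
  change C3 (d y) p (d y p) (d y (d y p)) at hdy
  rw [← hpy] at hdy
  set q := d x p with hq
  have hrs : d x q ≠ d y q := by
    intro h
    rw [← h] at hdy
    exact hyx (hinj x y hxa hxb hya hyb (hdx.ext hdy)).symm
  have hall : ∀ z, z ≠ a → z ≠ b → d z p = q := by
    intro z hza hzb
    by_cases hzx : z = x
    · rw [hzx]
    by_cases hzy : z = y
    · rw [hzy, hpy]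
    obtain ⟨u, hu, hu'⟩ := hshare x z hxa hxb hza hzb (Ne.symm hzx)
    obtain ⟨v, hv, hv'⟩ := hshare y z hya hyb hza hzb (Ne.symm hzy)
    have hdz := C3.of_moved (h3 z hza hzb) (p := u) (by change d z u ≠ u; rw [← hu']; exact hu)
    change C3 (d z) u (d z u) (d z (d z u)) at hdz
    have hdxz : d x ≠ d z := fun h => hzx (hinj x z hxa hxb hza hzb h).symm
    have hdyz : d y ≠ d z := fun h => hzy (hinj y z hya hyb hza hzb h).symm
    have hu2 : u = p ∨ u = q ∨ u = d x q := by
      by_contra! h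
      exact hu (hdx.2.2.2.2.2.2 u h.1 h.2.1 h.2.2)
    have hv2 : v = p ∨ v = q ∨ v = d y q := by
      by_contra! h
      exact hv (hdy.2.2.2.2.2.2 v h.1 h.2.1 h.2.2)
    have hne : ∀ w, C3 (d z) u (d z u) w → ¬ C3 (d x) u (d z u) w :=
      fun w h1 h2 => hdxz (h2.ext h1)
    have hne' := hne _ hdz
    clear hne hdxz hdyz
    unfold C3 at hdx hdy hdz hne'
    rcases hu2 with h | h | h
    · rw [← h, ← hu', h]
    · exfalso
      rcases hv2 with h' | h' | h' <;> grind
    · exfalso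
      rcases hv2 with h' | h' | h' <;> grind
  have hd : ∀ z, z ≠ a → z ≠ b → C3 (d z) p q (d z q) := by
    intro z h1 h2
    have h := C3.of_moved (h3 z h1 h2) (p := p) (by
      change d z p ≠ p
      rw [hall z h1 h2]
      exact hp)
    change C3 (d z) p (d z p) (d z (d z p)) at h
    rwa [hall z h1 h2] at h
  let τ : Fin n → Fin n := fun z => if z = a then p else if z = b then q else d z q
  have τa : τ a = p := by simp [τ]
  have τb : τ b = q := by simp [τ, hab.symm]
  have τz : ∀ z, z ≠ a → z ≠ b → τ z = d z q := fun z h1 h2 => by simp [τ, h1, h2]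
  have τinj : Function.Injective τ := by
    intro u v huv
    by_contra hne
    by_cases ua : u = a
    · subst ua
      by_cases vb : v = b
      · subst vb
        rw [τa, τb] at huv
        exact hp huv.symm
      · have hva : v ≠ a := Ne.symm hne
        rw [τa, τz v hva vb] at huv
        exact (hd v hva vb).2.2.2.2.2.1 huv
    by_cases ub : u = b
    · subst ub
      by_cases va : v = a
      · rw [va, τa, τb] at huv
        exact hp huv
      · have hvb : v ≠ b := Ne.symm hne
        rw [τb, τz v va hvb] at huv
        exact (hd v va hvb).2.2.2.2.1 huv
    have hu := hd u ua ub
    by_cases va : v = a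
    · rw [va, τa, τz u ua ub] at huv
      exact hu.2.2.2.2.2.1 huv.symm
    by_cases vb : v = b
    · rw [vb, τb, τz u ua ub] at huv
      exact hu.2.2.2.2.1 huv.symm
    have hv := hd v va vb
    rw [τz u ua ub, τz v va vb] at huv
    rw [← huv] at hv
    exact hne (hinj u v ua ub va vb (hu.ext hv))
  let t : Perm (Fin n) := Equiv.ofBijective τ (Finite.injective_iff_bijective.1 τinj)
  let f1 : alternatingGroup (Fin n) →* Perm (Fin n) :=
    (alternatingGroup (Fin n)).subtype.comp σ.toMonoidHom
  let f2 : alternatingGroup (Fin n) →* Perm (Fin n) :=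
    (MulAut.conj t).toMonoidHom.comp (alternatingGroup (Fin n)).subtype
  have hK : f1.eqLocus f2 = ⊤ := by
    apply closure_cyc hn hab
    intro g z hg
    have hza : z ≠ a := hg.2.2.2.2.2.1.symm
    have hzb : z ≠ b := hg.2.2.2.2.1.symm
    have hgc : g = c z := by
      apply Subtype.ext
      rw [hc z hza hzb]
      exact hg.ext (hC z hza hzb)
    have h1 := hg.conj t
    have h2 := hd z hza hzb
    have e1 : t a = p := τa
    have e2 : t b = q := τb
    have e3 : t z = d z q := τz z hza hzb
    rw [e1, e2, e3] at h1
    have := h2.ext h1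
    change (σ g : Perm (Fin n)) = t * g * t⁻¹
    rw [← this, hgc]
  refine ⟨t, fun g => ?_⟩
  have : g ∈ f1.eqLocus f2 := by rw [hK]; trivial
  exact this

lemma alt_simple {n : ℕ} (hn : 5 ≤ n) : IsSimpleGroup (alternatingGroup (Fin n)) :=
  alternatingGroup.isSimpleGroup (by simpa using hn)

lemma alt_center {n : ℕ} (hn : 5 ≤ n) : Subgroup.center (alternatingGroup (Fin n)) = ⊥ :=
  alternatingGroup.center_eq_bot (by simpa using (by omega : 4 ≤ n))

lemma alt_nontriv {n : ℕ} (hn : 5 ≤ n) : ∃ a : alternatingGroup (Fin n), a ≠ 1 := by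
  have := alt_simple hn
  exact exists_ne 1

lemma pi_hom_ext {m : ℕ} {S T : Type} [Group S] [Group T] (f g : (Fin m → S) →* T)
    (h : ∀ i, f.comp (MonoidHom.mulSingle (fun _ => S) i) =
      g.comp (MonoidHom.mulSingle (fun _ => S) i)) : f = g := by
  ext x
  change x ∈ f.eqLocus g
  apply Subgroup.pi_mem_of_mulSingle_mem
  intro i
  exact DFunLike.congr_fun (h i) (x i)

lemma map_eq_of_single {m : ℕ} {S : Type} [Group S] (f : (Fin m → S) →* S) (i : Fin m)
    (h : ∀ k, k ≠ i → ∀ a, f (Pi.mulSingle k a) = 1) (s : Fin m → S) :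
    f s = f (Pi.mulSingle i (s i)) := by
  have : f = f.comp ((MonoidHom.mulSingle (fun _ => S) i).comp (Pi.evalMonoidHom (fun _ => S) i)) := by
    apply pi_hom_ext
    intro k
    ext a
    by_cases hk : k = i
    · subst hk
      simp
    · simp [h k hk a, Ne.symm hk]
  conv_lhs => rw [this]
  rfl

/-- Automorphisms of `A_n ^ m`. -/
theorem aut_pow {n m : ℕ} (hn : 5 ≤ n) (hn6 : n ≠ 6)
    (Φ : MulAut (Fin m → alternatingGroup (Fin n))) :
    ∃ (ρ : Perm (Fin m)) (τ : Fin m → Perm (Fin n)), ∀ s j,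
      (Φ s j : Perm (Fin n)) = τ j * (s (ρ j) : Perm (Fin n)) * (τ j)⁻¹ := by
  have := alt_simple hn
  let S := alternatingGroup (Fin n)
  let f : Fin m → (Fin m → S) →* S := fun j => (Pi.evalMonoidHom (fun _ => S) j).comp Φ.toMonoidHom
  have hsurj : ∀ j, Function.Surjective (f j) := by
    intro j a
    refine ⟨Φ.symm (fun _ => a), ?_⟩
    simp [f]
  let F : Fin m → Fin m → S →* S := fun j i => (f j).comp (MonoidHom.mulSingle (fun _ => S) i)
  have hcomm : ∀ j i k, i ≠ k → ∀ a b, F j i a * F j k b = F j k b * F j i a := by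
    intro j i k hik a b
    have := Pi.mulSingle_commute (f := fun _ : Fin m => S) hik a b
    change f j _ * f j _ = f j _ * f j _
    rw [← map_mul, ← map_mul]
    exact congrArg _ this.eq
  -- normality of the images
  have hrange : ∀ j i, (∃ a, F j i a ≠ 1) → Function.Surjective (F j i) := by
    intro j i ⟨a, ha⟩
    have hnor : (F j i).range.Normal := by
      constructor
      rintro _ ⟨b, rfl⟩ g
      obtain ⟨s, rfl⟩ := hsurj j g
      refine ⟨s i * b * (s i)⁻¹, ?_⟩
      change f j _ = f j _ * f j _ * (f j _)⁻¹
      rw [← map_inv, ← map_mul, ← map_mul]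
      congr 1
      funext k
      by_cases hk : k = i
      · subst hk; simp
      · simp [hk]
    rcases hnor.eq_bot_or_eq_top with h | h
    · exfalso
      apply ha
      have : F j i a ∈ (F j i).range := ⟨a, rfl⟩
      rw [h] at this
      simpa using this
    · exact MonoidHom.range_eq_top.1 h
  have hex : ∀ j, ∃ i, (∃ a, F j i a ≠ 1) := by
    intro j
    by_contra! h
    have : f j = 1 := by
      apply pi_hom_ext
      intro i
      ext1 a
      exact h i a
    obtain ⟨a, ha⟩ := alt_nontriv hn
    obtain ⟨s, hs⟩ := hsurj j a
    rw [this] at hs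
    exact ha hs.symm
  choose ρ hρ using hex
  have huniq : ∀ j k, k ≠ ρ j → ∀ a, F j k a = 1 := by
    intro j k hk a
    have : F j k a ∈ Subgroup.center S := by
      rw [Subgroup.mem_center_iff]
      intro g
      obtain ⟨b, rfl⟩ := hrange j (ρ j) (hρ j) g
      exact hcomm j _ _ hk.symm _ _
    rw [alt_center hn] at this
    simpa using this
  have hf : ∀ j s, f j s = F j (ρ j) (s (ρ j)) := by
    intro j s
    exact map_eq_of_single (f j) (ρ j) (huniq j) s
  have hρs : Function.Surjective ρ := by
    intro i
    by_contra! h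
    obtain ⟨a, ha⟩ := alt_nontriv hn
    have h1 : Φ (Pi.mulSingle i a) = 1 := by
      funext j
      have := hf j (Pi.mulSingle i a)
      rw [Pi.mulSingle_eq_of_ne (h j)] at this
      simpa [f] using this
    rw [map_eq_one_iff _ Φ.injective] at h1
    exact ha (by simpa using congrFun h1 i)
  have hbij : ∀ j, Function.Bijective (F j (ρ j)) := by
    intro j
    exact (Finite.surjective_iff_bijective).1 (hrange j _ (hρ j))
  choose t ht using fun j => aut_alternating hn hn6 (MulEquiv.ofBijective (F j (ρ j)) (hbij j))
  refine ⟨Equiv.ofBijective ρ (Finite.surjective_iff_bijective.1 hρs), t, fun s j => ?_⟩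
  have := ht j (s (ρ j))
  rw [MulEquiv.ofBijective_apply, ← hf] at this
  exact this

/-- Number of fixed points. -/
def fixn {n : ℕ} (g : Perm (Fin n)) : ℕ := (Finset.univ.filter fun x => g x = x).card

lemma fixn_eq {n : ℕ} (g : Perm (Fin n)) : fixn g = n - g.support.card := by
  have : (Finset.univ.filter fun x => g x = x) = g.supportᶜ := by
    ext x
    simp
  rw [fixn, this, Finset.card_compl, Fintype.card_fin]

lemma fixn_conj {n : ℕ} (t g : Perm (Fin n)) : fixn (t * g * t⁻¹) = fixn g := by
  rw [fixn_eq, fixn_eq, Perm.card_support_conj]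

lemma closed_zpow {α : Type} {g : Perm α} {T : Set α} (h : ∀ x, g x ∈ T ↔ x ∈ T) (i : ℤ) (x : α) :
    (g ^ i) x ∈ T ↔ x ∈ T := by
  induction i with
  | zero => simp
  | succ i ih => rw [add_comm, zpow_add, Perm.mul_apply, zpow_one, h, ih]
  | pred i ih =>
    rw [← ih, ← h]
    rw [← Perm.mul_apply, ← zpow_one_add]
    simp

lemma closed_same {α : Type} {g : Perm α} {T : Set α} (h : ∀ x, g x ∈ T ↔ x ∈ T) {x y : α}
    (hx : x ∈ T) (hxy : g.SameCycle x y) : y ∈ T := by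
  obtain ⟨i, rfl⟩ := hxy
  exact (closed_zpow h i x).2 hx

lemma same_of_one {n a : ℕ} {g : Perm (Fin n)} (h : g.cycleType = {a}) :
    g.support.card = a ∧ ∀ x ∈ g.support, ∀ y ∈ g.support, g.SameCycle x y := by
  constructor
  · rw [← Perm.sum_cycleType, h]
    simp
  · have hc : g.IsCycle := by
      rw [← Perm.card_cycleType_eq_one, h]
      simp
    intro x hx y hy
    exact hc.sameCycle (Perm.mem_support.1 hx) (Perm.mem_support.1 hy)

lemma same_of_two {n a b : ℕ} {g : Perm (Fin n)} (h : g.cycleType = {a, b}) (hab : a + b = n) :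
    ∃ A : Finset (Fin n), A.card = a ∧ Aᶜ.card = b ∧ (∀ x ∈ A, ∀ y ∈ A, g.SameCycle x y) ∧
      (∀ x ∈ Aᶜ, ∀ y ∈ Aᶜ, g.SameCycle x y) := by
  have ha : a ∈ g.cycleType := by simp [h]
  obtain ⟨c, τ, rfl, hd, hc, hca⟩ := Perm.mem_cycleType_iff.1 ha
  rw [hd.cycleType_mul, hc.cycleType] at h
  have hτ : τ.cycleType = {b} := by
    change ({c.support.card} : Multiset ℕ) + _ = {a} + {b} at h
    rw [hca] at h
    exact add_left_cancel h
  obtain ⟨h1, h2⟩ := same_of_one hτ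
  have hcompl : c.supportᶜ = τ.support := by
    symm
    apply Finset.eq_of_subset_of_card_le
    · intro x hx
      rw [Finset.mem_compl]
      intro hx'
      exact (Finset.disjoint_left.1 hd.disjoint_support hx') hx
    · rw [Finset.card_compl, Fintype.card_fin]
      omega
  refine ⟨c.support, hca, by rw [hcompl, h1], ?_, ?_⟩
  · intro x hx y hy
    obtain ⟨i, hi⟩ := hc.sameCycle (Perm.mem_support.1 hx) (Perm.mem_support.1 hy)
    refine ⟨i, ?_⟩
    rw [hd.commute.mul_zpow, Perm.mul_apply]
    have : τ x = x := by
      rcases hd x with h | h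
      · exact absurd h (Perm.mem_support.1 hx)
      · exact h
    rw [Perm.zpow_apply_eq_self_of_apply_eq_self this, hi]
  · rw [hcompl]
    intro x hx y hy
    obtain ⟨i, hi⟩ := h2 x hx y hy
    refine ⟨i, ?_⟩
    rw [hd.commute.mul_zpow, Perm.mul_apply, hi]
    have : c y = y := by
      rcases hd y with h | h
      · exact h
      · exact absurd h (Perm.mem_support.1 hy)
    rw [Perm.zpow_apply_eq_self_of_apply_eq_self this]

/-- no block of size `b` if there is a `(2 * b - 1)`-cycle. -/
lemma no_block {n b : ℕ} (H : Subgroup (Perm (Fin n))) [MulAction.IsPretransitive H (Fin n)]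
    (hb : 2 ≤ b) {g : Perm (Fin n)} (hg : g ∈ H) (hgt : g.cycleType = {2 * b - 1})
    {B : Set (Fin n)} (hB : MulAction.IsBlock H B) (hBc : B.ncard = b) : False := by
  obtain ⟨h1, h2⟩ := same_of_one hgt
  obtain ⟨x, hx⟩ : g.support.Nonempty := by
    rw [← Finset.card_pos]; omega
  obtain ⟨y, hy⟩ : B.Nonempty := by
    rw [← Set.ncard_pos]; omega
  obtain ⟨k, hk⟩ := MulAction.exists_smul_eq H y x
  open scoped Pointwise in
  obtain ⟨B', hB', hxB, hB'c⟩ : ∃ B' : Set (Fin n), MulAction.IsBlock H B' ∧ x ∈ B' ∧ B'.ncard = b :=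
    ⟨k • B, hB.translate k, hk ▸ Set.smul_mem_smul_set hy, by rw [Set.ncard_smul_set, hBc]⟩
  have key : ∀ u, u ∈ B' → g u ∈ B' → False := by
    intro u hu hgu
    have hcl := block_closed hB' hg hu hgu
    have hsub : (g.support : Set (Fin n)) ⊆ B' := fun z hz => closed_same hcl hxB (h2 x hx z hz)
    have := Set.ncard_le_ncard hsub
    rw [Set.ncard_coe_finset] at this
    omega
  have hsub : B' ⊆ g.support := by
    intro u hu
    by_contra hu'
    have : g u = u := by simpa using hu'
    exact key u hu (by rwa [this])
  have hsub2 : g '' B' ⊆ g.support := by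
    rintro _ ⟨u, hu, rfl⟩
    have := hsub hu
    simpa using this
  have hdis : Disjoint B' (g '' B') := by
    rw [Set.disjoint_left]
    rintro _ hu ⟨u, hu', rfl⟩
    exact key u hu' hu
  have := Set.ncard_le_ncard (Set.union_subset hsub hsub2)
  rw [Set.ncard_union_eq hdis, Set.ncard_image_of_injective _ g.injective, Set.ncard_coe_finset] at this
  omega

lemma prim_of {n L : ℕ} (H : Subgroup (Perm (Fin n))) [MulAction.IsPretransitive H (Fin n)]
    {g : Perm (Fin n)} (hg : g ∈ H) (hgt : g.cycleType = {L}) (hL : n < 2 * L) (hLn : L < n)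
    (hno : ∀ b, 2 ≤ b → b ≤ n - L → ∃ f ∈ H, f.cycleType = {2 * b - 1}) :
    MulAction.IsPreprimitive H (Fin n) := by
  obtain ⟨h1, h2⟩ := same_of_one hgt
  have hc : g.supportᶜ.card = n - L := by rw [Finset.card_compl, Fintype.card_fin, h1]
  obtain ⟨x, hx⟩ : g.supportᶜ.Nonempty := by
    rw [← Finset.card_pos]; omega
  apply MulAction.IsPreprimitive.of_isTrivialBlock_base x
  intro B hxB hB
  have hgx : g x = x := by simpa using hx
  have hcl := block_closed hB hg hxB (by rwa [hgx])
  by_cases hmeet : ∃ y ∈ B, y ∈ g.support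
  · right
    apply hB.eq_univ_of_card_lt
    obtain ⟨y, hy, hy'⟩ := hmeet
    have hsub : (g.support : Set (Fin n)) ⊆ B := fun z hz => closed_same hcl hy (h2 y hy' z hz)
    have := Set.ncard_le_ncard hsub
    rw [Set.ncard_coe_finset] at this
    rw [Nat.card_fin]
    omega
  · left
    push Not at hmeet
    have hsub : B ⊆ (g.supportᶜ : Finset (Fin n)) := by
      intro z hz
      simpa using hmeet z hz
    have h3 := Set.ncard_le_ncard hsub
    rw [Set.ncard_coe_finset, hc] at h3
    rw [← Set.ncard_le_one_iff_subsingleton]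
    by_contra! hB2
    obtain ⟨f, hf, hft⟩ := hno _ hB2 h3
    exact no_block H hB2 hf hft hB rfl

lemma alt_le_of_types {n : ℕ} (hn : 5 ≤ n) (hn6 : n ≠ 6) (H : Subgroup (Perm (Fin n)))
    (hH : ∀ g : Perm (Fin n), Perm.sign g = 1 → fixn g ≠ 1 → ∃ t, t * g * t⁻¹ ∈ H) :
    alternatingGroup (Fin n) ≤ H := by
  have hT : ∀ c : Multiset ℕ, c.sum ≤ n → c.sum + 1 ≠ n → (∀ a ∈ c, 2 ≤ a) →
      Even (c.sum + Multiset.card c) → ∃ g ∈ H, g.cycleType = c := by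
    intro c h1 h2 h3 h4
    obtain ⟨g, hg⟩ := (Perm.exists_with_cycleType_iff (α := Fin n) (m := c)).2 ⟨by simpa using h1, h3⟩
    obtain ⟨t, ht⟩ := hH g (by rw [Perm.sign_of_cycleType, hg, h4.neg_one_pow])
      (by rw [fixn_eq, ← Perm.sum_cycleType, hg]; omega)
    exact ⟨_, ht, by rw [Perm.cycleType_conj, hg]⟩
  have hT1 : ∀ a, 2 ≤ a → a ≤ n → a + 1 ≠ n → Odd a → ∃ g ∈ H, g.cycleType = {a} := by
    intro a h1 h2 h3 h4
    apply hT {a}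
    · simpa using h2
    · simpa using h3
    · simpa using h1
    · simpa using h4.add_one
  obtain ⟨f, hf, hft⟩ := hT1 3 (by omega) (by omega) (by omega) (by decide)
  suffices hG : MulAction.IsPreprimitive H (Fin n) from
    Perm.alternatingGroup_le_of_isPreprimitive_of_isThreeCycle_mem hG hft hf
  rcases Nat.even_or_odd n with he | ho
  · -- `n` even
    have h8 : 8 ≤ n := by
      obtain ⟨k, hk⟩ := he
      omega
    have hT2 : ∀ a b, 2 ≤ a → 2 ≤ b → a + b = n → ∃ g ∈ H, g.cycleType = {a, b} := by
      intro a b h1 h2 h3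
      apply hT {a, b}
      · simp; omega
      · simp; omega
      · simp [h1, h2]
      · simpa [h3] using (he.add (by decide : Even 2))
    obtain ⟨g1, hg1, hg1t⟩ := hT2 (n - 3) 3 (by omega) (by omega) (by omega)
    obtain ⟨g2, hg2, hg2t⟩ := hT2 (n - 2) 2 (by omega) (by omega) (by omega)
    obtain ⟨A1, a1, a2, a3, a4⟩ := same_of_two hg1t (by omega)
    obtain ⟨A2, b1, b2, b3, b4⟩ := same_of_two hg2t (by omega)
    have hinv : ∀ T : Set (Fin n), (∀ g ∈ H, ∀ x, g x ∈ T ↔ x ∈ T) → T.Nonempty → ↑A2 ⊆ T := by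
      intro T hT ⟨x, hx⟩
      by_cases hm : ∃ y ∈ T, y ∈ A2
      · obtain ⟨y, hy, hy'⟩ := hm
        exact fun z hz => closed_same (hT g2 hg2) hy (b3 y hy' z hz)
      · exfalso
        push Not at hm
        have hsub : T ⊆ ((A2ᶜ : Finset (Fin n)) : Set (Fin n)) := by
          intro z hz
          simpa using hm z hz
        have h3 := Set.ncard_le_ncard hsub
        rw [Set.ncard_coe_finset, b2] at h3
        by_cases hx1 : x ∈ A1
        · have hs : (A1 : Set (Fin n)) ⊆ T := fun z hz => closed_same (hT g1 hg1) hx (a3 x hx1 z hz)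
          have := Set.ncard_le_ncard hs
          rw [Set.ncard_coe_finset] at this
          omega
        · have hs : ((A1ᶜ : Finset (Fin n)) : Set (Fin n)) ⊆ T := fun z hz =>
            closed_same (hT g1 hg1) hx (a4 x (by simpa using hx1) z hz)
          have := Set.ncard_le_ncard hs
          rw [Set.ncard_coe_finset] at this
          omega
    have htr : MulAction.IsPretransitive H (Fin n) := by
      constructor
      intro x y
      have hO : ∀ g ∈ H, ∀ z, g z ∈ MulAction.orbit H x ↔ z ∈ MulAction.orbit H x := by
        intro g hg z
        have := MulAction.orbit_smul (⟨g, hg⟩ : H) z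
        change (⟨g, hg⟩ : H) • z ∈ _ ↔ _
        rw [← MulAction.orbit_eq_iff, ← MulAction.orbit_eq_iff, this]
      by_contra hy
      have h1 := hinv _ hO ⟨x, MulAction.mem_orbit_self x⟩
      have h2 := hinv (MulAction.orbit H x)ᶜ (fun g hg z => not_congr (hO g hg z)) ⟨y, hy⟩
      obtain ⟨z, hz⟩ : A2.Nonempty := by
        rw [← Finset.card_pos]; omega
      exact h2 hz (h1 hz)
    obtain ⟨g, hg, hgt⟩ := hT1 (n - 3) (by omega) (by omega) (by omega) (by
      obtain ⟨k, hk⟩ := he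
      exact ⟨k - 2, by omega⟩)
    apply prim_of H hg hgt (by omega) (by omega)
    intro b hb1 hb2
    exact hT1 (2 * b - 1) (by omega) (by omega) (by
      obtain ⟨k, hk⟩ := he
      omega) ⟨b - 1, by omega⟩
  · -- `n` odd
    obtain ⟨k, hk⟩ := ho
    obtain ⟨g1, hg1, hg1t⟩ := hT1 n (by omega) (by omega) (by omega) ⟨k, hk⟩
    have htr : MulAction.IsPretransitive H (Fin n) := by
      constructor
      intro x y
      obtain ⟨h1, h2⟩ := same_of_one hg1t
      have h3 : g1.support = Finset.univ := by
        rw [← Finset.card_eq_iff_eq_univ, h1, Fintype.card_fin]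
      rw [h3] at h2
      obtain ⟨i, hi⟩ := h2 x (by simp) y (by simp)
      exact ⟨⟨g1 ^ i, H.zpow_mem hg1 i⟩, hi⟩
    obtain ⟨g, hg, hgt⟩ := hT1 (n - 2) (by omega) (by omega) (by omega) ⟨k - 1, by omega⟩
    apply prim_of H hg hgt (by omega) (by omega)
    intro b hb1 hb2
    exact hT1 (2 * b - 1) (by omega) (by omega) (by omega) ⟨b - 1, by omega⟩

lemma simple_of_restrict {Γ Λ M : Type} [Group Γ] [Group Λ] [Finite Γ] [Fintype Λ]
    [AddCommGroup M] [Module ℂ M] [FiniteDimensional ℂ M]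
    (R : Representation ℂ Γ M) (ι : Λ →* Γ)
    (h : ∑ s : Λ, LinearMap.trace ℂ M (R (ι s)) * LinearMap.trace ℂ M (R (ι s⁻¹)) = Nat.card Λ) :
    CategoryTheory.Simple (FDRep.of R) := by
  have hne : (Nat.card Λ : ℂ) ≠ 0 := by exact_mod_cast Nat.card_pos.ne'
  have hneG : (Nat.card Γ : ℂ) ≠ 0 := by exact_mod_cast Nat.card_pos.ne'
  have : NeZero (Nat.card Γ : ℂ) := ⟨hneG⟩
  have : Invertible (Nat.card Λ : ℂ) := invertibleOfNonzero hne
  let Q : Representation ℂ Λ M := R.comp ι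
  have h1 := Representation.card_inv_mul_sum_char_eq_finrank (Representation.linHom Q Q)
  simp_rw [Representation.char_linHom, mul_comm] at h1
  have h2 : ∑ s : Λ, Q.character s * Q.character s⁻¹ = Nat.card Λ := h
  rw [h2, inv_mul_cancel₀ hne] at h1
  have h3 : Module.finrank ℂ (Representation.linHom Q Q).invariants = 1 := by
    exact_mod_cast h1.symm
  rw [FDRep.simple_iff_end_is_rank_one,
    ← (Representation.linHom.invariantsEquivFDRepHom (FDRep.of R) (FDRep.of R)).finrank_eq,
    FDRep.of_ρ']
  change Module.finrank ℂ (Representation.linHom R R).invariants = 1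
  have hle : (Representation.linHom R R).invariants ≤ (Representation.linHom Q Q).invariants := by
    intro f hf s
    have h6 := hf (ι s)
    rw [Representation.linHom_apply] at h6 ⊢
    rw [← map_inv] at h6
    exact h6
  have h4 := Submodule.finrank_mono hle
  have hM : Nontrivial M := by
    by_contra hM
    rw [not_nontrivial_iff_subsingleton] at hM
    have := Module.finrank_zero_of_subsingleton (R := ℂ) (M := (Representation.linHom Q Q).invariants)
    omega
  have h5 : 0 < Module.finrank ℂ (Representation.linHom R R).invariants := by
    have hid : (LinearMap.id : M →ₗ[ℂ] M) ∈ (Representation.linHom R R).invariants := by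
      intro g
      ext x
      simp [Representation.linHom_apply]
    rw [Module.finrank_pos_iff_exists_ne_zero]
    refine ⟨⟨LinearMap.id, hid⟩, ?_⟩
    intro h0
    obtain ⟨x, hx⟩ := exists_ne (0 : M)
    have h7 : (LinearMap.id : M →ₗ[ℂ] M) = 0 := congrArg Subtype.val h0
    exact hx (LinearMap.congr_fun h7 x)
  omega

lemma alt_two_trans {n : ℕ} (hn : 5 ≤ n) {x y x' y' : Fin n} (h : x ≠ y) (h' : x' ≠ y') :
    ∃ g : alternatingGroup (Fin n), (g : Perm (Fin n)) x = x' ∧ (g : Perm (Fin n)) y = y' := by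
  obtain ⟨σ, h1, h2⟩ : ∃ σ : Perm (Fin n), σ x = x' ∧ σ y = y' := by
    refine ⟨swap (swap x x' y) y' * swap x x', ?_, ?_⟩
    · simp only [Perm.mul_apply, swap_apply_left]
      rw [swap_apply_of_ne_of_ne _ h']
      intro h3
      have : swap x x' x = swap x x' y := by rw [swap_apply_left]; exact h3
      exact h ((swap x x').injective this)
    · simp
  rcases Int.units_eq_one_or (Perm.sign σ) with hs | hs
  · exact ⟨⟨σ, hs⟩, h1, h2⟩
  · obtain ⟨z, hz1, hz2, -⟩ := exists_avoid hn x y x x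
    obtain ⟨w, hw1, hw2, hw3, -⟩ := exists_avoid hn x y z z
    refine ⟨⟨σ * swap z w, ?_⟩, ?_, ?_⟩
    · rw [Perm.mem_alternatingGroup, Perm.sign_mul, hs, Perm.sign_swap hw3.symm]
      simp
    · simp [swap_apply_of_ne_of_ne hz1.symm hw1.symm, h1]
    · simp [swap_apply_of_ne_of_ne hz2.symm hw2.symm, h2]

lemma sum_fix {n : ℕ} (hn : 5 ≤ n) :
    ∑ g : alternatingGroup (Fin n), fixn (g : Perm (Fin n)) = Nat.card (alternatingGroup (Fin n)) := by
  have h := MulAction.sum_card_fixedBy_eq_card_orbits_mul_card_group (alternatingGroup (Fin n)) (Fin n)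
  have h1 : ∀ g : alternatingGroup (Fin n),
      Fintype.card (MulAction.fixedBy (Fin n) g) = fixn (g : Perm (Fin n)) := by
    intro g
    rw [fixn, ← Fintype.card_subtype]
    apply Fintype.card_congr
    exact Equiv.refl _
  simp_rw [h1] at h
  rw [h, Nat.card_eq_fintype_card]
  suffices hh : Fintype.card (Quotient (MulAction.orbitRel (alternatingGroup (Fin n)) (Fin n))) = 1 by
    rw [hh, one_mul]
  rw [Fintype.card_eq_one_iff]
  refine ⟨Quotient.mk'' ⟨0, by omega⟩, ?_⟩
  intro q
  induction q using Quotient.inductionOn' with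
  | h x =>
    rw [Quotient.eq'', MulAction.orbitRel_apply]
    obtain ⟨y, hy, -⟩ := exists_avoid hn x x x x
    obtain ⟨y', hy', -⟩ := exists_avoid hn ⟨0, by omega⟩ x x x
    obtain ⟨g, hg, -⟩ := alt_two_trans hn hy'.symm hy.symm
    exact ⟨g, hg⟩

lemma sum_fix_sq {n : ℕ} (hn : 5 ≤ n) :
    ∑ g : alternatingGroup (Fin n), fixn (g : Perm (Fin n)) ^ 2 =
      2 * Nat.card (alternatingGroup (Fin n)) := by
  have h := MulAction.sum_card_fixedBy_eq_card_orbits_mul_card_group (alternatingGroup (Fin n))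
    (Fin n × Fin n)
  have h1 : ∀ g : alternatingGroup (Fin n),
      Fintype.card (MulAction.fixedBy (Fin n × Fin n) g) = fixn (g : Perm (Fin n)) ^ 2 := by
    intro g
    rw [fixn, ← Fintype.card_subtype, sq, ← Fintype.card_prod]
    apply Fintype.card_congr
    refine ⟨fun x => (⟨x.1.1, congrArg Prod.fst x.2⟩, ⟨x.1.2, congrArg Prod.snd x.2⟩),
      fun x => ⟨(x.1.1, x.2.1), Prod.ext x.1.2 x.2.2⟩, fun _ => rfl, fun _ => rfl⟩
  simp_rw [h1] at h
  rw [h, Nat.card_eq_fintype_card]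
  suffices hh : Fintype.card
      (Quotient (MulAction.orbitRel (alternatingGroup (Fin n)) (Fin n × Fin n))) = 2 by
    rw [hh]
  let a : Fin n := ⟨0, by omega⟩
  let b : Fin n := ⟨1, by omega⟩
  have hab : a ≠ b := by simp [a, b]
  have key : (Finset.univ : Finset (Quotient
      (MulAction.orbitRel (alternatingGroup (Fin n)) (Fin n × Fin n)))) = {(Quotient.mk'' (a, a) :
      Quotient (MulAction.orbitRel (alternatingGroup (Fin n)) (Fin n × Fin n))),
      Quotient.mk'' (a, b)} := by
    ext q
    simp only [Finset.mem_univ, true_iff, Finset.mem_insert, Finset.mem_singleton]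
    induction q using Quotient.inductionOn' with
    | h x =>
      obtain ⟨x, y⟩ := x
      rw [Quotient.eq'', MulAction.orbitRel_apply, Quotient.eq'', MulAction.orbitRel_apply]
      by_cases hxy : x = y
      · left
        subst hxy
        obtain ⟨y, hy, -⟩ := exists_avoid hn x x x x
        obtain ⟨g, hg, -⟩ := alt_two_trans hn hab hy.symm
        exact ⟨g, Prod.ext hg hg⟩
      · right
        obtain ⟨g, hg, hg'⟩ := alt_two_trans hn hab hxy
        exact ⟨g, Prod.ext hg hg'⟩
  rw [← Finset.card_univ, key, Finset.card_pair]
  intro heq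
  rw [Quotient.eq'', MulAction.orbitRel_apply] at heq
  obtain ⟨g, hg⟩ := heq
  have h1 : (g : Perm (Fin n)) a = a := congrArg Prod.fst hg
  have h2 : (g : Perm (Fin n)) b = a := congrArg Prod.snd hg
  exact hab ((g : Perm (Fin n)).injective (h1.trans h2.symm))

/-- The character value `fix - 1`. -/
def psi {n : ℕ} (g : alternatingGroup (Fin n)) : ℂ := (fixn (g : Perm (Fin n)) : ℂ) - 1

lemma sum_psi {n : ℕ} (hn : 5 ≤ n) : ∑ g : alternatingGroup (Fin n), psi g = 0 := by
  have := congrArg (fun k : ℕ => (k : ℂ)) (sum_fix hn)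
  simp only [Nat.cast_sum] at this
  simp [psi, this]

lemma sum_psi_sq {n : ℕ} (hn : 5 ≤ n) :
    ∑ g : alternatingGroup (Fin n), psi g * psi g = Nat.card (alternatingGroup (Fin n)) := by
  have h1 := congrArg (fun k : ℕ => (k : ℂ)) (sum_fix hn)
  have h2 := congrArg (fun k : ℕ => (k : ℂ)) (sum_fix_sq hn)
  simp only [Nat.cast_sum, Nat.cast_mul, Nat.cast_pow] at h1 h2
  have h3 : ∀ g : alternatingGroup (Fin n), psi g * psi g =
      (fixn (g : Perm (Fin n)) : ℂ) ^ 2 - 2 * (fixn (g : Perm (Fin n)) : ℂ) + 1 := by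
    intro g
    unfold psi
    ring
  simp_rw [h3, Finset.sum_add_distrib, Finset.sum_sub_distrib, ← Finset.mul_sum]
  rw [h1, h2]
  simp

lemma psi_inv {n : ℕ} (g : alternatingGroup (Fin n)) : psi g⁻¹ = psi g := by
  unfold psi
  rw [fixn_eq, fixn_eq]
  simp

lemma psi_one {n : ℕ} (hn : 5 ≤ n) : psi (1 : alternatingGroup (Fin n)) ≠ 0 := by
  unfold psi
  rw [fixn_eq]
  simp only [OneMemClass.coe_one, Perm.support_one, Finset.card_empty, Nat.sub_zero]
  intro h
  have : (n : ℂ) = 1 := by linear_combination h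
  have : n = 1 := by exact_mod_cast this
  omega

/-- `y` is the image of the point `x` under `Φ`, expressed through stabilizers. -/
def IsAct {n m : ℕ} (Φ : MulAut (Fin m → alternatingGroup (Fin n))) (x y : Fin m → Fin n) : Prop :=
  ∀ s : Fin m → alternatingGroup (Fin n), (∀ i, (s i : Perm (Fin n)) (x i) = x i) →
    ∀ j, (Φ s j : Perm (Fin n)) (y j) = y j

lemma isAct_formula {n m : ℕ} {Φ : MulAut (Fin m → alternatingGroup (Fin n))}
    {ρ : Perm (Fin m)} {τ : Fin m → Perm (Fin n)}
    (h : ∀ s j, (Φ s j : Perm (Fin n)) = τ j * (s (ρ j) : Perm (Fin n)) * (τ j)⁻¹)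
    (x : Fin m → Fin n) : IsAct Φ x (fun j => τ j (x (ρ j))) := by
  intro s hs j
  rw [h]
  simp [hs]

lemma isAct_unique {n m : ℕ} (hn : 5 ≤ n) {Φ : MulAut (Fin m → alternatingGroup (Fin n))}
    {ρ : Perm (Fin m)} {τ : Fin m → Perm (Fin n)}
    (h : ∀ s j, (Φ s j : Perm (Fin n)) = τ j * (s (ρ j) : Perm (Fin n)) * (τ j)⁻¹)
    {x y : Fin m → Fin n} (hy : IsAct Φ x y) : y = (fun j => τ j (x (ρ j))) := by
  funext j
  by_contra hne
  obtain ⟨w, hw1, hw2, -⟩ := exists_avoid hn (τ j (x (ρ j))) (y j) (y j) (y j)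
  obtain ⟨g, hg1, hg2⟩ := alt_two_trans hn (Ne.symm hne) hw1.symm
  have hs := hy (Φ.symm (Pi.mulSingle j g)) (by
    intro i
    obtain ⟨k, rfl⟩ := ρ.surjective i
    have h1 := h (Φ.symm (Pi.mulSingle j g)) k
    rw [MulEquiv.apply_symm_apply] at h1
    have h2 : ((Φ.symm (Pi.mulSingle j g)) (ρ k) : Perm (Fin n)) =
        (τ k)⁻¹ * ((Pi.mulSingle j g : Fin m → alternatingGroup (Fin n)) k : Perm (Fin n)) * τ k := by
      rw [h1]
      group
    rw [h2]
    by_cases hk : k = j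
    · subst hk
      simp [hg1]
    · simp [hk]) j
  rw [MulEquiv.apply_symm_apply, Pi.mulSingle_eq_same, hg2] at hs
  exact hw2 hs

lemma isAct_exists {n m : ℕ} (hn : 5 ≤ n) (hn6 : n ≠ 6)
    (Φ : MulAut (Fin m → alternatingGroup (Fin n))) (x : Fin m → Fin n) : ∃ y, IsAct Φ x y := by
  obtain ⟨ρ, τ, h⟩ := aut_pow hn hn6 Φ
  exact ⟨_, isAct_formula h x⟩

/-- The image of `x` under `Φ`. -/
def actFun {n m : ℕ} (hn : 5 ≤ n) (hn6 : n ≠ 6)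
    (Φ : MulAut (Fin m → alternatingGroup (Fin n))) (x : Fin m → Fin n) : Fin m → Fin n :=
  (isAct_exists hn hn6 Φ x).choose

lemma actFun_spec {n m : ℕ} (hn : 5 ≤ n) (hn6 : n ≠ 6)
    (Φ : MulAut (Fin m → alternatingGroup (Fin n))) (x : Fin m → Fin n) :
    IsAct Φ x (actFun hn hn6 Φ x) := (isAct_exists hn hn6 Φ x).choose_spec

lemma actFun_eq {n m : ℕ} (hn : 5 ≤ n) (hn6 : n ≠ 6)
    {Φ : MulAut (Fin m → alternatingGroup (Fin n))} {x y : Fin m → Fin n} (h : IsAct Φ x y) :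
    actFun hn hn6 Φ x = y := by
  obtain ⟨ρ, τ, h'⟩ := aut_pow hn hn6 Φ
  rw [isAct_unique hn h' h, isAct_unique hn h' (actFun_spec hn hn6 Φ x)]

lemma actFun_one {n m : ℕ} (hn : 5 ≤ n) (hn6 : n ≠ 6) (x : Fin m → Fin n) :
    actFun hn hn6 1 x = x :=
  actFun_eq hn hn6 (fun _ hs => hs)

lemma actFun_mul {n m : ℕ} (hn : 5 ≤ n) (hn6 : n ≠ 6)
    (Φ Ψ : MulAut (Fin m → alternatingGroup (Fin n))) (x : Fin m → Fin n) :
    actFun hn hn6 (Φ * Ψ) x = actFun hn hn6 Φ (actFun hn hn6 Ψ x) :=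
  actFun_eq hn hn6 (fun s hs =>
    actFun_spec hn hn6 Φ _ (Ψ s) (actFun_spec hn hn6 Ψ x s hs))

lemma actFun_conj {n m : ℕ} (hn : 5 ≤ n) (hn6 : n ≠ 6)
    (s : Fin m → alternatingGroup (Fin n)) (x : Fin m → Fin n) :
    actFun hn hn6 (MulAut.conj s) x = fun i => (s i : Perm (Fin n)) (x i) := by
  apply actFun_eq hn hn6
  intro t ht j
  simp [MulAut.conj_apply, ht]

/-- The permutation action as a homomorphism. -/
def actHom {n m : ℕ} (hn : 5 ≤ n) (hn6 : n ≠ 6) :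
    MulAut (Fin m → alternatingGroup (Fin n)) →* Perm (Fin m → Fin n) :=
  MonoidHom.toHomPerm
    { toFun := fun Φ => (actFun hn hn6 Φ : Function.End _)
      map_one' := funext (actFun_one hn hn6)
      map_mul' := fun Φ Ψ => funext (actFun_mul hn hn6 Φ Ψ) }

lemma actHom_apply {n m : ℕ} (hn : 5 ≤ n) (hn6 : n ≠ 6)
    (Φ : MulAut (Fin m → alternatingGroup (Fin n))) (x : Fin m → Fin n) :
    actHom hn hn6 Φ x = actFun hn hn6 Φ x := rfl

/-- The projection kernel. -/
def pk {n m : ℕ} (x y : Fin m → Fin n) : ℂ := ∏ i, ((if x i = y i then 1 else 0) - (n : ℂ)⁻¹)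

lemma pk_act {n m : ℕ} (hn : 5 ≤ n) (hn6 : n ≠ 6)
    (Φ : MulAut (Fin m → alternatingGroup (Fin n))) (x y : Fin m → Fin n) :
    pk (actHom hn hn6 Φ x) (actHom hn hn6 Φ y) = pk x y := by
  obtain ⟨ρ, τ, h⟩ := aut_pow hn hn6 Φ
  rw [actHom_apply, actHom_apply, actFun_eq hn hn6 (isAct_formula h x),
    actFun_eq hn hn6 (isAct_formula h y)]
  unfold pk
  simp only [EmbeddingLike.apply_eq_iff_eq]
  exact Equiv.prod_comp ρ (fun i => (if x i = y i then (1 : ℂ) else 0) - (n : ℂ)⁻¹)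

lemma pk_idem {n m : ℕ} (hn : 5 ≤ n) (x z : Fin m → Fin n) : ∑ y, pk x y * pk y z = pk x z := by
  unfold pk
  simp_rw [← Finset.prod_mul_distrib]
  rw [← Fintype.piFinset_univ, ← Finset.prod_univ_sum (fun _ => Finset.univ) (fun i (y : Fin n) =>
    ((if x i = y then (1 : ℂ) else 0) - (n : ℂ)⁻¹) * ((if y = z i then (1 : ℂ) else 0) - (n : ℂ)⁻¹))]
  refine Finset.prod_congr rfl fun i _ => ?_
  have hn0 : (n : ℂ) ≠ 0 := by
    have : n ≠ 0 := by omega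
    exact_mod_cast this
  simp only [sub_mul, mul_sub, Finset.sum_sub_distrib, ← Finset.mul_sum, ← Finset.sum_mul]
  simp
  field_simp
  ring

lemma pk_trace {n m : ℕ} (hn : 5 ≤ n) (s : Fin m → alternatingGroup (Fin n)) :
    ∑ x : Fin m → Fin n, pk (fun i => (s i : Perm (Fin n)) (x i)) x = ∏ i, psi (s i) := by
  unfold pk
  rw [← Fintype.piFinset_univ, ← Finset.prod_univ_sum (fun _ => Finset.univ) (fun i (y : Fin n) =>
    ((if (s i : Perm (Fin n)) y = y then (1 : ℂ) else 0) - (n : ℂ)⁻¹))]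
  refine Finset.prod_congr rfl fun i _ => ?_
  have hn0 : (n : ℂ) ≠ 0 := by
    have : n ≠ 0 := by omega
    exact_mod_cast this
  rw [Finset.sum_sub_distrib, Finset.sum_boole]
  simp [psi, fixn, hn0]

/-- The projection. -/
def PP (n m : ℕ) : ((Fin m → Fin n) → ℂ) →ₗ[ℂ] ((Fin m → Fin n) → ℂ) :=
  Matrix.toLin' (Matrix.of pk)

lemma PP_apply {n m : ℕ} (f : (Fin m → Fin n) → ℂ) (x : Fin m → Fin n) :
    PP n m f x = ∑ y, pk x y * f y := by
  rw [PP, Matrix.toLin'_apply]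
  rfl

/-- The permutation representation. -/
def R0 {n m : ℕ} (hn : 5 ≤ n) (hn6 : n ≠ 6) :
    Representation ℂ (MulAut (Fin m → alternatingGroup (Fin n))) ((Fin m → Fin n) → ℂ) where
  toFun Φ := LinearMap.funLeft ℂ ℂ (actHom hn hn6 Φ⁻¹)
  map_one' := by
    ext f x
    simp
  map_mul' Φ Ψ := by
    ext f x
    simp [LinearMap.funLeft_apply]

lemma R0_apply {n m : ℕ} (hn : 5 ≤ n) (hn6 : n ≠ 6)
    (Φ : MulAut (Fin m → alternatingGroup (Fin n))) (f : (Fin m → Fin n) → ℂ) (x : Fin m → Fin n) :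
    R0 hn hn6 Φ f x = f (actHom hn hn6 Φ⁻¹ x) := rfl

lemma R0_PP {n m : ℕ} (hn : 5 ≤ n) (hn6 : n ≠ 6)
    (Φ : MulAut (Fin m → alternatingGroup (Fin n))) (f : (Fin m → Fin n) → ℂ) :
    R0 hn hn6 Φ (PP n m f) = PP n m (R0 hn hn6 Φ f) := by
  funext x
  rw [R0_apply, PP_apply, PP_apply]
  simp_rw [R0_apply]
  rw [← Equiv.sum_comp (actHom hn hn6 Φ⁻¹) (fun y => pk (actHom hn hn6 Φ⁻¹ x) y * f y)]
  simp_rw [pk_act]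

lemma PP_PP {n m : ℕ} (hn : 5 ≤ n) (f : (Fin m → Fin n) → ℂ) :
    PP n m (PP n m f) = PP n m f := by
  funext x
  simp_rw [PP_apply, Finset.mul_sum]
  rw [Finset.sum_comm]
  simp_rw [← mul_assoc, ← Finset.sum_mul, pk_idem hn]

lemma R0_range {n m : ℕ} (hn : 5 ≤ n) (hn6 : n ≠ 6)
    (Φ : MulAut (Fin m → alternatingGroup (Fin n))) :
    ∀ f ∈ LinearMap.range (PP n m), R0 hn hn6 Φ f ∈ LinearMap.range (PP n m) := by
  rintro _ ⟨f, rfl⟩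
  rw [R0_PP]
  exact ⟨_, rfl⟩

/-- The representation on the range of the projection. -/
def R1 {n m : ℕ} (hn : 5 ≤ n) (hn6 : n ≠ 6) :
    Representation ℂ (MulAut (Fin m → alternatingGroup (Fin n))) (LinearMap.range (PP n m)) where
  toFun Φ := (R0 hn hn6 Φ).restrict (R0_range hn hn6 Φ)
  map_one' := by
    ext f x
    simp [LinearMap.restrict_apply]
  map_mul' Φ Ψ := by
    ext f x
    simp [LinearMap.restrict_apply]

lemma R1_trace {n m : ℕ} (hn : 5 ≤ n) (hn6 : n ≠ 6) (s : Fin m → alternatingGroup (Fin n)) :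
    LinearMap.trace ℂ _ (R1 hn hn6 (MulAut.conj s)) = ∏ i, psi (s i) := by
  have h0 : ∀ f, ((R0 hn hn6 (MulAut.conj s)).comp (PP n m)) f ∈ LinearMap.range (PP n m) :=
    fun f => R0_range hn hn6 _ _ (LinearMap.mem_range_self _ f)
  have h1 : R1 hn hn6 (MulAut.conj s) =
      ((R0 hn hn6 (MulAut.conj s)).comp (PP n m)).restrict (p := LinearMap.range (PP n m))
        (q := LinearMap.range (PP n m))
        (fun f _ => h0 f) := by
    ext ⟨f, hf⟩ x
    obtain ⟨f, rfl⟩ := hf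
    simp only [LinearMap.restrict_apply, LinearMap.comp_apply]
    rw [PP_PP hn]
    rfl
  rw [h1, LinearMap.trace_restrict_eq_of_forall_mem _ _ h0]
  have h2 : (R0 hn hn6 (MulAut.conj s)).comp (PP n m) =
      Matrix.toLin' (Matrix.of fun x y => pk (actHom hn hn6 (MulAut.conj s)⁻¹ x) y) := by
    refine LinearMap.ext fun f => funext fun x => ?_
    rw [LinearMap.comp_apply, R0_apply, PP_apply, Matrix.toLin'_apply]
    rfl
  rw [h2, Matrix.trace_toLin'_eq, Matrix.trace]
  simp only [Matrix.diag_apply, Matrix.of_apply]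
  rw [← map_inv]
  simp_rw [actHom_apply, actFun_conj]
  rw [pk_trace hn]
  simp [psi_inv]

lemma irr_char {n m : ℕ} (hn : 5 ≤ n) (hn6 : n ≠ 6)
    (G : Subgroup (MulAut (Fin m → ↥(alternatingGroup (Fin n)))))
    (hG : (MulAut.conj : (Fin m → ↥(alternatingGroup (Fin n))) →*
          MulAut (Fin m → ↥(alternatingGroup (Fin n)))).range ≤ G) :
    ∃ V : FDRep ℂ G, CategoryTheory.Simple V ∧
      ∀ s : Fin m → alternatingGroup (Fin n),
        V.character ⟨MulAut.conj s, hG ⟨s, rfl⟩⟩ = ∏ i, psi (s i) := by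
  let Q : Representation ℂ G (LinearMap.range (PP n m)) := (R1 hn hn6).comp G.subtype
  let ι : (Fin m → ↥(alternatingGroup (Fin n))) →* G :=
    (MulAut.conj).codRestrict G (fun s => hG ⟨s, rfl⟩)
  have htr : ∀ s, LinearMap.trace ℂ _ (Q (ι s)) = ∏ i, psi (s i) := R1_trace hn hn6
  refine ⟨FDRep.of Q, ?_, htr⟩
  apply simple_of_restrict Q ι
  simp_rw [htr, Pi.inv_apply, psi_inv, ← Finset.prod_mul_distrib]
  rw [← Fintype.piFinset_univ, ← Finset.prod_univ_sum (fun _ => Finset.univ)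
    (fun i (y : alternatingGroup (Fin n)) => psi y * psi y)]
  rw [Finset.prod_congr rfl (fun _ _ => sum_psi_sq hn), Nat.card_pi]
  simp

lemma conj_twist {Λ : Type} [Group Λ] (Φ : MulAut Λ) (s : Λ) :
    Φ * MulAut.conj s * Φ⁻¹ = MulAut.conj (Φ s) := by
  ext x
  simp [MulAut.conj_apply]

lemma sum_pullback {Γ A : Type} [Group Γ] [Group A] [Fintype A] (U : Subgroup Γ)
    (W : FDRep ℂ U) (f : A →* Γ) :
    ∃ r : ℕ, ∑ a, (if h : f a ∈ U then W.character ⟨f a, h⟩ else 0) = (r : ℂ) := by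
  let D : Subgroup A := U.comap f
  let fD : D →* U := (f.comp D.subtype).codRestrict U (fun a => a.2)
  have hne : (Nat.card D : ℂ) ≠ 0 := by exact_mod_cast Nat.card_pos.ne'
  have : Invertible (Nat.card D : ℂ) := invertibleOfNonzero hne
  let Q : Representation ℂ D W := (W.ρ : U →* _).comp fD
  have h1 := Representation.card_inv_mul_sum_char_eq_finrank Q
  rw [inv_mul_eq_iff_eq_mul₀ hne] at h1
  refine ⟨Nat.card D * Module.finrank ℂ Q.invariants, ?_⟩
  push_cast
  rw [← h1]
  have h2 : ∀ a, a ∉ Finset.univ.filter (fun a => a ∈ D) →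
      (if h : f a ∈ U then W.character ⟨f a, h⟩ else 0) = 0 := by
    intro a ha
    have : f a ∉ U := by simpa [D] using ha
    rw [dif_neg this]
  rw [← Finset.sum_subset (Finset.subset_univ (Finset.univ.filter (fun a => a ∈ D)))
    (fun a _ ha => h2 a ha)]
  rw [Finset.sum_subtype (p := fun a => a ∈ D) _ (by simp)]
  refine Finset.sum_congr rfl fun a _ => ?_
  have ha : f a ∈ U := a.2
  rw [dif_pos ha]
  rfl

/-- For `S = A_n` (`n ≥ 5`, `n ≠ 6`) and `S^m ≤ G ≤ Aut(S^m)`, the group `G` is not QSI.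
Here `G` is realised as a subgroup of `Aut(S^m)` containing the inner automorphisms
(the image of `S^m` under conjugation). -/
theorem not_isQSIGroup_of_alternating_socle (n m : ℕ) (hn : 5 ≤ n) (hn6 : n ≠ 6)
    (hm : 1 ≤ m)
    (G : Subgroup (MulAut (Fin m → ↥(alternatingGroup (Fin n)))))
    (hG : (MulAut.conj :
        (Fin m → ↥(alternatingGroup (Fin n))) →*
          MulAut (Fin m → ↥(alternatingGroup (Fin n)))).range ≤ G) :
    ¬ IsQSIGroup ↥G := by
  intro hQ
  have hsimple := alt_simple hn
  obtain ⟨V, hV, hχ⟩ := irr_char hn hn6 G hG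
  obtain ⟨U, φ, ⟨W, -, hW⟩, ⟨k, hk0, hk⟩, K, hK, hKset, hsol⟩ := hQ V.character ⟨V, hV, rfl⟩
  let ι : (Fin m → ↥(alternatingGroup (Fin n))) →* G := (MulAut.conj).codRestrict G (fun s => hG ⟨s, rfl⟩)
  have hχ' : ∀ s, V.character (ι s) = ∏ i, psi (s i) := hχ
  have hkC : (k : ℂ) ≠ 0 := by exact_mod_cast hk0.ne'
  have htw : ∀ (y : G) (s : (Fin m → ↥(alternatingGroup (Fin n)))), y⁻¹ * ι s * y = ι ((y⁻¹ : G).1 s) := by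
    intro y s
    apply Subtype.ext
    have := conj_twist (y⁻¹ : G).1 s
    rw [Subgroup.coe_inv, inv_inv] at this
    exact this
  have hmem : ∀ s : (Fin m → ↥(alternatingGroup (Fin n))), ∏ i, psi (s i) ≠ 0 →
      ∃ Φ : MulAut (Fin m → ↥(alternatingGroup (Fin n))), ι (Φ s) ∈ U := by
    intro s hs
    by_contra! hno
    apply hs
    have h1 := hk (ι s)
    rw [hχ', inducedChar] at h1
    have h2 : ∀ y : G, (if h : y⁻¹ * ι s * y ∈ U then φ ⟨y⁻¹ * ι s * y, h⟩ else 0) = 0 := by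
      intro y
      rw [dif_neg]
      rw [htw]
      exact hno _
    simp_rw [h2] at h1
    simpa [hkC] using h1
  -- the projections of `U ∩ N` are surjective
  have hproj : ∀ (j : Fin m) (a : alternatingGroup (Fin n)), ∃ s : (Fin m → ↥(alternatingGroup (Fin n))), ι s ∈ U ∧ s j = a := by
    intro j a
    let H : Subgroup (Perm (Fin n)) :=
      ((U.comap ι).map (Pi.evalMonoidHom (fun _ => ↥(alternatingGroup (Fin n))) j)).map
        (alternatingGroup (Fin n)).subtype
    have hH : alternatingGroup (Fin n) ≤ H := by
      apply alt_le_of_types hn hn6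
      intro g hg1 hg2
      obtain ⟨Φ, hΦ⟩ := hmem (fun _ => ⟨g, hg1⟩) (by
        rw [Finset.prod_ne_zero_iff]
        intro i _ h0
        apply hg2
        unfold psi at h0
        have : (fixn g : ℂ) = 1 := by linear_combination h0
        exact_mod_cast this)
      obtain ⟨ρ, τ, h⟩ := aut_pow hn hn6 Φ
      refine ⟨τ j, ?_⟩
      have h1 := h (fun _ => ⟨g, hg1⟩) j
      refine ⟨_, ⟨_, hΦ, rfl⟩, h1⟩
    obtain ⟨b, ⟨s, hs, rfl⟩, hb⟩ := hH a.2
    exact ⟨s, hs, Subtype.ext hb⟩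
  -- some coordinate subgroup is contained in `U`
  obtain ⟨j, hj⟩ : ∃ j : Fin m, ∀ a, ι (Pi.mulSingle j a) ∈ U := by
    let j0 : Fin m := ⟨0, by omega⟩
    let a : Fin n := ⟨0, by omega⟩
    let b : Fin n := ⟨1, by omega⟩
    let c : Fin n := ⟨2, by omega⟩
    have h3 : (cyc a b c).IsThreeCycle :=
      (cyc_C3 (by simp [a, b]) (by simp [b, c]) (by simp [a, c])).isThreeCycle
    let d : alternatingGroup (Fin n) := ⟨cyc a b c, h3.mem_alternatingGroup⟩
    have hd : d ≠ 1 := fun h => h3.ne_one (congrArg Subtype.val h)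
    obtain ⟨Φ, hΦ⟩ := hmem (Pi.mulSingle j0 d) (by
      rw [Finset.prod_ne_zero_iff]
      intro i _
      by_cases hi : i = j0
      · rw [hi, Pi.mulSingle_eq_same]
        unfold psi
        rw [fixn_eq]
        change ((n - (cyc a b c).support.card : ℕ) : ℂ) - 1 ≠ 0
        rw [h3.card_support]
        intro h0
        have h1 : ((n - 3 : ℕ) : ℂ) = 1 := by linear_combination h0
        have h2 : n - 3 = 1 := by exact_mod_cast h1
        omega
      · rw [Pi.mulSingle_eq_of_ne hi]
        exact psi_one hn)
    obtain ⟨ρ, τ, h⟩ := aut_pow hn hn6 Φ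
    refine ⟨ρ.symm j0, ?_⟩
    set j := ρ.symm j0 with hjdef
    have hρj : ρ j = j0 := by simp [hjdef]
    set e := Φ (Pi.mulSingle j0 d) j with he
    have hΦe : Φ (Pi.mulSingle j0 d) = Pi.mulSingle j e := by
      funext i
      by_cases hi : i = j
      · subst hi
        rw [Pi.mulSingle_eq_same]
      · rw [Pi.mulSingle_eq_of_ne hi]
        apply Subtype.ext
        rw [h, Pi.mulSingle_eq_of_ne]
        · simp
        · intro h5
          apply hi
          rw [hjdef, ← h5]
          simp
    have he1 : e ≠ 1 := by
      intro h1
      rw [h1, Pi.mulSingle_one, map_eq_one_iff _ Φ.injective] at hΦe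
      apply hd
      simpa using congrFun hΦe j0
    let D : Subgroup (alternatingGroup (Fin n)) :=
      (U.comap ι).comap (MonoidHom.mulSingle (fun _ => ↥(alternatingGroup (Fin n))) j)
    have hDn : D.Normal := by
      constructor
      intro x hx g
      obtain ⟨t, ht, rfl⟩ := hproj j g
      change ι (Pi.mulSingle j _) ∈ U
      have : (Pi.mulSingle j (t j * x * (t j)⁻¹) : (Fin m → ↥(alternatingGroup (Fin n)))) = t * Pi.mulSingle j x * t⁻¹ := by
        funext i
        by_cases hi : i = j
        · subst hi
          simp
        · simp [hi]
      rw [this, map_mul, map_mul, map_inv]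
      exact U.mul_mem (U.mul_mem ht hx) (U.inv_mem ht)
    have heD : e ∈ D := by
      change ι (Pi.mulSingle j e) ∈ U
      rw [← hΦe]
      exact hΦ
    rcases hDn.eq_bot_or_eq_top with hD | hD
    · rw [hD] at heD
      exact absurd (by simpa using heD) he1
    · intro x
      have : x ∈ D := by rw [hD]; trivial
      exact this
  -- `φ` is constant on it
  have hφ : ∀ a, φ ⟨ι (Pi.mulSingle j a), hj a⟩ = φ 1 := by
    let f : alternatingGroup (Fin n) →* U :=
      (ι.comp (MonoidHom.mulSingle (fun _ => ↥(alternatingGroup (Fin n))) j)).codRestrict U hj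
    let q : alternatingGroup (Fin n) →* U ⧸ K := (QuotientGroup.mk' K).comp f
    have hq : q.ker = ⊤ := by
      rcases (MonoidHom.normal_ker q).eq_bot_or_eq_top with h | h
      · exfalso
        have hinj := (MonoidHom.ker_eq_bot_iff q).1 h
        have : Group.IsSolvable (U ⧸ K) := hsol
        have hs : Group.IsSolvable (alternatingGroup (Fin n)) := Group.isSolvable_of_isSolvable_injective hinj
        have hcomm := IsSimpleGroup.comm_iff_isSolvable.2 hs
        obtain ⟨x, hx⟩ := alt_nontriv hn
        have : x ∈ Subgroup.center (alternatingGroup (Fin n)) := by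
          rw [Subgroup.mem_center_iff]
          intro g
          exact hcomm g x
        rw [alt_center hn] at this
        exact hx (by simpa using this)
      · exact h
    intro a
    have ha : a ∈ q.ker := by rw [hq]; trivial
    have ha' : f a ∈ K := by
      rw [MonoidHom.mem_ker] at ha
      exact (QuotientGroup.eq_one_iff _).1 ha
    have : f a ∈ (K : Set U) := ha'
    rw [hKset] at this
    exact this
  -- the degree of `φ`
  have hφ1 : φ 1 = (Module.finrank ℂ W : ℂ) := by rw [hW, FDRep.char_one]
  have hφ0 : φ 1 ≠ 0 := by
    intro h0
    have h1 := hk (ι 1)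
    rw [hχ', inducedChar] at h1
    have h2 : ∀ y : G, (if h : y⁻¹ * ι 1 * y ∈ U then φ ⟨y⁻¹ * ι 1 * y, h⟩ else 0) = 0 := by
      intro y
      have hy : y⁻¹ * ι 1 * y = 1 := by simp
      split_ifs with h
      · rw [← h0]
        congr 1
        exact Subtype.ext hy
      · rfl
    simp_rw [h2] at h1
    simp [hkC, Finset.prod_eq_zero_iff, psi_one hn] at h1
  -- sum of the character
  have hsum0 : ∑ a, V.character (ι (Pi.mulSingle j a)) = 0 := by
    have h1 : ∀ a : alternatingGroup (Fin n), V.character (ι (Pi.mulSingle j a)) =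
        psi a * ∏ i ∈ Finset.univ.erase j, psi (1 : alternatingGroup (Fin n)) := by
      intro a
      rw [hχ', ← Finset.mul_prod_erase _ _ (Finset.mem_univ j), Pi.mulSingle_eq_same]
      congr 1
      refine Finset.prod_congr rfl fun i hi => ?_
      rw [Pi.mulSingle_eq_of_ne (Finset.ne_of_mem_erase hi)]
    simp_rw [h1, ← Finset.sum_mul, sum_psi hn, zero_mul]
  have hft : Fintype G := Fintype.ofFinite G
  have hU0 : (Nat.card U : ℂ) ≠ 0 := by exact_mod_cast Nat.card_pos.ne'
  let F : G → alternatingGroup (Fin n) → ℂ := fun y a =>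
    if h : y⁻¹ * ι (Pi.mulSingle j a) * y ∈ U then φ ⟨y⁻¹ * ι (Pi.mulSingle j a) * y, h⟩ else 0
  have hF0 : ∑ y : G, ∑ a, F y a = 0 := by
    rw [Finset.sum_comm]
    have h1 : ∀ a, ∑ y : G, F y a = (Nat.card U : ℂ) * (k * V.character (ι (Pi.mulSingle j a))) := by
      intro a
      rw [hk, inducedChar, finsum_eq_sum_of_fintype, ← mul_assoc, mul_inv_cancel₀ hU0, one_mul]
    simp_rw [h1, ← Finset.mul_sum, hsum0, mul_zero]
  have hFr : ∀ y : G, ∃ r : ℕ, ∑ a, F y a = (r : ℂ) := by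
    intro y
    let f : alternatingGroup (Fin n) →* G := ((MulAut.conj y⁻¹).toMonoidHom.comp ι).comp
      (MonoidHom.mulSingle (fun _ => ↥(alternatingGroup (Fin n))) j)
    obtain ⟨r, hr⟩ := sum_pullback U W f
    refine ⟨r, ?_⟩
    rw [← hr]
    have hf : ∀ a, f a = y⁻¹ * ι (Pi.mulSingle j a) * y := by
      intro a
      simp [f, MulAut.conj_apply]
    refine Finset.sum_congr rfl fun a _ => ?_
    simp only [F, hf, hW]
  choose r hr using hFr
  have hr1 : r 1 ≠ 0 := by
    intro h0
    have h1 := hr 1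
    rw [h0] at h1
    have h2 : ∀ a, F 1 a = φ 1 := by
      intro a
      have e1 : (1 : G)⁻¹ * ι (Pi.mulSingle j a) * 1 = ι (Pi.mulSingle j a) := by simp
      rw [← hφ a]
      simp only [F, e1, hj, dif_pos]
    simp_rw [h2] at h1
    rw [Finset.sum_const, nsmul_eq_mul, Finset.card_univ, Nat.cast_zero] at h1
    refine mul_ne_zero ?_ hφ0 h1
    exact_mod_cast Fintype.card_ne_zero
  simp_rw [hr] at hF0
  have hF1 : ∑ y : G, r y = 0 := by exact_mod_cast hF0
  rw [Finset.sum_eq_zero_iff] at hF1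
  exact hr1 (hF1 1 (Finset.mem_univ _))
end
end

section
/- Let n ≥ 5 with n ≠ 6, and let χ_n = π_n − 1 be the irreducible character of degree n − 1 of the alternating group A_n, where π_n is the permutation character of the natural action of A_n on {1, …, n}. Then χ_n is not QSI: there exist no subgroup U ≤ A_n, irreducible character φ of U with U/ker(φ) solvable, and positive integer k with k·χ_n = φ^{A_n}. -/
open scoped BigOperators Classical

noncomputable section

section Helpers
open Equiv.Perm MulAction
open scoped Pointwise

theorem support_subset_of_stab {α : Type} [Fintype α] [DecidableEq α]
    {H : Subgroup (Equiv.Perm α)} {B : Set α} {c : Equiv.Perm α} (hc : c.IsCycle) (hcH : c ∈ H)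
    (hs : (⟨c, hcH⟩ : H) • B = B) {w : α} (hw : w ∈ B) (hcw : c w ≠ w) :
    (c.support : Set α) ⊆ B := by
  intro y hy
  have hy' : c y ≠ y := by simpa using hy
  obtain ⟨j, hj⟩ := hc.exists_zpow_eq hcw hy'
  have h1 : (⟨c, hcH⟩ : H) ^ j ∈ stabilizer H B := Subgroup.zpow_mem _ (by simpa using hs) j
  rw [mem_stabilizer_iff] at h1
  rw [← h1]
  refine ⟨w, hw, ?_⟩
  simpa [Subgroup.smul_def] using hj

theorem support_subset_of_prime {α : Type} [Fintype α] [DecidableEq α]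
    {H : Subgroup (Equiv.Perm α)} {B : Set α} (hB : IsBlock H B)
    {c : Equiv.Perm α} (hc : c.IsCycle) (hp : (orderOf c).Prime) (hcH : c ∈ H)
    {w w' : α} (hw : w ∈ B) (hw' : w' ∈ B) (hne : w' ≠ w) (hcw : c w ≠ w) :
    (c.support : Set α) ⊆ B := by
  rw [isBlock_iff_smul_eq_of_mem] at hB
  refine support_subset_of_stab hc hcH ?_ hw hcw
  by_cases h : c w' = w'
  · exact hB hw' (by simpa [Subgroup.smul_def, h] using hw')
  · obtain ⟨i, hi⟩ := hc.exists_zpow_eq hcw h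
    have h1 : (⟨c, hcH⟩ : H) ^ i ∈ stabilizer H B := by
      rw [mem_stabilizer_iff]
      refine hB hw ?_
      have : (⟨c, hcH⟩ : H) ^ i • w = w' := by simpa [Subgroup.smul_def] using hi
      rwa [this]
    have hnd : ¬ ((orderOf c : ℤ) ∣ i) := by
      intro hd
      rw [orderOf_dvd_iff_zpow_eq_one] at hd
      rw [hd] at hi
      exact hne (by simpa using hi.symm)
    have hco : IsCoprime (orderOf c : ℤ) i :=
      (Nat.prime_iff_prime_int.mp hp).irreducible.coprime_iff_not_dvd.mpr hnd
    obtain ⟨a, b, hab⟩ := hco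
    have h2 : (⟨c, hcH⟩ : H) = ((⟨c, hcH⟩ : H) ^ i) ^ b := by
      apply Subtype.ext
      simp only [SubgroupClass.coe_zpow]
      have : c ^ (a * (orderOf c : ℤ) + b * i) = c := by rw [hab, zpow_one]
      rw [zpow_add, mul_comm a, zpow_mul, zpow_natCast, pow_orderOf_eq_one, one_zpow, one_mul,
        mul_comm, zpow_mul] at this
      exact this.symm
    have h3 := Subgroup.zpow_mem _ h1 b
    rw [← h2] at h3
    exact mem_stabilizer_iff.mp h3

theorem alternating_le_core (n : ℕ) (hn : 5 ≤ n) (hn6 : n ≠ 6)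
    (H : Subgroup (Equiv.Perm (Fin n)))
    (hH : ∀ m : Multiset ℕ, m.sum ≤ n → (∀ a ∈ m, 2 ≤ a) → Even (m.sum + m.card) →
      m.sum + 1 ≠ n → ∃ g ∈ H, g.cycleType = m) :
    alternatingGroup (Fin n) ≤ H := by
  classical
  obtain ⟨c3, hc3, h3⟩ := hH {3} (by simp; omega) (by simp) (by simp; decide) (by simp; omega)
  obtain ⟨c5, hc5, h5⟩ := hH {5} (by simp; omega) (by simp) (by simp; decide) (by simp; omega)
  obtain ⟨h, hh, hcyc, hc1, hc2⟩ : ∃ h ∈ H, h.IsCycle ∧ h.support.card + 2 ≤ n ∧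
      n ≤ h.support.card + 3 := by
    rcases Nat.even_or_odd n with he | ho
    · obtain ⟨k, hk⟩ := he
      obtain ⟨g, hg, hgt⟩ := hH {n - 3} (by simp) (by simp; omega)
        (by simp; exact ⟨k - 1, by omega⟩) (by simp; omega)
      refine ⟨g, hg, card_cycleType_eq_one.mp (by simp [hgt]), ?_⟩
      rw [← sum_cycleType, hgt]; simp; omega
    · obtain ⟨k, hk⟩ := ho
      obtain ⟨g, hg, hgt⟩ := hH {n - 2} (by simp) (by simp; omega)
        (by simp; exact ⟨k, by omega⟩) (by simp; omega)
      refine ⟨g, hg, card_cycleType_eq_one.mp (by simp [hgt]), ?_⟩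
      rw [← sum_cycleType, hgt]; simp; omega
  obtain ⟨g, hg, hg1, hg2⟩ : ∃ g ∈ H, (∀ a ∈ g.cycleType, 4 ≤ a) ∧ g.cycleType.sum = n := by
    rcases Nat.even_or_odd n with he | ho
    · obtain ⟨k, hk⟩ := he
      obtain ⟨g, hg, hgt⟩ := hH {k, k} (by simp; omega) (by simp; omega)
        (by simp; exact ⟨k + 1, by omega⟩) (by simp; omega)
      exact ⟨g, hg, by rw [hgt]; simp; omega, by rw [hgt]; simp; omega⟩
    · obtain ⟨k, hk⟩ := ho
      obtain ⟨g, hg, hgt⟩ := hH {n} (by simp) (by simp; omega)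
        (by simp; exact ⟨k + 1, by omega⟩) (by simp)
      exact ⟨g, hg, by rw [hgt]; simp; omega, by rw [hgt]; simp⟩
  have hgs : ∀ x, x ∈ g.support := by
    rw [sum_cycleType] at hg2
    have : g.support = Finset.univ := Finset.eq_univ_of_card _ (by simpa using hg2)
    simp [this]
  have hfix : h.supportᶜ.card ≤ 3 := by rw [Finset.card_compl, Fintype.card_fin]; omega
  have hfix1 : h.supportᶜ.Nonempty := by
    rw [← Finset.card_pos, Finset.card_compl, Fintype.card_fin]; omega
  -- every orbit meets the support of `h`
  have hmeet : ∀ x : Fin n, ∃ y ∈ h.support, ∃ u : H, u • x = y := by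
    intro x
    have hm : (g.cycleOf x).support.card ∈ g.cycleType := by
      rw [cycleType_def]
      exact Multiset.mem_map.mpr ⟨g.cycleOf x, cycleOf_mem_cycleFactorsFinset_iff.mpr (hgs x), rfl⟩
    have h4 := hg1 _ hm
    obtain ⟨y, hy, hy'⟩ : ∃ y ∈ (g.cycleOf x).support, y ∉ h.supportᶜ := by
      by_contra! hcon
      have := Finset.card_le_card (show (g.cycleOf x).support ⊆ h.supportᶜ from hcon)
      omega
    obtain ⟨i, hi⟩ := (mem_support_cycleOf_iff.mp hy).1
    exact ⟨y, by simpa using hy', ⟨g, hg⟩ ^ i, by simpa [Subgroup.smul_def] using hi⟩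
  have htrans : IsPretransitive H (Fin n) := by
    constructor
    intro x y
    obtain ⟨x', hx', u, hu⟩ := hmeet x
    obtain ⟨y', hy', v, hv⟩ := hmeet y
    obtain ⟨i, hi⟩ := hcyc.exists_zpow_eq (mem_support.mp hx') (mem_support.mp hy')
    refine ⟨v⁻¹ * (⟨h, hh⟩ : H) ^ i * u, ?_⟩
    rw [mul_smul, mul_smul, hu, inv_smul_eq_iff, hv]
    simpa [Subgroup.smul_def] using hi
  have c5cyc : c5.IsCycle := card_cycleType_eq_one.mp (by simp [h5])
  have c5card : c5.support.card = 5 := by rw [← sum_cycleType, h5]; simp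
  have c5ord : orderOf c5 = 5 := by rw [c5cyc.orderOf, c5card]
  obtain ⟨w, hw⟩ : c5.support.Nonempty := by rw [← Finset.card_pos]; omega
  -- nontrivial blocks have at least five elements
  have hbig : ∀ B : Set (Fin n), IsBlock H B → B.Nontrivial → 5 ≤ B.ncard := by
    intro B hB hBn
    obtain ⟨b, hb, b', hb', hbb⟩ := hBn
    obtain ⟨u, hu⟩ := exists_smul_eq H b w
    have := support_subset_of_prime (hB.translate u) c5cyc (by rw [c5ord]; norm_num) hc5
      (w := w) (w' := u • b') (hu ▸ Set.smul_mem_smul_set hb) (Set.smul_mem_smul_set hb')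
      (by rw [← hu]; simpa using hbb.symm) (mem_support.mp hw)
    have h1 := Set.ncard_le_ncard this (Set.toFinite _)
    rw [Set.ncard_coe_finset, c5card] at h1
    simpa using h1
  obtain ⟨x, hx⟩ := hfix1
  have hxf : h x = x := by simpa using hx
  have hprim : IsPreprimitive H (Fin n) := by
    refine IsPreprimitive.of_isTrivialBlock_base x ?_
    intro B hxB hB
    by_cases hBn : B.Nontrivial
    · right
      have h5' := hbig B hB hBn
      have hst : (⟨h, hh⟩ : H) • B = B :=
        (isBlock_iff_smul_eq_of_mem.mp hB) hxB (by simpa [Subgroup.smul_def, hxf] using hxB)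
      obtain ⟨y, hyB, hy⟩ : ∃ y ∈ B, y ∉ (h.supportᶜ : Finset (Fin n)) := by
        by_contra! hcon
        have := Set.ncard_le_ncard (show B ⊆ ((h.supportᶜ : Finset (Fin n)) : Set (Fin n)) from hcon)
          (Set.toFinite _)
        rw [Set.ncard_coe_finset] at this
        omega
      have hsub := support_subset_of_stab hcyc hh hst hyB (by simpa using hy)
      apply hB.eq_univ_of_card_lt
      have hsub2 := Set.ncard_le_ncard (Set.insert_subset hxB hsub) (Set.toFinite _)
      rw [Set.ncard_insert_of_notMem (by simpa using hxf), Set.ncard_coe_finset] at hsub2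
      simp only [Nat.card_eq_fintype_card, Fintype.card_fin]
      omega
    · left
      exact Set.not_nontrivial_iff.mp hBn
  exact alternatingGroup_le_of_isPreprimitive_of_isThreeCycle_mem hprim h3 hc3

end Helpers

/-- For `n ≥ 5`, `n ≠ 6`, the irreducible character `χ_n = π_n - 1` of degree `n-1` of the
alternating group `A_n` (where `π_n(g)` is the number of fixed points of `g`) is not QSI. -/
theorem alternating_deleted_permutation_char_not_isQSI (n : ℕ) (hn : 5 ≤ n) (hn6 : n ≠ 6) :
    ¬ IsQSI (fun g : ↥(alternatingGroup (Fin n)) =>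
        (Nat.card {x : Fin n // (g : Equiv.Perm (Fin n)) x = x} : ℂ) - 1) := by
  rintro ⟨U, φ, -, ⟨k, hk, hind⟩, K, hK, hKφ, hsol⟩
  have hfixcard : ∀ g : Equiv.Perm (Fin n),
      Nat.card {x : Fin n // g x = x} + g.cycleType.sum = n := by
    intro g
    rw [Equiv.Perm.sum_cycleType, Nat.card_eq_fintype_card, Fintype.card_subtype]
    have h := Finset.card_filter_add_card_filter_not (s := (Finset.univ : Finset (Fin n)))
      (fun x => g x = x)
    simpa [Equiv.Perm.support] using h
  have hsign : ∀ g : Equiv.Perm (Fin n), Even (g.cycleType.sum + g.cycleType.card) →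
      g ∈ alternatingGroup (Fin n) := by
    intro g hg
    rw [Equiv.Perm.mem_alternatingGroup, Equiv.Perm.sign_of_cycleType, hg.neg_one_pow]
  -- elements with `χ ≠ 0` are conjugate into `U`
  have hconj : ∀ g : alternatingGroup (Fin n),
      Nat.card {x : Fin n // (g : Equiv.Perm (Fin n)) x = x} ≠ 1 →
      ∃ y : alternatingGroup (Fin n), y⁻¹ * g * y ∈ U := by
    intro g hg
    by_contra! hcon
    have h1 := hind g
    have h2 : inducedChar U φ g = 0 := by
      simp [inducedChar, hcon]
    rw [h2] at h1
    have hk' : (k : ℂ) ≠ 0 := by exact_mod_cast hk.ne'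
    have h3 := (mul_eq_zero.mp h1).resolve_left hk'
    apply hg
    rw [sub_eq_zero] at h3
    exact_mod_cast h3
  have hle : alternatingGroup (Fin n) ≤ U.map (alternatingGroup (Fin n)).subtype := by
    apply alternating_le_core n hn hn6
    intro m hm1 hm2 hm3 hm4
    obtain ⟨g, hg⟩ := (Equiv.Perm.exists_with_cycleType_iff (Fin n)).mpr
      ⟨by simpa using hm1, hm2⟩
    have hgA := hsign g (by rw [hg]; exact hm3)
    have hc := hfixcard g
    rw [hg] at hc
    obtain ⟨y, hy⟩ := hconj ⟨g, hgA⟩ (by simp only; omega)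
    refine ⟨_, Subgroup.mem_map_of_mem _ hy, ?_⟩
    rw [← hg]
    have := Equiv.Perm.cycleType_conj (σ := g) (τ := (y : Equiv.Perm (Fin n))⁻¹)
    simpa using this
  have hU : ∀ g, g ∈ U := by
    intro g
    obtain ⟨u, hu, hug⟩ := hle g.2
    have : u = g := Subtype.ext hug
    exact this ▸ hu
  obtain rfl : U = ⊤ := by ext g; simp [hU]
  -- `U` is perfect, hence `K = ⊤`
  have hperf : commutator (alternatingGroup (Fin n)) = ⊤ :=
    commutator_alternatingGroup_eq_top (by simpa using hn)
  have hperf2 : commutator ((⊤ : Subgroup (alternatingGroup (Fin n))) ⧸ K) = ⊤ := by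
    have hs : Function.Surjective ((QuotientGroup.mk' K).comp
        (Subgroup.topEquiv (G := alternatingGroup (Fin n))).symm.toMonoidHom) :=
      (QuotientGroup.mk'_surjective K).comp (MulEquiv.surjective _)
    rw [commutator_def, ← Subgroup.map_top_of_surjective _ hs, ← Subgroup.map_commutator,
      ← commutator_def, hperf]
  have hsub : Subsingleton ((⊤ : Subgroup (alternatingGroup (Fin n))) ⧸ K) := by
    by_contra hnt
    rw [not_subsingleton_iff_nontrivial] at hnt
    have hs : Group.IsSolvable ((⊤ : Subgroup (alternatingGroup (Fin n))) ⧸ K) := hsol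
    exact (Group.IsSolvable.commutator_lt_top_of_nontrivial
      ((⊤ : Subgroup (alternatingGroup (Fin n))) ⧸ K)).ne hperf2
  have hKtop : K = ⊤ := QuotientGroup.subsingleton_iff.mp hsub
  have hφ : ∀ u, φ u = φ 1 := by
    intro u
    have : u ∈ (K : Set _) := by rw [hKtop]; simp
    rw [hKφ] at this
    exact this
  have hconst : ∀ g, inducedChar (⊤ : Subgroup (alternatingGroup (Fin n))) φ g =
      inducedChar (⊤ : Subgroup (alternatingGroup (Fin n))) φ 1 := by
    intro g
    unfold inducedChar
    congr 1
    apply finsum_congr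
    intro y
    rw [dif_pos (Subgroup.mem_top _), dif_pos (Subgroup.mem_top _), hφ, hφ ⟨y⁻¹ * 1 * y, _⟩]
  obtain ⟨g, hg⟩ := (Equiv.Perm.exists_with_cycleType_iff (Fin n) (m := {3})).mpr
      ⟨by simp; omega, by simp⟩
  have hgA := hsign g (by rw [hg]; simp; decide)
  have e := hconst ⟨g, hgA⟩
  rw [← hind, ← hind] at e
  have hk' : (k : ℂ) ≠ 0 := by exact_mod_cast hk.ne'
  have e2 := mul_left_cancel₀ hk' e
  rw [sub_left_inj] at e2
  have e3 : Nat.card {x : Fin n // g x = x} =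
      Nat.card {x : Fin n // (1 : Equiv.Perm (Fin n)) x = x} := by exact_mod_cast e2
  have f1 := hfixcard g
  have f2 := hfixcard 1
  rw [hg] at f1
  simp only [Equiv.Perm.cycleType_one, Multiset.sum_singleton, Multiset.sum_zero] at f1 f2
  omega
end
end

section
/- Let G be a finite group, p a prime, and χ an irreducible complex character of G whose degree χ(1) equals the p-part |G|_p of |G| (the largest power of p dividing |G|). If χ is QSI from a subgroup U ≤ G and φ ∈ Irr(U), then p does not divide |ker(φ)|. -/
open scoped BigOperators Classical

noncomputable section

/-- Character values of finite groups are algebraic integers. -/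
theorem aux_isIntegral_char {H : Type} [Group H] [Finite H] (V : FDRep ℂ H) (g : H) :
    IsIntegral ℤ (V.character g) := by
  have hs : (V.ρ g).charpoly.Splits := IsAlgClosed.splits _
  unfold FDRep.character
  rw [Module.End.trace_eq_sum_roots_charpoly_of_splits hs]
  refine IsIntegral.multiset_sum ?_
  intro μ hμ
  have hev : Module.End.HasEigenvalue (V.ρ g) μ := by
    rw [Module.End.hasEigenvalue_iff_isRoot_charpoly]
    exact Polynomial.isRoot_of_mem_roots hμ
  obtain ⟨v, hv⟩ := hev.exists_hasEigenvector
  have h1 : ∀ n : ℕ, ((V.ρ g) ^ n) v = μ ^ n • v := fun n => hv.pow_apply n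
  have h2 : μ ^ Nat.card H = 1 := by
    have h3 := h1 (Nat.card H)
    rw [← map_pow, pow_card_eq_one', map_one, Module.End.one_apply] at h3
    have h4 : (μ ^ Nat.card H - 1) • v = 0 := by
      rw [sub_smul, one_smul, ← h3, sub_self]
    rcases smul_eq_zero.mp h4 with h5 | h5
    · exact sub_eq_zero.mp h5
    · exact absurd h5 hv.2
  exact IsIntegral.of_pow Nat.card_pos (h2 ▸ isIntegral_one)

/-- Schur's lemma: an endomorphism commuting with a simple representation is scalar. -/
theorem aux_schur {H : Type} [Group H] [Finite H] (V : FDRep ℂ H)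
    [CategoryTheory.Simple V] (f : V →ₗ[ℂ] V) (hf : ∀ g, f ∘ₗ V.ρ g = V.ρ g ∘ₗ f) :
    ∃ c : ℂ, f = c • LinearMap.id := by
  have h1 : Module.finrank ℂ (Representation.linHom V.ρ V.ρ).invariants = 1 := by
    rw [LinearEquiv.finrank_eq (Representation.linHom.invariantsEquivFDRepHom V V),
      FDRep.finrank_hom_simple_simple, if_pos ⟨CategoryTheory.Iso.refl V⟩]
  have hid : (LinearMap.id : V →ₗ[ℂ] V) ∈ (Representation.linHom V.ρ V.ρ).invariants := by
    intro g
    ext x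
    simp [Representation.linHom_apply]
  have hfm : f ∈ (Representation.linHom V.ρ V.ρ).invariants := by
    intro g
    rw [Representation.linHom_apply, hf, ← LinearMap.comp_assoc]
    ext x
    simp
  by_cases hz : (LinearMap.id : V →ₗ[ℂ] V) = 0
  · refine ⟨0, ?_⟩
    ext x
    have hx : x = 0 := by simpa using LinearMap.congr_fun hz x
    simp [hx]
  · have h2 : (⟨LinearMap.id, hid⟩ : (Representation.linHom V.ρ V.ρ).invariants) ≠ 0 := by
      intro h
      exact hz (congrArg Subtype.val h)
    obtain ⟨c, hc⟩ := (finrank_eq_one_iff_of_nonzero' _ h2).mp h1 ⟨f, hfm⟩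
    exact ⟨c, (congrArg Subtype.val hc).symm⟩

/-- Elements of a subgroup on which the character is constant act trivially. -/
theorem aux_ker {H : Type} [Group H] [Finite H] (V : FDRep ℂ H) (K : Subgroup H)
    (hK : ∀ k ∈ K, V.character k = V.character 1) (k : H) (hk : k ∈ K) : V.ρ k = 1 := by
  have : Fintype K := Fintype.ofFinite K
  have : Invertible (Nat.card K : ℂ) := invertibleOfNonzero (by
    exact_mod_cast Nat.card_pos.ne')
  let σ : Representation ℂ K V := (V.ρ).comp K.subtype
  have h1 := Representation.card_inv_mul_sum_char_eq_finrank σ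
  have h2 : ∀ g : K, σ.character g = Module.finrank ℂ V := by
    intro g
    have := hK g g.2
    rw [FDRep.char_one] at this
    exact this
  simp only [h2, Finset.sum_const, Finset.card_univ, nsmul_eq_mul] at h1
  rw [Fintype.card_eq_nat_card, inv_mul_cancel_left₀ (Invertible.ne_zero _)] at h1
  have h3 : σ.invariants = ⊤ := Submodule.eq_top_of_finrank_eq (by exact_mod_cast h1.symm)
  ext x
  have hx : x ∈ σ.invariants := h3 ▸ Submodule.mem_top
  exact hx ⟨k, hk⟩

/-- Sum of a function constant on left cosets of a normal subgroup. -/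
theorem aux_sum_cosets {H M : Type} [Group H] [Fintype H] [AddCommMonoid M] (K : Subgroup H)
    (F : H → M) (hF : ∀ g, ∀ k ∈ K, F (g * k) = F g) :
    ∑ g : H, F g = Nat.card K • ∑ q : H ⧸ K, F q.out := by
  have : Fintype K := Fintype.ofFinite K
  have key : ∑ g : H, F g = ∑ x : (H ⧸ K) × K, F (x.1.out * x.2) := by
    refine Fintype.sum_equiv (Subgroup.groupEquivQuotientProdSubgroup (s := K)) _ _ ?_
    intro g
    have hg : ((g : H ⧸ K).out)⁻¹ * g ∈ K := by
      rw [← QuotientGroup.eq, QuotientGroup.out_eq']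
    have hfst : (Subgroup.groupEquivQuotientProdSubgroup (s := K) g).1 = (g : H ⧸ K) := rfl
    rw [hF _ _ (Subtype.prop _), hfst, ← hF (g : H ⧸ K).out _ hg, mul_inv_cancel_left]
  rw [key, Fintype.sum_prod_type, Finset.smul_sum]
  refine Finset.sum_congr rfl fun q _ => ?_
  rw [Finset.sum_congr rfl (fun (k : K) _ => hF q.out k k.2), Finset.sum_const, Finset.card_univ,
    Fintype.card_eq_nat_card]

/-- The degree of an irreducible character divides the index of its kernel. -/
theorem aux_dvd {H : Type} [Group H] [Finite H] (V : FDRep ℂ H)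
    [CategoryTheory.Simple V] (K : Subgroup H)
    (hK : ∀ k ∈ K, V.character k = V.character 1) :
    0 < Module.finrank ℂ V ∧ Module.finrank ℂ V * Nat.card K ∣ Nat.card H := by
  have : Fintype H := Fintype.ofFinite H
  have hH0 : (Nat.card H : ℂ) ≠ 0 := by exact_mod_cast Nat.card_pos.ne'
  have hK0 : (Nat.card K : ℂ) ≠ 0 := by exact_mod_cast Nat.card_pos.ne'
  have : Invertible (Nat.card H : ℂ) := invertibleOfNonzero hH0
  have horth := FDRep.char_orthonormal V V
  rw [if_pos ⟨CategoryTheory.Iso.refl V⟩, inv_mul_eq_one₀ hH0] at horth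
  let e : V →ₗ[ℂ] V := ∑ g : H, V.character g⁻¹ • V.ρ g
  have hcomm : ∀ g, e ∘ₗ V.ρ g = V.ρ g ∘ₗ e := by
    intro g
    change (∑ x : H, V.character x⁻¹ • V.ρ x) * V.ρ g =
      V.ρ g * (∑ x : H, V.character x⁻¹ • V.ρ x)
    rw [Finset.sum_mul, Finset.mul_sum]
    refine Fintype.sum_equiv (MulAut.conj g⁻¹).toEquiv _ _ ?_
    intro x
    have h1 : (MulAut.conj g⁻¹).toEquiv x = g⁻¹ * x * g := by simp
    rw [h1, smul_mul_assoc, mul_smul_comm, ← map_mul, ← map_mul]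
    have h2 : V.character (g⁻¹ * x * g)⁻¹ = V.character x⁻¹ := by
      rw [← V.char_conj x⁻¹ g⁻¹]
      congr 1
      group
    have h3 : g * (g⁻¹ * x * g) = x * g := by group
    rw [h2, h3]
  obtain ⟨c, hc⟩ := aux_schur V e hcomm
  have htr : c * Module.finrank ℂ V = Nat.card H := by
    have h1 : LinearMap.trace ℂ V e = ∑ g : H, V.character g * V.character g⁻¹ := by
      simp only [e, map_sum, map_smul, smul_eq_mul]
      exact Finset.sum_congr rfl fun g _ => mul_comm _ _
    rw [← horth, hc, map_smul, LinearMap.trace_id, smul_eq_mul] at h1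
    exact h1
  have hd0 : Module.finrank ℂ V ≠ 0 := by
    intro h
    rw [h, Nat.cast_zero, mul_zero] at htr
    exact hH0 htr.symm
  refine ⟨Nat.pos_of_ne_zero hd0, ?_⟩
  have hker := aux_ker V K hK
  have he : e = Nat.card K • ∑ q : H ⧸ K, V.character q.out⁻¹ • V.ρ q.out := by
    refine aux_sum_cosets K (fun g => V.character g⁻¹ • V.ρ g) ?_
    intro g k hk
    have h1 : V.ρ (g * k) = V.ρ g := by rw [map_mul, hker k hk, mul_one]
    have h2 : V.ρ (g * k)⁻¹ = V.ρ g⁻¹ := by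
      rw [mul_inv_rev, map_mul, hker k⁻¹ (K.inv_mem hk), one_mul]
    simp only [FDRep.character, h1, h2]
  set f : V →ₗ[ℂ] V := ∑ q : H ⧸ K, V.character q.out⁻¹ • V.ρ q.out with hfdef
  let c' : ℂ := c / Nat.card K
  have hf : ∀ x, f x = c' • x := by
    intro x
    have h1 : (Nat.card K : ℂ) • f x = c • x := by
      have := LinearMap.congr_fun (he.symm.trans hc) x
      simpa [Nat.cast_smul_eq_nsmul] using this
    rw [← inv_smul_smul₀ hK0 (f x), h1, smul_smul]
    congr 1
    simp only [c']
    field_simp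
  have : Nontrivial V := Module.nontrivial_of_finrank_pos (Nat.pos_of_ne_zero hd0)
  obtain ⟨v, hv⟩ := exists_ne (0 : V)
  let A := integralClosure ℤ ℂ
  let N : Submodule A V := Submodule.span A (Set.range fun g : H => V.ρ g v)
  have hint : IsIntegral A c' := by
    refine isIntegral_of_smul_mem_submodule N ?_ ?_ c' ?_
    · intro h
      have : v ∈ N := Submodule.subset_span ⟨1, by simp⟩
      rw [h] at this
      exact hv (by simpa using this)
    · exact Submodule.fg_span (Set.finite_range _)
    · intro n hn
      rw [← hf]
      have hρ : ∀ g : H, ∀ n ∈ N, V.ρ g n ∈ N := by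
        intro g n hn
        induction hn using Submodule.span_induction with
        | mem x hx =>
          obtain ⟨y, rfl⟩ := hx
          exact Submodule.subset_span ⟨g * y, by simp⟩
        | zero => simp
        | add x y _ _ hx hy => rw [map_add]; exact N.add_mem hx hy
        | smul a x _ hx =>
          have : V.ρ g (a • x) = a • V.ρ g x := (V.ρ g).map_smul (a : ℂ) x
          rw [this]
          exact N.smul_mem a hx
      rw [hfdef, LinearMap.sum_apply]
      refine N.sum_mem fun q _ => ?_
      exact N.smul_mem (⟨V.character q.out⁻¹, aux_isIntegral_char V _⟩ : A) (hρ _ n hn)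
  have hintZ : IsIntegral ℤ c' := isIntegral_trans c' hint
  have hd0' : (Module.finrank ℂ V : ℂ) ≠ 0 := by exact_mod_cast hd0
  let r : ℚ := (Nat.card H : ℚ) / (Module.finrank ℂ V * Nat.card K)
  have hr : algebraMap ℚ ℂ r = c' := by
    simp only [r, c', eq_ratCast]
    push_cast
    rw [← htr]
    field_simp
  rw [← hr, isIntegral_algebraMap_iff (algebraMap ℚ ℂ).injective,
    IsIntegrallyClosed.isIntegral_iff] at hintZ
  obtain ⟨m, hm⟩ := hintZ
  have hdK : ((Module.finrank ℂ V : ℚ) * Nat.card K) ≠ 0 := by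
    have : Nat.card K ≠ 0 := Nat.card_pos.ne'
    positivity
  have h1 : (m : ℚ) * (Module.finrank ℂ V * Nat.card K) = Nat.card H := by
    have : (m : ℚ) = r := by simpa using hm
    rw [this]
    exact div_mul_cancel₀ _ hdK
  have h2 : ((Module.finrank ℂ V * Nat.card K : ℕ) : ℤ) ∣ (Nat.card H : ℤ) := by
    refine ⟨m, ?_⟩
    have h3 : m * ((Module.finrank ℂ V : ℤ) * Nat.card K) = Nat.card H := by exact_mod_cast h1
    rw [← h3]
    push_cast
    ring
  exact_mod_cast h2

/-- If `χ ∈ Irr(G)` has degree equal to the `p`-part `|G|_p` of `|G|` (as the Steinberg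
character of a group of Lie type in defining characteristic `p` does), and `χ` is QSI from
`U` and `φ`, then `p` does not divide `|ker(φ)|`. -/
theorem not_dvd_card_ker_of_degree_eq_p_part (G : Type) [Group G] [Finite G]
    (p : ℕ) (hp : p.Prime)
    (χ : G → ℂ) (hχirr : IsIrreducibleCharacter G χ)
    (hdeg : χ 1 = ((p ^ (Nat.card G).factorization p : ℕ) : ℂ))
    (U : Subgroup G) (φ : ↥U → ℂ) (h : IsQSIFrom χ U φ) :
    ¬ p ∣ Nat.card {u : ↥U // φ u = φ 1} := by
  obtain ⟨⟨V, hV, rfl⟩, ⟨k, hk, hind⟩, K, hKn, hKset, -⟩ := h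
  have := hV
  have hKmem : ∀ u, u ∈ K ↔ V.character u = V.character 1 := by
    intro u
    rw [← SetLike.mem_coe, hKset]
    rfl
  have hcard : Nat.card {u : ↥U // V.character u = V.character 1} = Nat.card K :=
    Nat.card_congr (Equiv.subtypeEquivRight fun u => (hKmem u).symm)
  rw [hcard]
  intro hdvd
  obtain ⟨hd, m, hm⟩ := aux_dvd V K fun u hu => (hKmem u).mp hu
  have : Fintype G := Fintype.ofFinite G
  have hU0 : (Nat.card U : ℂ) ≠ 0 := by exact_mod_cast Nat.card_pos.ne'
  have h1 := hind 1
  have h2 : inducedChar U V.character 1 =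
      (Nat.card U : ℂ)⁻¹ * (Nat.card G * Module.finrank ℂ V) := by
    unfold inducedChar
    rw [finsum_eq_sum_of_fintype]
    congr 1
    have : ∀ y : G, (if h : y⁻¹ * 1 * y ∈ U then V.character ⟨y⁻¹ * 1 * y, h⟩ else 0) =
        (Module.finrank ℂ V : ℂ) := by
      intro y
      have hy : y⁻¹ * 1 * y = 1 := by group
      have hmem : y⁻¹ * 1 * y ∈ U := by rw [hy]; exact U.one_mem
      rw [dif_pos hmem, ← FDRep.char_one]
      congr 1
      exact Subtype.ext hy
    rw [Finset.sum_congr rfl fun y _ => this y]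
    simp [Finset.card_univ, Nat.card_eq_fintype_card]
  rw [h2, hdeg, eq_inv_mul_iff_mul_eq₀ hU0] at h1
  have h3 : Nat.card U * (k * p ^ (Nat.card G).factorization p) =
      Nat.card G * Module.finrank ℂ V := by exact_mod_cast h1
  have h4 : Nat.card K * m * (k * p ^ (Nat.card G).factorization p) = Nat.card G := by
    refine Nat.eq_of_mul_eq_mul_right hd ?_
    rw [← h3, hm]
    ring
  have h5 : p ^ ((Nat.card G).factorization p + 1) ∣ Nat.card G := by
    obtain ⟨t, ht⟩ := hdvd
    refine ⟨t * m * k, ?_⟩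
    rw [pow_succ]
    conv_lhs => rw [← h4, ht]
    ring
  exact Nat.pow_succ_factorization_not_dvd Nat.card_pos.ne' hp h5
end
end
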